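/- Assume the transversality hypothesis and auxiliary hypothesis 2, and suppose that there is no real analytic solution of the functional equation, other than the identically zero solution, in any nonempty open subset of ℝ³. Then for every compact interval I ⊂ ℝ∖{0} and ball B there exist κ > 0 and C < ∞ with the following property. Let ε ∈ (0,1], and let f = (f₁,f₂,f₃) be a triple of Lebesgue measurable functions such that for some i ∈ {1,2,3}, |f_i(Φ_i(x,s))| ≥ 1 for every (x,s) ∈ B×I. Then the Lebesgue measure of the set {(x,s) ∈ B×I : |Σ_{j=1}^3 f_j(Φ_j(x,s))·∇φ_j(x)| ≤ ε} is at most C ε^κ. -/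

import Mathlib

open MeasureTheory Real Set Filter Metric
open scoped FourierTransform ENNReal NNReal Topology ComplexConjugate

noncomputable section

abbrev Vec2 : Type := ℝ × ℝ

/-- The quadrilinear form `T(f) = ∫ ∏ⱼ fⱼ(φⱼ(x)) η(x) dx`. -/
def Tform (φ : Fin 4 → Vec2 → ℝ) (η : Vec2 → ℝ) (f : Fin 4 → ℝ → ℂ) : ℂ :=
  ∫ x : Vec2, (∏ j : Fin 4, f j (φ j x)) * (η x : ℂ)
/-- `D = ∂/∂x₂`. -/
def Dder (φ : Vec2 → ℝ) (x : Vec2) : ℝ := fderiv ℝ φ x ((0, 1) : Vec2)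

/-- `Φⱼ(x,s) = (φⱼ(x), s·Dφⱼ(x))`. -/
def Φmap (φ : Vec2 → ℝ) (p : Vec2 × ℝ) : Vec2 := (φ p.1, p.2 * Dder φ p.1)

section SM1
lemma sub1D_base (J : Set ℝ) (hJ : J.OrdConnected) (g g' : ℝ → ℝ) (c : ℝ) (hc : 0 < c)
    (hg : ∀ t ∈ J, HasDerivAt g (g' t) t) (hl : ∀ t ∈ J, c ≤ g' t) (δ : ℝ) (hδ : 0 < δ) :
    volume {t | t ∈ J ∧ |g t| ≤ δ} ≤ ENNReal.ofReal (2 * (δ / c)) := by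
  refine (Real.volume_le_diam _).trans ?_
  refine Metric.ediam_le ?_
  have key : ∀ x ∈ J, ∀ y ∈ J, x ≤ y → c * (y - x) ≤ g y - g x := by
    intro x hx y hy hxy
    refine hJ.convex.mul_sub_le_image_sub_of_le_deriv
      (fun t ht => (hg t ht).continuousAt.continuousWithinAt)
      (fun t ht => (hg t (interior_subset ht)).differentiableAt.differentiableWithinAt) ?_ x hx y hy hxy
    intro t ht
    rw [(hg t (interior_subset ht)).deriv]
    exact hl t (interior_subset ht)
  have k2 : ∀ x ∈ J, ∀ y ∈ J, |g x| ≤ δ → |g y| ≤ δ → x ≤ y → |x - y| ≤ 2 * (δ / c) := by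
    intro x hx y hy h1 h2 hxy
    have := key x hx y hy hxy
    rw [abs_le] at h1 h2
    rw [abs_sub_comm, abs_of_nonneg (by linarith)]
    have : c * (y - x) ≤ 2 * δ := by linarith
    have h3 : y - x ≤ 2 * δ / c := by rw [le_div_iff₀ hc]; linarith
    linarith [mul_div_assoc 2 δ c]
  rintro x ⟨hx, hx'⟩ y ⟨hy, hy'⟩
  rw [edist_dist, Real.dist_eq]
  apply ENNReal.ofReal_le_ofReal
  rcases le_total x y with h | h
  · exact k2 x hx y hy hx' hy' h
  · rw [abs_sub_comm]; exact k2 y hy x hx hy' hx' h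

lemma sub1D (m : ℕ) : ∃ C : ℝ, 0 ≤ C ∧ ∀ (J : Set ℝ), J.OrdConnected → ∀ (g : ℕ → ℝ → ℝ),
    (∀ n ≤ m, ∀ t ∈ J, HasDerivAt (g n) (g (n+1) t) t) → ∀ c : ℝ, 0 < c →
    (∀ t ∈ J, c ≤ g (m+1) t) → ∀ δ : ℝ, 0 < δ →
    volume {t | t ∈ J ∧ |g 0 t| ≤ δ} ≤ ENNReal.ofReal (C * (δ / c) ^ ((1:ℝ) / ((m:ℝ)+1))) := by
  induction m with
  | zero =>
    refine ⟨2, by norm_num, ?_⟩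
    intro J hJ g hg c hc hl δ hδ
    have := sub1D_base J hJ (g 0) (g 1) c hc (hg 0 le_rfl) hl δ hδ
    simpa using this
  | succ m ih =>
    obtain ⟨C, hC0, hC⟩ := ih
    refine ⟨2 + 2 * C, by positivity, ?_⟩
    intro J hJ g hg c hc hl δ hδ
    set θ : ℝ := (δ / c) ^ ((1:ℝ) / ((m:ℝ)+1+1)) with hθ
    have hθ0 : 0 < θ := by positivity
    have hpow : (δ / (c * θ)) ^ ((1:ℝ) / ((m:ℝ)+1)) = θ := by
      have h1 : δ / (c * θ) = (δ / c) ^ (((m:ℝ)+1) / ((m:ℝ)+1+1)) := by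
        have : ((m:ℝ)+1) / ((m:ℝ)+1+1) = 1 - (1:ℝ) / ((m:ℝ)+1+1) := by
          field_simp; ring
        rw [this, Real.rpow_sub (by positivity), Real.rpow_one, ← hθ]
        field_simp
      rw [h1, ← Real.rpow_mul (by positivity), hθ]
      congr 1
      field_simp
    have hmono : ∀ x ∈ J, ∀ y ∈ J, x ≤ y → g (m+1) x ≤ g (m+1) y := by
      have : MonotoneOn (g (m+1)) J := by
        refine monotoneOn_of_deriv_nonneg hJ.convex
          (fun t ht => (hg (m+1) le_rfl t ht).continuousAt.continuousWithinAt)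
          (fun t ht => (hg (m+1) le_rfl t (interior_subset ht)).differentiableAt.differentiableWithinAt) ?_
        intro t ht
        rw [(hg (m+1) le_rfl t (interior_subset ht)).deriv]
        exact hc.le.trans (hl t (interior_subset ht))
      exact fun x hx y hy h => this hx hy h
    have hη : 0 < c * θ := by positivity
    have h1 := sub1D_base J hJ (g (m+1)) (g (m+2)) c hc (hg (m+1) le_rfl) hl (c*θ) hη
    have h2 := hC {t | t ∈ J ∧ c * θ ≤ g (m+1) t} (by
      constructor
      rintro x ⟨hx, hx'⟩ y ⟨hy, hy'⟩ z hz
      have hzJ := hJ.out hx hy hz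
      exact ⟨hzJ, hx'.trans (hmono x hx z hzJ hz.1)⟩) g
      (fun n hn t ht => hg n (by omega) t ht.1) (c * θ) hη (fun t ht => ht.2) δ hδ
    have h3 := hC {t | t ∈ J ∧ g (m+1) t ≤ - (c * θ)} (by
      constructor
      rintro x ⟨hx, hx'⟩ y ⟨hy, hy'⟩ z hz
      have hzJ := hJ.out hx hy hz
      exact ⟨hzJ, (hmono z hzJ y hy hz.2).trans hy'⟩) (fun n t => - g n t)
      (fun n hn t ht => (hg n (by omega) t ht.1).neg) (c * θ) hη (fun t ht => by
        have := ht.2; linarith) δ hδ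
    rw [hpow] at h2 h3
    have hsub : {t | t ∈ J ∧ |g 0 t| ≤ δ} ⊆ {t | t ∈ J ∧ |g (m+1) t| ≤ c * θ} ∪
        ({t | t ∈ {t | t ∈ J ∧ c * θ ≤ g (m+1) t} ∧ |g 0 t| ≤ δ} ∪
        {t | t ∈ {t | t ∈ J ∧ g (m+1) t ≤ - (c * θ)} ∧ |(fun n t => - g n t) 0 t| ≤ δ}) := by
      rintro t ⟨ht, ht'⟩
      by_cases hh : |g (m+1) t| ≤ c * θ
      · exact Or.inl ⟨ht, hh⟩
      · right
        rw [not_le, lt_abs] at hh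
        rcases hh with hh | hh
        · left; exact ⟨⟨ht, hh.le⟩, ht'⟩
        · right; exact ⟨⟨ht, by linarith⟩, by simpa using ht'⟩
    refine (measure_mono hsub).trans ((measure_union_le _ _).trans ?_)
    refine (add_le_add h1 ((measure_union_le _ _).trans (add_le_add h2 h3))).trans ?_
    rw [← ENNReal.ofReal_add (by positivity) (by positivity), ← ENNReal.ofReal_add (by positivity) (by positivity)]
    apply ENNReal.ofReal_le_ofReal
    have : c * θ / c = θ := by field_simp
    rw [this]
    push_cast
    rw [← hθ]
    linarith

/-- directional derivative -/
def dirD {E : Type*} [NormedAddCommGroup E] [NormedSpace ℝ E] (v : E) (Q : E → ℝ) : E → ℝ :=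
  fun p => fderiv ℝ Q p v

section
variable {E : Type*} [NormedAddCommGroup E] [NormedSpace ℝ E]

lemma dirD_an (v : E) (Q : E → ℝ) (U : Set E) (h : AnalyticOnNhd ℝ Q U) [CompleteSpace E] :
    AnalyticOnNhd ℝ (dirD v Q) U := by
  intro p hp
  exact ((ContinuousLinearMap.apply ℝ ℝ v).analyticAt _).comp (h p hp).fderiv

lemma dirD_iter_an (v : E) (Q : E → ℝ) (U : Set E) (h : AnalyticOnNhd ℝ Q U) [CompleteSpace E] (n : ℕ) :
    AnalyticOnNhd ℝ ((dirD v)^[n] Q) U := by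
  induction n with
  | zero => exact h
  | succ n ih => rw [Function.iterate_succ_apply']; exact dirD_an v _ U ih

lemma dirD_hasDeriv (v : E) (Q : E → ℝ) (p : E) (t : ℝ)
    (h : AnalyticAt ℝ Q (p + t • v)) :
    HasDerivAt (fun t : ℝ => Q (p + t • v)) (dirD v Q (p + t • v)) t := by
  have h1 : HasDerivAt (fun t : ℝ => p + t • v) v t := by
    have := ((hasDerivAt_id t).smul_const v).const_add p
    simpa using this
  exact h.differentiableAt.hasFDerivAt.comp_hasDerivAt t h1

lemma exists_dirD_ne (P : E → ℝ) [CompleteSpace E] (p0 : E) (h : AnalyticAt ℝ P p0)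
    (hne : ¬ (∀ᶠ p in 𝓝 p0, P p = 0)) : ∃ v m, (dirD v)^[m] P p0 ≠ 0 := by
  by_contra hcon
  push Not at hcon
  obtain ⟨ρ, hρ, hball⟩ := Metric.eventually_nhds_iff_ball.1 h.eventually_analyticAt
  apply hne
  rw [Metric.eventually_nhds_iff_ball]
  refine ⟨ρ, hρ, fun p1 hp1 => ?_⟩
  set v := p1 - p0 with hv
  set T : Set ℝ := {t : ℝ | p0 + t • v ∈ ball p0 ρ} with hT
  have hTo : IsOpen T := isOpen_ball.preimage (by fun_prop)
  have hTc : Convex ℝ T := by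
    have : T = (AffineMap.lineMap p0 p1 : ℝ →ᵃ[ℝ] E) ⁻¹' ball p0 ρ := by
      ext t; simp [hT, AffineMap.lineMap_apply, hv, add_comm]
    rw [this]; exact (convex_ball p0 ρ).affine_preimage _
  have h0T : (0:ℝ) ∈ T := by simp [hT, hρ]
  have h1T : (1:ℝ) ∈ T := by simpa [hT, hv, dist_eq_norm] using hp1
  have hder : ∀ n : ℕ, ∀ t ∈ T, iteratedDeriv n (fun t : ℝ => P (p0 + t • v)) t
      = (dirD v)^[n] P (p0 + t • v) := by
    intro n
    induction n with
    | zero => intro t ht; simp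
    | succ n ih =>
      intro t ht
      rw [iteratedDeriv_succ, Function.iterate_succ_apply']
      have he : iteratedDeriv n (fun t : ℝ => P (p0 + t • v)) =ᶠ[𝓝 t]
          fun t => (dirD v)^[n] P (p0 + t • v) := by
        filter_upwards [hTo.mem_nhds ht] with y hy using ih y hy
      rw [he.deriv_eq]
      exact (dirD_hasDeriv v _ p0 t
        (dirD_iter_an v P (ball p0 ρ) (fun p hp => hball p hp) n _ ht)).deriv
  have han : AnalyticOnNhd ℝ (fun t : ℝ => P (p0 + t • v)) T := by
    intro t ht
    refine AnalyticAt.fun_comp (hball _ ht) ?_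
    fun_prop
  have hz : ∀ᶠ t in 𝓝 (0:ℝ), P (p0 + t • v) = 0 := by
    rw [← analyticOrderAt_eq_top]
    rw [ENat.eq_top_iff_forall_ge]
    intro n
    rw [natCast_le_analyticOrderAt_iff_iteratedDeriv_eq_zero (han 0 h0T)]
    intro i hi
    rw [hder i 0 h0T]
    simpa using hcon v i
  have := han.eqOn_zero_of_preconnected_of_eventuallyEq_zero hTc.isPreconnected h0T hz h1T
  simpa [hv] using this

end

end SM1

section SM1b
section
variable {E : Type*} [NormedAddCommGroup E] [NormedSpace ℝ E] [FiniteDimensional ℝ E]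
  [MeasurableSpace E] [BorelSpace E] (μ : Measure E) [μ.IsAddHaarMeasure]

/-- polynomial sublevel bound on a set -/
def SubBd (P : E → ℝ) (s : Set E) : Prop :=
  ∃ κ : ℝ, 0 < κ ∧ ∃ C : ℝ, 0 ≤ C ∧ ∀ δ : ℝ, 0 < δ → δ ≤ 1 →
    μ {p | p ∈ s ∧ |P p| ≤ δ} ≤ ENNReal.ofReal (C * δ ^ κ)

lemma SubBd.mono {P : E → ℝ} {s t : Set E} (h : SubBd μ P t) (hst : s ⊆ t) : SubBd μ P s := by
  obtain ⟨κ, hκ, C, hC, H⟩ := h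
  exact ⟨κ, hκ, C, hC, fun δ h1 h2 => (measure_mono (fun p (hp : p ∈ s ∧ |P p| ≤ δ) => (⟨hst hp.1, hp.2⟩ : p ∈ t ∧ |P p| ≤ δ))).trans (H δ h1 h2)⟩

lemma SubBd.union {P : E → ℝ} {s t : Set E} (h : SubBd μ P s) (h' : SubBd μ P t) :
    SubBd μ P (s ∪ t) := by
  obtain ⟨κ, hκ, C, hC, H⟩ := h
  obtain ⟨κ', hκ', C', hC', H'⟩ := h'
  refine ⟨min κ κ', lt_min hκ hκ', C + C', by positivity, fun δ h1 h2 => ?_⟩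
  have : {p | p ∈ s ∪ t ∧ |P p| ≤ δ} ⊆ {p | p ∈ s ∧ |P p| ≤ δ} ∪ {p | p ∈ t ∧ |P p| ≤ δ} := by
    rintro p ⟨hp | hp, hp'⟩
    · exact Or.inl ⟨hp, hp'⟩
    · exact Or.inr ⟨hp, hp'⟩
  refine (measure_mono this).trans ((measure_union_le _ _).trans ((add_le_add (H δ h1 h2) (H' δ h1 h2)).trans ?_))
  rw [← ENNReal.ofReal_add (by positivity) (by positivity), add_mul]
  apply ENNReal.ofReal_le_ofReal
  exact add_le_add (mul_le_mul_of_nonneg_left (Real.rpow_le_rpow_of_exponent_ge h1 h2 (min_le_left _ _)) hC)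
    (mul_le_mul_of_nonneg_left (Real.rpow_le_rpow_of_exponent_ge h1 h2 (min_le_right _ _)) hC')

lemma translate_bound (A : Set E) (hA : MeasurableSet A) (p0 : E) (ρ : ℝ)
    (hAb : A ⊆ closedBall p0 ρ) (v : E) (τ : ℝ) (hτ : 0 ≤ τ) (hτv : τ * ‖v‖ ≤ ρ) (b : ℝ≥0∞)
    (hb : ∀ q ∈ closedBall p0 (2*ρ), volume {t : ℝ | t ∈ Icc 0 τ ∧ q + t • v ∈ A} ≤ b) :
    ENNReal.ofReal τ * μ A ≤ b * μ (closedBall p0 (2*ρ)) := by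
  set S : Set (E × ℝ) := {z | z.2 ∈ Icc 0 τ ∧ z.1 + z.2 • v ∈ A} with hS
  have hSm : MeasurableSet S := by
    have h1 : MeasurableSet {z : E × ℝ | z.2 ∈ Icc 0 τ} := measurable_snd measurableSet_Icc
    have h2 : MeasurableSet {z : E × ℝ | z.1 + z.2 • v ∈ A} := by
      have : Measurable fun z : E × ℝ => z.1 + z.2 • v := by fun_prop
      exact this hA
    exact h1.inter h2
  have e1 : (μ.prod volume) S = ENNReal.ofReal τ * μ A := by
    rw [Measure.prod_apply_symm hSm]
    have : ∀ t : ℝ, μ ((fun x => (x, t)) ⁻¹' S) = (Icc 0 τ).indicator (fun _ => μ A) t := by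
      intro t
      by_cases ht : t ∈ Icc 0 τ
      · rw [indicator_of_mem ht]
        have : (fun x => (x, t)) ⁻¹' S = (fun x => x + t • v) ⁻¹' A := by
          ext x; simp only [hS, mem_preimage, mem_ofPred_eq]; exact ⟨fun h => h.2, fun h => ⟨ht, h⟩⟩
        rw [this, measure_preimage_add_right]
      · rw [indicator_of_notMem ht]
        have : (fun x => (x, t)) ⁻¹' S = ∅ := by
          ext x; simp only [hS, mem_preimage, mem_ofPred_eq, mem_empty_iff_false, iff_false]
          exact fun h => ht h.1
        rw [this, measure_empty]
    simp_rw [this]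
    rw [lintegral_indicator measurableSet_Icc, setLIntegral_const, Real.volume_Icc, mul_comm, sub_zero]
  have e2 : (μ.prod volume) S ≤ b * μ (closedBall p0 (2*ρ)) := by
    rw [Measure.prod_apply hSm]
    have : ∀ q : E, volume (Prod.mk q ⁻¹' S) ≤ (closedBall p0 (2*ρ)).indicator (fun _ => b) q := by
      intro q
      by_cases hq : q ∈ closedBall p0 (2*ρ)
      · rw [indicator_of_mem hq]; exact hb q hq
      · rw [indicator_of_notMem hq]
        have : Prod.mk q ⁻¹' S = ∅ := by
          ext t; simp only [hS, mem_preimage, mem_ofPred_eq, mem_empty_iff_false, iff_false]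
          rintro ⟨ht, hA'⟩
          apply hq
          have h3 := hAb hA'
          rw [mem_closedBall, dist_eq_norm] at h3 ⊢
          have h4 : ‖t • v‖ ≤ ρ := by
            rw [norm_smul, Real.norm_eq_abs, abs_of_nonneg ht.1]
            exact (mul_le_mul_of_nonneg_right ht.2 (norm_nonneg _)).trans hτv
          calc ‖q - p0‖ = ‖(q + t • v - p0) - t • v‖ := by congr 1; abel
            _ ≤ _ := norm_sub_le _ _
            _ ≤ 2 * ρ := by linarith
        rw [this, measure_empty]
    refine (lintegral_mono this).trans ?_
    rw [lintegral_indicator measurableSet_closedBall, setLIntegral_const]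
  rw [← e1]; exact e2

lemma subBd_local (P : E → ℝ) (p0 : E) (h : AnalyticAt ℝ P p0)
    (hne : ¬ (∀ᶠ p in 𝓝 p0, P p = 0)) : ∃ U ∈ 𝓝 p0, SubBd μ P U := by
  have : CompleteSpace E := FiniteDimensional.complete ℝ E
  obtain ⟨v, m, hm⟩ := exists_dirD_ne P p0 h hne
  -- choose sign
  obtain ⟨sg, hsg, hpos⟩ : ∃ sg : ℝ, |sg| = 1 ∧ 0 < sg * (dirD v)^[m] P p0 := by
    rcases lt_or_gt_of_ne hm with h1 | h1
    · exact ⟨-1, by simp, by linarith⟩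
    · exact ⟨1, by simp, by linarith⟩
  obtain ⟨ρ1, hρ1, hball1⟩ := Metric.eventually_nhds_iff_ball.1 h.eventually_analyticAt
  set c := sg * (dirD v)^[m] P p0 / 2 with hc
  have hc0 : 0 < c := by positivity
  have hcont : ContinuousAt (fun p => sg * (dirD v)^[m] P p) p0 :=
    continuousAt_const.mul (dirD_iter_an v P (ball p0 ρ1) (fun p hp => hball1 p hp) m p0 (mem_ball_self hρ1)).continuousAt
  have hev : ∀ᶠ p in 𝓝 p0, c < sg * (dirD v)^[m] P p :=
    hcont.eventually (lt_mem_nhds (by rw [hc]; linarith))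
  obtain ⟨ρ2, hρ2, hball2⟩ := Metric.eventually_nhds_iff_ball.1 hev
  set ρ := min ρ1 ρ2 / 4 with hρ
  have hρ0 : 0 < ρ := by have := lt_min hρ1 hρ2; positivity
  have hr1 : 4 * ρ ≤ ρ1 := by rw [hρ]; linarith [min_le_left ρ1 ρ2]
  have hr2 : 4 * ρ ≤ ρ2 := by rw [hρ]; linarith [min_le_right ρ1 ρ2]
  have han : ∀ p ∈ closedBall p0 (3 * ρ), AnalyticAt ℝ P p := fun p hp => hball1 p (by
    rw [mem_closedBall] at hp; rw [mem_ball]; linarith)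
  have hlow : ∀ p ∈ closedBall p0 (3 * ρ), c ≤ sg * (dirD v)^[m] P p := fun p hp => (hball2 p (by
    rw [mem_closedBall] at hp; rw [mem_ball]; linarith)).le
  refine ⟨closedBall p0 ρ, closedBall_mem_nhds p0 hρ0, ?_⟩
  have hsub : closedBall p0 ρ ⊆ closedBall p0 (3*ρ) := closedBall_subset_closedBall (by linarith)
  rcases m with _ | m
  · refine ⟨1, one_pos, (μ (closedBall p0 ρ)).toReal / c, by positivity, fun δ h1 h2 => ?_⟩
    by_cases hδ : δ < c
    · have : {p | p ∈ closedBall p0 ρ ∧ |P p| ≤ δ} = ∅ := by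
        ext p; simp only [mem_ofPred_eq, mem_empty_iff_false, iff_false]
        rintro ⟨hp, hp'⟩
        have := hlow p (hsub hp)
        have h3 : sg * P p ≤ |P p| := by
          calc sg * P p ≤ |sg * P p| := le_abs_self _
            _ = |P p| := by rw [abs_mul, hsg, one_mul]
        simp at this; linarith
      rw [this, measure_empty]; simp
    · refine (measure_mono (fun p hp => hp.1) : _ ≤ μ (closedBall p0 ρ)).trans ?_
      have hfin : μ (closedBall p0 ρ) ≠ ⊤ := measure_closedBall_lt_top.ne
      conv_lhs => rw [← ENNReal.ofReal_toReal hfin]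
      apply ENNReal.ofReal_le_ofReal
      rw [Real.rpow_one, div_mul_eq_mul_div, le_div_iff₀ hc0]
      gcongr; linarith
  · obtain ⟨C, hC0, hC⟩ := sub1D m
    set τ := ρ / (‖v‖ + 1) with hτ
    have hτ0 : 0 < τ := by positivity
    have hτv : τ * ‖v‖ ≤ ρ := by
      rw [hτ, div_mul_eq_mul_div, div_le_iff₀ (by positivity)]
      nlinarith [norm_nonneg v]
    set M := (μ (closedBall p0 (2*ρ))).toReal with hM
    have hfin : μ (closedBall p0 (2*ρ)) ≠ ⊤ := measure_closedBall_lt_top.ne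
    refine ⟨1 / ((m:ℝ)+1), by positivity, C * (1/c) ^ ((1:ℝ) / ((m:ℝ)+1)) * M / τ, by positivity, fun δ h1 h2 => ?_⟩
    set A := {p | p ∈ closedBall p0 ρ ∧ |P p| ≤ δ} with hA
    have hAm : MeasurableSet A := by
      have hcP : ContinuousOn (fun p => |P p|) (closedBall p0 ρ) := fun p hp =>
        ((han p (hsub hp)).continuousAt.abs).continuousWithinAt
      have : A = closedBall p0 ρ ∩ (fun p => |P p|) ⁻¹' Iic δ := by ext; simp [hA]
      rw [this]
      exact (hcP.preimage_isClosed_of_isClosed isClosed_closedBall isClosed_Iic).measurableSet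
    have hb : ∀ q ∈ closedBall p0 (2*ρ), volume {t : ℝ | t ∈ Icc 0 τ ∧ q + t • v ∈ A} ≤
        ENNReal.ofReal (C * (δ/c) ^ ((1:ℝ) / ((m:ℝ)+1))) := by
      intro q hq
      have hmem : ∀ t ∈ Icc 0 τ, q + t • v ∈ closedBall p0 (3*ρ) := by
        intro t ht
        rw [mem_closedBall, dist_eq_norm] at hq ⊢
        have h4 : ‖t • v‖ ≤ ρ := by
          rw [norm_smul, Real.norm_eq_abs, abs_of_nonneg ht.1]
          exact (mul_le_mul_of_nonneg_right ht.2 (norm_nonneg _)).trans hτv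
        calc ‖q + t • v - p0‖ = ‖(q - p0) + t • v‖ := by congr 1; abel
            _ ≤ _ := norm_add_le _ _
            _ ≤ 3 * ρ := by linarith
      refine le_trans (measure_mono ?_) (hC (Icc 0 τ) ordConnected_Icc
        (fun n t => sg * (dirD v)^[n] P (q + t • v)) ?_ c hc0 (fun t ht => hlow _ (hmem t ht)) δ h1)
      · rintro t ⟨ht, ht'⟩
        refine ⟨ht, ?_⟩
        rw [abs_mul, hsg, one_mul]; exact ht'.2
      · intro n hn t ht
        rw [Function.iterate_succ_apply']
        exact (dirD_hasDeriv v _ q t (dirD_iter_an v P _ han n _ (hmem t ht))).const_mul sg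
    have key := translate_bound μ A hAm p0 ρ (fun p hp => hp.1) v τ hτ0.le hτv _ hb
    have hAf : μ A ≠ ⊤ := ne_top_of_le_ne_top (measure_closedBall_lt_top (x := p0) (r := ρ)).ne (measure_mono (fun p hp => hp.1))
    have key2 : τ * (μ A).toReal ≤ C * (δ/c) ^ ((1:ℝ) / ((m:ℝ)+1)) * M := by
      have := ENNReal.toReal_mono (by finiteness) key
      rwa [ENNReal.toReal_mul, ENNReal.toReal_mul, ENNReal.toReal_ofReal hτ0.le, ENNReal.toReal_ofReal (by positivity)] at this
    conv_lhs => rw [← ENNReal.ofReal_toReal hAf]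
    apply ENNReal.ofReal_le_ofReal
    rw [div_mul_eq_mul_div, le_div_iff₀ hτ0]
    have : (δ/c) ^ ((1:ℝ) / ((m:ℝ)+1)) = (1/c) ^ ((1:ℝ) / ((m:ℝ)+1)) * δ ^ ((1:ℝ) / ((m:ℝ)+1)) := by
      rw [← Real.mul_rpow (by positivity) (by positivity)]; congr 1; ring
    rw [this] at key2
    nlinarith [key2]

lemma subBd_compact (P : E → ℝ) (O : Set E) (hO : IsPreconnected O)
    (h : AnalyticOnNhd ℝ P O) (ps : E) (hps : ps ∈ O) (hne : P ps ≠ 0) (K : Set E) (hK : IsCompact K)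
    (hKO : K ⊆ O) : SubBd μ P K := by
  refine hK.induction_on (p := fun s => SubBd μ P s) ?_ (fun s t hst ht => ht.mono μ hst)
    (fun s t hs ht => hs.union μ ht) ?_
  · exact ⟨1, one_pos, 0, le_rfl, fun δ _ _ => by simp⟩
  · intro x hx
    obtain ⟨U, hU, hS⟩ := subBd_local μ P x (h x (hKO hx)) (fun hev => hne
      (h.eqOn_zero_of_preconnected_of_eventuallyEq_zero hO (hKO hx) hev hps))
    exact ⟨U, mem_nhdsWithin_of_mem_nhds hU, hS⟩
end

end SM1b

section SM2
lemma an_clm_apply {E F G : Type*} [NormedAddCommGroup E] [NormedSpace ℝ E] [NormedAddCommGroup F] [NormedSpace ℝ F]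
    [NormedAddCommGroup G] [NormedSpace ℝ G] {f : E → (F →L[ℝ] G)} {g : E → F} {x : E}
    (hf : AnalyticAt ℝ f x) (hg : AnalyticAt ℝ g x) : AnalyticAt ℝ (fun y => f y (g y)) x :=
  ((ContinuousLinearMap.id ℝ (F →L[ℝ] G)).analyticAt_bilinear (f x, g x)).comp₂ hf hg

lemma analyticAt_of_hasFDerivAt {E : Type*} [NormedAddCommGroup E] [NormedSpace ℝ E]
    (L : E → ℝ) (ω : E → (E →L[ℝ] ℝ)) (p0 : E) (hω : AnalyticAt ℝ ω p0)
    (hL : ∀ᶠ p in 𝓝 p0, HasFDerivAt L (ω p) p) : AnalyticAt ℝ L p0 := by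
  obtain ⟨q, r, hq⟩ := hω
  obtain ⟨ρ, hρ, hb⟩ := Metric.eventually_nhds_iff_ball.1 hL
  set r1 : ℝ≥0∞ := min r (ENNReal.ofReal ρ) with hr1
  have hr1pos : 0 < r1 := lt_min hq.r_pos (by simpa using hρ)
  have hq1 : HasFPowerSeriesOnBall ω q p0 r1 := hq.mono hr1pos (min_le_left _ _)
  let q' : FormalMultilinearSeries ℝ E (E →L[ℝ] ℝ) := fun n => (1 / ((n:ℝ)+1)) • q n
  have hnorm : ∀ n, ‖q' n‖ ≤ ‖q n‖ := by
    intro n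
    have : ‖(1 / ((n:ℝ)+1))‖ ≤ 1 := by
      rw [Real.norm_eq_abs, abs_of_nonneg (by positivity), div_le_one (by positivity)]
      linarith [Nat.cast_nonneg (α := ℝ) n]
    calc ‖q' n‖ ≤ ‖(1 / ((n:ℝ)+1))‖ * ‖q n‖ := by
          have h := ContinuousMultilinearMap.opNorm_smul_le (1 / ((n:ℝ)+1)) (q n)
          exact h
      _ ≤ _ := by nlinarith [norm_nonneg (q n)]
  have hrad : q.radius ≤ q'.radius := by
    refine ENNReal.le_of_forall_nnreal_lt fun s hs => ?_
    obtain ⟨C, hC, hCb⟩ := q.norm_mul_pow_le_of_lt_radius hs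
    exact q'.le_radius_of_bound C fun n => (mul_le_mul_of_nonneg_right (hnorm n) (by positivity)).trans (hCb n)
  have hψ : HasFPowerSeriesOnBall q'.sum q' 0 r1 :=
    (q'.hasFPowerSeriesOnBall (lt_of_lt_of_le (lt_of_lt_of_le hr1pos hq1.r_le) hrad)).mono hr1pos (hq1.r_le.trans hrad)
  have hψ' : AnalyticAt ℝ q'.sum (p0 - p0) := by rw [sub_self]; exact hψ.analyticAt
  have hA : AnalyticAt ℝ (fun p => L p0 + q'.sum (p - p0) (p - p0)) p0 := by
    have h1 : AnalyticAt ℝ (fun p : E => p - p0) p0 := by fun_prop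
    have h2 : AnalyticAt ℝ (fun p => q'.sum (p - p0)) p0 := AnalyticAt.fun_comp (f := fun p => p - p0) hψ' h1
    exact analyticAt_const.add (an_clm_apply h2 h1)
  refine hA.congr ?_
  have hmem : Metric.eball p0 r1 ∈ 𝓝 p0 := Metric.eball_mem_nhds p0 hr1pos
  filter_upwards [hmem] with p hp
  set y := p - p0 with hy
  have hyb : ‖y‖₊ < r1 := by
    have : edist p p0 < r1 := hp
    rwa [edist_eq_enorm_sub, ← hy] at this
  have hy0 : y ∈ Metric.eball (0:E) r1 := by rw [Metric.mem_eball, edist_zero_right]; exact hyb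
  have hty : ∀ t ∈ Icc (0:ℝ) 1, t • y ∈ Metric.eball (0:E) r1 := by
    intro t ht
    rw [Metric.mem_eball, edist_zero_right]
    refine lt_of_le_of_lt ?_ hyb
    have : ‖t • y‖ ≤ ‖y‖ := by
      rw [norm_smul, Real.norm_eq_abs, abs_of_nonneg ht.1]; nlinarith [norm_nonneg y, ht.2]
    exact_mod_cast this
  have hder : ∀ t ∈ uIcc (0:ℝ) 1, HasDerivAt (fun t : ℝ => L (p0 + t • y)) (ω (p0 + t • y) y) t := by
    intro t ht
    rw [uIcc_of_le zero_le_one] at ht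
    have h1 : HasDerivAt (fun t : ℝ => p0 + t • y) y t := by
      have := ((hasDerivAt_id t).smul_const y).const_add p0
      simpa using this
    refine (hb _ ?_).comp_hasDerivAt t h1
    have := hty t ht
    rw [Metric.mem_eball, edist_zero_right] at this
    have h3 : ‖t • y‖ₑ < ENNReal.ofReal ρ := this.trans_le (min_le_right _ _)
    rw [mem_ball, dist_eq_norm, add_sub_cancel_left]
    rw [← ofReal_norm_eq_enorm] at h3
    exact (ENNReal.ofReal_lt_ofReal_iff hρ).1 h3
  have hsum : ∀ t ∈ Icc (0:ℝ) 1, HasSum (fun n => t ^ n * (q n (fun _ => y) y)) (ω (p0 + t • y) y) := by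
    intro t ht
    have := (hq1.hasSum (hty t ht)).mapL (ContinuousLinearMap.apply ℝ ℝ y)
    have he : (fun n => t ^ n * (q n (fun _ => y) y)) = fun n => (ContinuousLinearMap.apply ℝ ℝ y) (q n fun _ => t • y) := by
      funext n
      rw [(q n).map_smul_univ (fun _ => t) (fun _ => y)]
      simp
    rw [he]; exact this
  have hsummable : Summable (fun n => ‖q n‖ * ‖y‖ ^ n) :=
    q.summable_norm_mul_pow (r := ‖y‖₊) (lt_of_lt_of_le hyb hq1.r_le)
  have hint : HasSum (fun n => ∫ t in (0:ℝ)..1, t ^ n * (q n (fun _ => y) y)) (∫ t in (0:ℝ)..1, ω (p0 + t • y) y) := by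
    refine intervalIntegral.hasSum_integral_of_dominated_convergence (fun n t => ‖q n‖ * ‖y‖ ^ n * ‖y‖) ?_ ?_ ?_ ?_ ?_
    · intro n; exact (by fun_prop : Continuous _).aestronglyMeasurable
    · intro n
      refine Eventually.of_forall fun t ht => ?_
      rw [uIoc_of_le zero_le_one] at ht
      have h1 : ‖q n (fun _ => y) y‖ ≤ ‖q n‖ * ‖y‖ ^ n * ‖y‖ := by
        refine ((q n (fun _ => y)).le_opNorm y).trans ?_
        gcongr
        simpa using (q n).le_opNorm (fun _ => y)
      rw [norm_mul, norm_pow, Real.norm_eq_abs, abs_of_pos ht.1]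
      calc t ^ n * ‖q n (fun _ => y) y‖ ≤ 1 * ‖q n (fun _ => y) y‖ := by
            gcongr; exact pow_le_one₀ ht.1.le ht.2
        _ ≤ _ := by rwa [one_mul]
    · exact Eventually.of_forall fun t _ => hsummable.mul_right _
    · exact intervalIntegrable_const
    · refine Eventually.of_forall fun t ht => ?_
      rw [uIoc_of_le zero_le_one] at ht
      exact hsum t ⟨ht.1.le, ht.2⟩
  have hcont : ContinuousOn (fun t : ℝ => ω (p0 + t • y) y) (uIcc 0 1) := by
    rw [uIcc_of_le zero_le_one]
    have h1 : ContinuousOn ω (Metric.eball p0 r1) := hq1.continuousOn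
    have h2 : ContinuousOn (fun t : ℝ => ω (p0 + t • y)) (Icc 0 1) :=
      h1.comp (by fun_prop) (fun t ht => by
        have := hty t ht
        simpa [edist_eq_enorm_sub] using this)
    exact h2.clm_apply continuousOn_const
  have hftc := intervalIntegral.integral_eq_sub_of_hasDerivAt hder hcont.intervalIntegrable
  rw [hftc] at hint
  have hsum2 : HasSum (fun n => q' n (fun _ => y) y) (q'.sum y y) := by
    have := (hψ.hasSum hy0).mapL (ContinuousLinearMap.apply ℝ ℝ y)
    simpa using this
  have : (fun n => ∫ t in (0:ℝ)..1, t ^ n * (q n (fun _ => y) y)) = fun n => q' n (fun _ => y) y := by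
    funext n
    rw [intervalIntegral.integral_mul_const, integral_pow]
    simp [q']
  rw [this] at hint
  have := hsum2.unique hint
  rw [this]
  simp [hy]

lemma analytic_poincare {E : Type*} [NormedAddCommGroup E] [NormedSpace ℝ E] 
    (ω : E → (E →L[ℝ] ℝ)) (s : Set E) (hs : IsOpen s) (hc : Convex ℝ s)
    (hω : AnalyticOnNhd ℝ ω s)
    (hsym : ∀ p ∈ s, ∀ x y, fderiv ℝ ω p x y = fderiv ℝ ω p y x) :
    ∃ L : E → ℝ, AnalyticOnNhd ℝ L s ∧ ∀ p ∈ s, HasFDerivAt L (ω p) p := by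
  obtain ⟨L, hL⟩ := hc.exists_forall_hasFDerivAt_of_fderiv_symmetric hs hω.differentiableOn hsym
  refine ⟨L, fun p hp => analyticAt_of_hasFDerivAt L ω p (hω p hp) ?_, hL⟩
  filter_upwards [hs.mem_nhds hp] with q hq using hL q hq

end SM2

section SM3
lemma det_analytic {Z : Type*} [NormedAddCommGroup Z] [NormedSpace ℝ Z] {ι : Type*} [Fintype ι] [DecidableEq ι]
    (A : Z → Matrix ι ι ℝ) (x : Z) (h : ∀ i j, AnalyticAt ℝ (fun z => A z i j) x) :
    AnalyticAt ℝ (fun z => (A z).det) x := by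
  simp_rw [Matrix.det_apply]
  refine Finset.analyticAt_fun_sum _ fun σ _ => ?_
  have : AnalyticAt ℝ (fun z => ∏ i, A z (σ i) i) x := Finset.analyticAt_fun_prod _ fun i _ => h _ _
  simp_rw [Units.smul_def, zsmul_eq_mul]
  exact analyticAt_const.mul this

lemma adj_exists (X Y : Type*) [NormedAddCommGroup X] [NormedSpace ℝ X] [FiniteDimensional ℝ X]
    [NormedAddCommGroup Y] [NormedSpace ℝ Y] [FiniteDimensional ℝ Y]
    (hfr : Module.finrank ℝ X = Module.finrank ℝ Y + 1) :
    ∃ (dt : (X →L[ℝ] ℝ × Y) → ℝ) (adj : (X →L[ℝ] ℝ × Y) → (ℝ × Y →L[ℝ] X)),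
      (∀ L, AnalyticAt ℝ dt L) ∧ (∀ L, AnalyticAt ℝ adj L) ∧
      (∀ L v, adj L (L v) = dt L • v) ∧
      (∀ (L : X →L[ℝ] ℝ × Y) (w : X), w ≠ 0 → (∀ v, (L v).2 = 0 → ∃ t : ℝ, v = t • w) →
        adj L (1, 0) ≠ 0) := by
  classical
  set n := Module.finrank ℝ Y with hn
  let bY : Module.Basis (Fin n) ℝ Y := Module.finBasis ℝ Y
  let bZ : Module.Basis (Unit ⊕ Fin n) ℝ (ℝ × Y) := (Module.Basis.singleton Unit ℝ).prod bY
  let bX : Module.Basis (Unit ⊕ Fin n) ℝ X :=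
    (Module.finBasis ℝ X).reindex ((finCongr hfr).trans (by
      exact (finSumFinEquiv (m := n) (n := 1)).symm.trans ((Equiv.sumComm _ _).trans (Equiv.sumCongr finOneEquiv (Equiv.refl _)))))
  let A : (X →L[ℝ] ℝ × Y) → Matrix (Unit ⊕ Fin n) (Unit ⊕ Fin n) ℝ := fun L => LinearMap.toMatrix bX bZ L.toLinearMap
  have hA : ∀ i j L, AnalyticAt ℝ (fun L => A L i j) L := by
    intro i j L
    have h : ∀ L, A L i j = (LinearMap.toContinuousLinearMap (bZ.coord i)) (L (bX j)) := by
      intro L; simp [A, LinearMap.toMatrix_apply]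
    simp_rw [h]
    exact ((LinearMap.toContinuousLinearMap (bZ.coord i)).comp (ContinuousLinearMap.apply ℝ (ℝ × Y) (bX j))).analyticAt L
  have hadjA : ∀ i j L, AnalyticAt ℝ (fun L => (A L).adjugate i j) L := by
    intro i j L
    simp_rw [Matrix.adjugate_apply]
    refine det_analytic _ _ fun k l => ?_
    by_cases hk : k = j
    · subst hk; simp only [Matrix.updateRow_self]; exact analyticAt_const
    · simp only [Matrix.updateRow_ne hk]; exact hA k l L
  let adj : (X →L[ℝ] ℝ × Y) → (ℝ × Y →L[ℝ] X) := fun L =>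
    ∑ i, ∑ j, (A L).adjugate i j • (LinearMap.toContinuousLinearMap (bZ.coord j)).smulRight (bX i)
  have hadj_apply : ∀ L z, adj L z = ∑ i, ((A L).adjugate.mulVec (fun j => bZ.repr z j)) i • bX i := by
    intro L z
    simp only [adj, ContinuousLinearMap.sum_apply, ContinuousLinearMap.smul_apply,
      ContinuousLinearMap.smulRight_apply, Matrix.mulVec, dotProduct, Finset.sum_smul, smul_smul]
    rfl
  refine ⟨fun L => (A L).det, adj, fun L => det_analytic _ _ fun i j => hA i j L, ?_, ?_, ?_⟩
  · intro L
    refine Finset.analyticAt_fun_sum _ fun i _ => Finset.analyticAt_fun_sum _ fun j _ => ?_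
    exact (hadjA i j L).smul analyticAt_const
  · intro L v
    have h1 : (fun j => bZ.repr (L v) j) = (A L).mulVec (fun j => bX.repr v j) := by
      have := LinearMap.toMatrix_mulVec_repr bX bZ L.toLinearMap v
      exact this.symm
    rw [hadj_apply, h1, Matrix.mulVec_mulVec, Matrix.adjugate_mul, Matrix.smul_mulVec, Matrix.one_mulVec]
    simp only [Pi.smul_apply, smul_eq_mul, mul_smul]
    rw [← Finset.smul_sum, bX.sum_repr]
  · intro L w hw hker h0
    have hrepr : (fun j => bZ.repr ((1:ℝ), (0:Y)) j) = Pi.single (Sum.inl ()) 1 := by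
      have : ((1:ℝ), (0:Y)) = bZ (Sum.inl ()) := by simp [bZ]
      rw [this, bZ.repr_self]
      ext j; simp [Finsupp.single_apply, Pi.single_apply, eq_comm]
    rw [hadj_apply, hrepr] at h0
    have h1 := Fintype.linearIndependent_iff.1 bX.linearIndependent _ h0
    obtain ⟨i, hi⟩ : ∃ i, bX.repr w i ≠ 0 := by
      by_contra hcon
      push Not at hcon
      exact hw (bX.repr.map_eq_zero_iff.1 (Finsupp.ext hcon))
    have h2 := h1 i
    rw [Matrix.mulVec_single_one, Matrix.col_apply, Matrix.adjugate_apply] at h2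
    obtain ⟨c, hc, hc'⟩ := Matrix.exists_mulVec_eq_zero_iff.2 h2
    set v := ∑ k, c k • bX k with hv
    have hvr : ∀ k, bX.repr v k = c k := fun k => by rw [hv, bX.repr_sum_self]
    have h3 : (A L).mulVec c = fun j => bZ.repr (L v) j := by
      have := LinearMap.toMatrix_mulVec_repr bX bZ L.toLinearMap v
      rw [← show (fun k => bX.repr v k) = c from funext hvr]; exact this
    have h4 : (L v).2 = 0 := by
      apply bY.repr.map_eq_zero_iff.1
      ext k
      have := congrFun hc' (Sum.inr k)
      rw [Matrix.mulVec, Matrix.updateRow_ne (by simp)] at this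
      have h5 := congrFun h3 (Sum.inr k)
      rw [Matrix.mulVec, this] at h5
      simpa [bZ] using h5.symm
    obtain ⟨t, ht⟩ := hker v h4
    have h6 := congrFun hc' (Sum.inl ())
    rw [Matrix.mulVec, Matrix.updateRow_self, single_dotProduct, one_mul] at h6
    have h7 : c i = t * bX.repr w i := by rw [← hvr, ht]; simp
    rw [h7] at h6
    have ht0 : t = 0 := by
      rcases mul_eq_zero.1 h6 with h | h
      · exact h
      · exact absurd h hi
    apply hc
    ext k
    rw [← hvr, ht, ht0]; simp

end SM3

section SM4
section
variable {X Y : Type*} [NormedAddCommGroup X] [NormedSpace ℝ X] [NormedAddCommGroup Y] [NormedSpace ℝ Y]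

/-- uniform first order Taylor bounds on a set -/
structure TayOn (f : X → Y) (K : Set X) (Γ : ℝ) : Prop where
  bd : ∀ x ∈ K, ‖f x‖ ≤ Γ
  bd' : ∀ x ∈ K, ‖fderiv ℝ f x‖ ≤ Γ
  lip : ∀ x ∈ K, ∀ y ∈ K, ‖f x - f y‖ ≤ Γ * ‖x - y‖
  tay : ∀ x ∈ K, ∀ y ∈ K, ∀ z ∈ K, ∀ ρ : ℝ, ‖x - z‖ ≤ ρ → ‖y - z‖ ≤ ρ →
    ‖f x - f y - fderiv ℝ f z (x - y)‖ ≤ Γ * ρ * ‖x - y‖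

lemma TayOn.mono {f : X → Y} {K : Set X} {Γ Γ' : ℝ} (h : TayOn f K Γ) (hG : Γ ≤ Γ') : TayOn f K Γ' where
  bd x hx := (h.bd x hx).trans hG
  bd' x hx := (h.bd' x hx).trans hG
  lip x hx y hy := (h.lip x hx y hy).trans (by gcongr)
  tay x hx y hy z hz ρ h1 h2 := (h.tay x hx y hy z hz ρ h1 h2).trans (by
    have : 0 ≤ ρ := (norm_nonneg _).trans h1
    gcongr)

lemma an_bound (f : X → Y) (O K : Set X) (hf : AnalyticOnNhd ℝ f O) (hKO : K ⊆ O)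
    (hK : IsCompact K) : ∃ C, 0 ≤ C ∧ ∀ x ∈ K, ‖f x‖ ≤ C := by
  obtain ⟨C, h⟩ := hK.exists_bound_of_continuousOn (hf.continuousOn.mono hKO)
  exact ⟨max C 0, le_max_right _ _, fun x hx => (h x hx).trans (le_max_left _ _)⟩

lemma tayOn_exists [CompleteSpace Y] (f : X → Y) (O K : Set X) (hf : AnalyticOnNhd ℝ f O) (hKO : K ⊆ O)
    (hK : IsCompact K) (hKc : Convex ℝ K) : ∃ Γ : ℝ, TayOn f K Γ := by
  have hf' : AnalyticOnNhd ℝ (fderiv ℝ f) O := hf.fderiv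
  have hf'' : AnalyticOnNhd ℝ (fderiv ℝ (fderiv ℝ f)) O := hf'.fderiv
  obtain ⟨C0, h0⟩ := hK.exists_bound_of_continuousOn (hf.continuousOn.mono hKO)
  obtain ⟨C1, h1⟩ := hK.exists_bound_of_continuousOn (hf'.continuousOn.mono hKO)
  obtain ⟨C2, hC2, h2⟩ := an_bound (fderiv ℝ (fderiv ℝ f)) O K hf'' hKO hK
  have hL : ∀ x ∈ K, ∀ z ∈ K, ‖fderiv ℝ f x - fderiv ℝ f z‖ ≤ C2 * ‖x - z‖ := fun x hx z hz =>
    hKc.norm_image_sub_le_of_norm_hasFDerivWithin_le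
      (fun w hw => (hf' w (hKO hw)).differentiableAt.hasFDerivAt.hasFDerivWithinAt) h2 hz hx
  have hb : TayOn f K (max C0 (max C1 C2)) := by
    refine ⟨fun x hx => (h0 x hx).trans (le_max_left _ _), fun x hx => (h1 x hx).trans
      ((le_max_left _ _).trans (le_max_right _ _)), ?_, ?_⟩
    · intro x hx y hy
      refine (hKc.norm_image_sub_le_of_norm_hasFDerivWithin_le
        (fun w hw => (hf w (hKO hw)).differentiableAt.hasFDerivAt.hasFDerivWithinAt) h1 hy hx).trans ?_
      gcongr; exact ((le_max_left _ _).trans (le_max_right _ _))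
    · intro x hx y hy z hz ρ hρ1 hρ2
      have hρ0 : 0 ≤ ρ := (norm_nonneg _).trans hρ1
      refine ((hKc.inter (convex_closedBall z ρ)).norm_image_sub_le_of_norm_hasFDerivWithin_le' (C := C2 * ρ)
        (fun w hw => (hf w (hKO hw.1)).differentiableAt.hasFDerivAt.hasFDerivWithinAt) ?_
        ⟨hy, by rwa [mem_closedBall, dist_eq_norm]⟩ ⟨hx, by rwa [mem_closedBall, dist_eq_norm]⟩).trans ?_
      · rintro w ⟨hw, hw'⟩
        rw [mem_closedBall, dist_eq_norm] at hw'
        exact (hL w hw z hz).trans (by gcongr)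
      · gcongr; exact ((le_max_right _ _).trans (le_max_right _ _))
  exact ⟨_, hb⟩
end

section
variable {E F : Type*} [NormedAddCommGroup E] [NormedSpace ℝ E] [FiniteDimensional ℝ E]
  [MeasurableSpace E] [BorelSpace E] (μ : Measure E) [μ.IsAddHaarMeasure]
  [NormedAddCommGroup F] [NormedSpace ℝ F] [FiniteDimensional ℝ F]
  [MeasurableSpace F] [BorelSpace F] (ν : Measure F) [ν.IsAddHaarMeasure]

lemma lip_image_measure (hfr : Module.finrank ℝ E = Module.finrank ℝ F) :
    ∃ C : ℝ≥0∞, C ≠ ⊤ ∧ ∀ (s : Set E) (f : E → F) (K : ℝ≥0), LipschitzOnWith K f s →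
      ν (f '' s) ≤ C * (K : ℝ≥0∞) ^ (Module.finrank ℝ E) * μ s := by
  set n := Module.finrank ℝ E with hn
  have hE : (Measure.hausdorffMeasure (n:ℝ) : Measure E).IsAddHaarMeasure := by
    rw [hn]; infer_instance
  have hF : (Measure.hausdorffMeasure (n:ℝ) : Measure F).IsAddHaarMeasure := by
    rw [hfr]; infer_instance
  set a := (Measure.hausdorffMeasure (n:ℝ) : Measure E).addHaarScalarFactor μ
  set b := ν.addHaarScalarFactor (Measure.hausdorffMeasure (n:ℝ) : Measure F)
  have e1 : (Measure.hausdorffMeasure (n:ℝ) : Measure E) = a • μ :=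
    Measure.isAddLeftInvariant_eq_smul _ _
  have e2 : ν = b • (Measure.hausdorffMeasure (n:ℝ) : Measure F) :=
    Measure.isAddLeftInvariant_eq_smul _ _
  refine ⟨a * b, by finiteness, fun s f K hf => ?_⟩
  have h := hf.hausdorffMeasure_image_le (d := (n:ℝ)) (by positivity)
  rw [e1, ENNReal.rpow_natCast] at h
  rw [e2, Measure.smul_apply, ENNReal.smul_def, smul_eq_mul]
  rw [Measure.smul_apply, ENNReal.smul_def, smul_eq_mul] at h
  calc (b:ℝ≥0∞) * _ ≤ b * ((K:ℝ≥0∞)^n * (a * μ s)) := by gcongr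
    _ = _ := by ring
end

/-- a set coverable by at most `C η^{-n}` balls of radius `η ≤ 1` with centers in the set -/
def CovOn {X : Type*} [PseudoMetricSpace X] (K : Set X) (n : ℕ) : Prop :=
  ∃ C : ℝ, 0 ≤ C ∧ ∀ η : ℝ, 0 < η → η ≤ 1 → ∃ T : Finset X, (T.card : ℝ) ≤ C * (η⁻¹) ^ n ∧
    K ⊆ ⋃ z ∈ T, closedBall z η

lemma covOn_Icc (a b : ℝ) : CovOn (Icc a b) 1 := by
  refine ⟨|b - a| + 1, by positivity, fun η h0 h1 => ?_⟩
  classical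
  refine ⟨(Finset.range (⌊|b - a| / η⌋₊ + 1)).image (fun k : ℕ => a + k * η), ?_, ?_⟩
  · refine (Nat.cast_le.2 Finset.card_image_le).trans ?_
    rw [Finset.card_range]
    push_cast
    have := Nat.floor_le (show 0 ≤ |b - a| / η by positivity)
    have h2 : 1 ≤ η⁻¹ := (one_le_inv₀ h0).2 h1
    rw [pow_one, add_mul, one_mul, ← div_eq_mul_inv]
    linarith
  · intro x hx
    have hxa : 0 ≤ (x - a) / η := div_nonneg (by linarith [hx.1]) h0.le
    have hle : (x - a) / η ≤ |b - a| / η := by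
      gcongr
      exact (by linarith [hx.2] : x - a ≤ b - a).trans (le_abs_self _)
    simp only [mem_iUnion]
    refine ⟨a + (⌊(x-a)/η⌋₊ : ℝ) * η, ?_, ?_⟩
    · rw [Finset.mem_image]
      exact ⟨_, Finset.mem_range.2 (Nat.lt_succ_of_le (Nat.floor_le_floor hle)), rfl⟩
    · have h3 := Nat.floor_le hxa
      have h4 := Nat.lt_floor_add_one ((x-a)/η)
      rw [le_div_iff₀ h0] at h3
      rw [div_lt_iff₀ h0] at h4
      rw [mem_closedBall, Real.dist_eq, abs_le]
      constructor <;> nlinarith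

lemma CovOn.prod {X Y : Type*} [PseudoMetricSpace X] [PseudoMetricSpace Y] {K : Set X} {L : Set Y} {n m : ℕ}
    (hK : CovOn K n) (hL : CovOn L m) : CovOn (K ×ˢ L) (n + m) := by
  obtain ⟨C, hC, H⟩ := hK
  obtain ⟨C', hC', H'⟩ := hL
  refine ⟨C * C', by positivity, fun η h0 h1 => ?_⟩
  obtain ⟨T, hT, hTK⟩ := H η h0 h1
  obtain ⟨T', hT', hTK'⟩ := H' η h0 h1
  refine ⟨T ×ˢ T', ?_, ?_⟩
  · rw [Finset.card_product]; push_cast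
    calc (T.card : ℝ) * T'.card ≤ (C * (η⁻¹) ^ n) * (C' * (η⁻¹) ^ m) := by gcongr
      _ = _ := by rw [pow_add]; ring
  · rintro ⟨x, y⟩ ⟨hx, hy⟩
    have h1 := hTK hx
    have h2 := hTK' hy
    simp only [mem_iUnion, exists_prop] at h1 h2 ⊢
    obtain ⟨z, hz, hz'⟩ := h1
    obtain ⟨w, hw, hw'⟩ := h2
    exact ⟨(z, w), Finset.mem_product.2 ⟨hz, hw⟩, by
      rw [← closedBall_prod_same]; exact ⟨hz', hw'⟩⟩

lemma CovOn.mono {X : Type*} [PseudoMetricSpace X] {K L : Set X} {n : ℕ}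
    (hL : CovOn L n) (h : K ⊆ L) : CovOn K n := by
  obtain ⟨C, hC, H⟩ := hL
  refine ⟨C, hC, fun η h0 h1 => ?_⟩
  obtain ⟨T, hT, hTK⟩ := H η h0 h1
  exact ⟨T, hT, h.trans hTK⟩

end SM4

section SM6
/-- if a map expands distances up to factor `K⁻¹`, source measure is controlled by image measure -/
lemma expand_measure (E F : Type*) [NormedAddCommGroup E] [NormedSpace ℝ E] [FiniteDimensional ℝ E]
    [MeasurableSpace E] [BorelSpace E] (μ : Measure E) [μ.IsAddHaarMeasure]
    [NormedAddCommGroup F] [NormedSpace ℝ F] [FiniteDimensional ℝ F]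
    [MeasurableSpace F] [BorelSpace F] (ν : Measure F) [ν.IsAddHaarMeasure]
    (hfr : Module.finrank ℝ F = Module.finrank ℝ E) :
    ∃ C : ℝ, 0 ≤ C ∧ ∀ (s : Set E) (f : E → F) (K : ℝ), 0 ≤ K →
      (∀ x ∈ s, ∀ y ∈ s, ‖x - y‖ ≤ K * ‖f x - f y‖) →
      μ s ≤ ENNReal.ofReal (C * K ^ (Module.finrank ℝ E)) * ν (f '' s) := by
  obtain ⟨C, hC, H⟩ := lip_image_measure ν μ hfr
  refine ⟨C.toReal, by positivity, fun s f K hK h => ?_⟩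
  have hinj : InjOn f s := by
    intro x hx y hy hxy
    have := h x hx y hy
    rw [hxy, sub_self, norm_zero, mul_zero] at this
    exact sub_eq_zero.1 (norm_le_zero_iff.1 this)
  have hL : LipschitzOnWith (K.toNNReal) (Function.invFunOn f s) (f '' s) := by
    refine LipschitzOnWith.of_dist_le_mul ?_
    rintro _ ⟨x, hx, rfl⟩ _ ⟨y, hy, rfl⟩
    rw [hinj.leftInvOn_invFunOn hx, hinj.leftInvOn_invFunOn hy, dist_eq_norm, dist_eq_norm, Real.coe_toNNReal _ hK]
    exact h x hx y hy
  have h2 := H (f '' s) _ _ hL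
  rw [hinj.leftInvOn_invFunOn.image_image] at h2
  refine h2.trans (le_of_eq ?_)
  rw [ENNReal.ofReal_mul (by positivity), ENNReal.ofReal_toReal hC, ENNReal.ofReal_pow hK, hfr]
  rfl

lemma volProdHaar (E F : Type*) [NormedAddCommGroup E] [NormedSpace ℝ E] [FiniteDimensional ℝ E]
    [MeasureSpace E] [BorelSpace E] [(volume : Measure E).IsAddHaarMeasure]
    [NormedAddCommGroup F] [NormedSpace ℝ F] [FiniteDimensional ℝ F]
    [MeasureSpace F] [BorelSpace F] [(volume : Measure F).IsAddHaarMeasure] :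
    (volume : Measure (E × F)).IsAddHaarMeasure :=
  inferInstanceAs ((volume.prod volume : Measure (E × F)).IsAddHaarMeasure)

instance haarVec2 : (volume : Measure Vec2).IsAddHaarMeasure := volProdHaar ℝ ℝ
instance haarX3 : (volume : Measure (Vec2 × ℝ)).IsAddHaarMeasure := volProdHaar Vec2 ℝ
instance haarX3' : (volume : Measure (ℝ × Vec2)).IsAddHaarMeasure := volProdHaar ℝ Vec2
instance haarW5 : (volume : Measure ((Vec2 × ℝ) × (ℝ × ℝ))).IsAddHaarMeasure := volProdHaar (Vec2 × ℝ) (ℝ × ℝ)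
instance haarV4 : (volume : Measure (Vec2 × Vec2)).IsAddHaarMeasure := volProdHaar Vec2 Vec2
instance haarY5 : (volume : Measure ((Vec2 × Vec2) × ℝ)).IsAddHaarMeasure := volProdHaar (Vec2 × Vec2) ℝ

lemma vol_ball_vec2 (z : Vec2) (R : ℝ) (hR : 0 ≤ R) : volume (closedBall z R) = ENNReal.ofReal (4 * R ^ 2) := by
  rw [← Prod.mk.eta (p := z), ← closedBall_prod_same, Measure.volume_eq_prod, Measure.prod_prod, Real.volume_closedBall,
    Real.volume_closedBall, ← ENNReal.ofReal_mul (by positivity)]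
  congr 1; ring

/-- chart attached to `Φ` -/
def chi (Φ : Vec2 × ℝ → Vec2) (p : Vec2 × ℝ) : ℝ × Vec2 := (p.1.1, Φ p)

lemma bad_bound : ∃ C0 : ℝ, 0 ≤ C0 ∧ ∀ (A : Set (Vec2 × ℝ)) (Φ : Vec2 × ℝ → Vec2) (Λ r τ : ℝ) (z0 : Vec2 × ℝ),
    MeasurableSet A → 0 ≤ Λ → 0 ≤ r → 0 ≤ τ →
    A ⊆ closedBall z0 r →
    (∀ p ∈ A, ∀ q ∈ A, ‖Φ p - Φ q‖ ≤ Λ * ‖p - q‖) →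
    (∀ p ∈ A, ∀ q ∈ A, ‖p - q‖ ≤ Λ * ‖chi Φ p - chi Φ q‖) →
    MeasurableSet (chi Φ '' A) ∧
    volume {p | p ∈ A ∧ volume {ξ : ℝ | (ξ, Φ p) ∈ chi Φ '' A} < ENNReal.ofReal τ} ≤
      ENNReal.ofReal (C0 * Λ ^ 5 * r ^ 2 * τ) := by
  obtain ⟨C, hC, H⟩ := expand_measure (Vec2 × ℝ) (ℝ × Vec2) volume volume (by simp)
  refine ⟨16 * C, by positivity, ?_⟩
  intro A Φ Λ r τ z0 hA hΛ hr hτ hAb hL hbi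
  have hcont : ContinuousOn Φ A := by
    have : LipschitzOnWith Λ.toNNReal Φ A := LipschitzOnWith.of_dist_le_mul fun p hp q hq => by
      rw [dist_eq_norm, dist_eq_norm, Real.coe_toNNReal _ hΛ]; exact hL p hp q hq
    exact this.continuousOn
  have hchi : ContinuousOn (chi Φ) A := by
    unfold chi
    exact ContinuousOn.prodMk (by fun_prop) hcont
  have hinj : InjOn (chi Φ) A := by
    intro x hx y hy hxy
    have := hbi x hx y hy
    rw [hxy, sub_self, norm_zero, mul_zero] at this
    exact sub_eq_zero.1 (norm_le_zero_iff.1 this)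
  have hm : MeasurableSet (chi Φ '' A) := hA.image_of_continuousOn_injOn hchi hinj
  refine ⟨hm, ?_⟩
  set A' := chi Φ '' A with hA'
  rcases A.eq_empty_or_nonempty with h0 | ⟨a0, ha0⟩
  · have : {p | p ∈ A ∧ volume {ξ : ℝ | (ξ, Φ p) ∈ A'} < ENNReal.ofReal τ} = ∅ := by
      ext p; simp [h0]
    rw [this]; simp
  set Bad := {p | p ∈ A ∧ volume {ξ : ℝ | (ξ, Φ p) ∈ A'} < ENNReal.ofReal τ} with hBad
  have h1 := H Bad (chi Φ) Λ hΛ (fun x hx y hy => hbi x hx.1 y hy.1)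
  set S : Set (ℝ × Vec2) := {w | w ∈ A' ∧ volume {ξ : ℝ | (ξ, w.2) ∈ A'} < ENNReal.ofReal τ} with hS
  have hνm : Measurable (fun y : Vec2 => volume {ξ : ℝ | (ξ, y) ∈ A'}) := measurable_measure_prodMk_right hm
  have hSm : MeasurableSet S := by
    refine hm.inter ?_
    exact measurableSet_lt (hνm.comp measurable_snd) measurable_const
  have hsub : chi Φ '' Bad ⊆ S := by
    rintro _ ⟨p, hp, rfl⟩
    exact ⟨⟨p, hp.1, rfl⟩, hp.2⟩
  have hSv : volume S ≤ ENNReal.ofReal τ * ENNReal.ofReal (4 * (2 * Λ * r) ^ 2) := by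
    rw [Measure.volume_eq_prod, Measure.prod_apply_symm hSm]
    have : ∀ y : Vec2, volume ((fun x => (x, y)) ⁻¹' S) ≤
        (closedBall (Φ a0) (2 * Λ * r)).indicator (fun _ => ENNReal.ofReal τ) y := by
      intro y
      by_cases hy : y ∈ closedBall (Φ a0) (2 * Λ * r)
      · rw [indicator_of_mem hy]
        by_cases hν : volume {ξ : ℝ | (ξ, y) ∈ A'} < ENNReal.ofReal τ
        · exact (measure_mono (fun ξ hξ => hξ.1)).trans hν.le
        · have : (fun x => (x, y)) ⁻¹' S = (∅ : Set ℝ) := by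
            ext ξ; simp only [mem_preimage, mem_empty_iff_false, iff_false]
            exact fun h => hν h.2
          rw [this]; simp
      · rw [indicator_of_notMem hy]
        have : (fun x => (x, y)) ⁻¹' S = (∅ : Set ℝ) := by
          ext ξ; simp only [mem_preimage, mem_empty_iff_false, iff_false]
          rintro ⟨⟨p, hp, hpe⟩, -⟩
          apply hy
          have hpy : Φ p = y := congrArg Prod.snd hpe
          rw [← hpy, mem_closedBall, dist_eq_norm]
          have h3 := hAb hp
          have h4 := hAb ha0
          rw [mem_closedBall] at h3 h4
          have h5 : ‖p - a0‖ ≤ 2 * r := by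
            rw [← dist_eq_norm]; linarith [dist_triangle_right p a0 z0]
          calc _ ≤ Λ * ‖p - a0‖ := hL p hp a0 ha0
            _ ≤ Λ * (2 * r) := by gcongr
            _ = _ := by ring
        rw [this]; simp
    refine (lintegral_mono this).trans ?_
    rw [lintegral_indicator measurableSet_closedBall, setLIntegral_const, vol_ball_vec2 _ _ (by positivity)]
  refine h1.trans ?_
  refine (mul_le_mul_right ((measure_mono hsub).trans hSv) _).trans ?_
  rw [← ENNReal.ofReal_mul hτ, ← ENNReal.ofReal_mul (by positivity)]
  apply ENNReal.ofReal_le_ofReal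
  have : Module.finrank ℝ (Vec2 × ℝ) = 3 := by simp
  rw [this]
  apply le_of_eq; ring

lemma lower_prod {X Y : Type*} [MeasurableSpace X] [MeasurableSpace Y] (μ : Measure X) (ν : Measure Y)
    [SFinite μ] [SFinite ν] (s : Set (X × Y)) (G : Set X) (c : ℝ≥0∞)
    (h : ∀ x ∈ G, c ≤ ν (Prod.mk x ⁻¹' s)) : c * μ G ≤ (μ.prod ν) s := by
  rw [← measure_toMeasurable s, Measure.prod_apply (measurableSet_toMeasurable _ _)]
  have hm := measurable_measure_prodMk_left (ν := ν) (measurableSet_toMeasurable (μ.prod ν) s)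
  refine le_trans ?_ (mul_meas_ge_le_lintegral hm c)
  gcongr
  intro x hx
  exact (h x hx).trans (measure_mono (preimage_mono (subset_toMeasurable _ _)))

lemma lower_W (G : Set (Vec2 × ℝ)) (Φj Φk : Vec2 × ℝ → Vec2) (Aj Ak : Set (ℝ × Vec2))
    (α β : Vec2 × ℝ → ℝ) (α0 s0 τ : ℝ) (hα0 : 0 < α0) (hτ : 0 ≤ τ) (hs0 : 0 ≤ s0) (hst : 4 * s0 ≤ τ * α0)
    (hα : ∀ p ∈ G, α0 ≤ |α p|)
    (hj : ∀ p ∈ G, ENNReal.ofReal τ ≤ volume {ξ : ℝ | (ξ, Φj p) ∈ Aj})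
    (hk : ∀ p ∈ G, ENNReal.ofReal τ ≤ volume {ξ : ℝ | (ξ, Φk p) ∈ Ak}) :
    ENNReal.ofReal (τ ^ 2 / 2) * volume G ≤ volume {w : (Vec2 × ℝ) × (ℝ × ℝ) | w.1 ∈ G ∧
      (w.2.1, Φk w.1) ∈ Ak ∧ (w.2.2, Φj w.1) ∈ Aj ∧
      s0 ≤ |α w.1 * (w.2.2 - w.1.1.1) + β w.1 * (w.2.1 - w.1.1.1)|} := by
  rw [Measure.volume_eq_prod]
  refine lower_prod _ _ _ G _ fun p hp => ?_
  have h1 : ENNReal.ofReal (τ / 2) * volume {η : ℝ | (η, Φk p) ∈ Ak} ≤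
      (volume.prod volume : Measure (ℝ × ℝ)) {v : ℝ × ℝ | (v.1, Φk p) ∈ Ak ∧ (v.2, Φj p) ∈ Aj ∧
      s0 ≤ |α p * (v.2 - p.1.1) + β p * (v.1 - p.1.1)|} := by
    refine lower_prod _ _ _ _ _ fun η hη => ?_
    set b := β p * (η - p.1.1)
    have hsub : {ξ : ℝ | (ξ, Φj p) ∈ Aj} \ closedBall (p.1.1 - b / α p) (s0 / α0) ⊆
        Prod.mk η ⁻¹' {v : ℝ × ℝ | (v.1, Φk p) ∈ Ak ∧ (v.2, Φj p) ∈ Aj ∧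
      s0 ≤ |α p * (v.2 - p.1.1) + β p * (v.1 - p.1.1)|} := by
      rintro ξ ⟨h1, h2⟩
      refine ⟨hη, h1, ?_⟩
      rw [mem_closedBall, not_le, Real.dist_eq, div_lt_iff₀ hα0] at h2
      have hαp := hα p hp
      have hne : α p ≠ 0 := by
        intro h; rw [h, abs_zero] at hαp; linarith
      have : α p * (ξ - p.1.1) + b = α p * (ξ - (p.1.1 - b / α p)) := by
        field_simp; ring
      change s0 ≤ |α p * (ξ - p.1.1) + b|
      rw [this, abs_mul]
      nlinarith [abs_nonneg (ξ - (p.1.1 - b / α p))]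
    refine le_trans ?_ (measure_mono hsub)
    refine le_trans ?_ le_measure_diff
    rw [Real.volume_closedBall]
    refine le_trans ?_ (tsub_le_tsub_right (hj p hp) _)
    rw [← ENNReal.ofReal_sub _ (by positivity)]
    apply ENNReal.ofReal_le_ofReal
    have : s0 / α0 ≤ τ / 4 := by rw [div_le_div_iff₀ hα0 (by norm_num)]; linarith
    linarith
  have h2 : {v : ℝ × ℝ | (v.1, Φk p) ∈ Ak ∧ (v.2, Φj p) ∈ Aj ∧
      s0 ≤ |α p * (v.2 - p.1.1) + β p * (v.1 - p.1.1)|} ⊆ Prod.mk p ⁻¹' {w : (Vec2 × ℝ) × (ℝ × ℝ) | w.1 ∈ G ∧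
      (w.2.1, Φk w.1) ∈ Ak ∧ (w.2.2, Φj w.1) ∈ Aj ∧
      s0 ≤ |α w.1 * (w.2.2 - w.1.1.1) + β w.1 * (w.2.1 - w.1.1.1)|} := fun v hv => ⟨hp, hv⟩
  rw [Measure.volume_eq_prod]
  refine le_trans ?_ (measure_mono h2)
  refine le_trans ?_ h1
  refine le_trans ?_ (mul_le_mul_right (hk p hp) _)
  rw [← ENNReal.ofReal_mul (by positivity)]
  apply ENNReal.ofReal_le_ofReal
  apply le_of_eq; ring

lemma vol_S (f : Vec2 → ℝ) (hf : Measurable f) (R h e : ℝ) (hR : 0 ≤ R) (hh : 0 < h) (he : 0 ≤ e) :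
    volume {w : (Vec2 × Vec2) × ℝ | ‖w.1.1‖ ≤ R ∧ ‖w.1.2‖ ≤ R ∧ h ≤ |f w.1.1| ∧ |w.2 * f w.1.1 - f w.1.2| ≤ e}
      ≤ ENNReal.ofReal (32 * R ^ 4 * (e / h)) := by
  set S := {w : (Vec2 × Vec2) × ℝ | ‖w.1.1‖ ≤ R ∧ ‖w.1.2‖ ≤ R ∧ h ≤ |f w.1.1| ∧ |w.2 * f w.1.1 - f w.1.2| ≤ e} with hS
  have hSm : MeasurableSet S := by
    have m1 : MeasurableSet {w : (Vec2 × Vec2) × ℝ | ‖w.1.1‖ ≤ R} := measurableSet_le (by fun_prop) (by fun_prop)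
    have m2 : MeasurableSet {w : (Vec2 × Vec2) × ℝ | ‖w.1.2‖ ≤ R} := measurableSet_le (by fun_prop) (by fun_prop)
    have f1 : Measurable fun w : (Vec2 × Vec2) × ℝ => f w.1.1 := hf.comp (by fun_prop)
    have f2 : Measurable fun w : (Vec2 × Vec2) × ℝ => f w.1.2 := hf.comp (by fun_prop)
    have m3 : MeasurableSet {w : (Vec2 × Vec2) × ℝ | h ≤ |f w.1.1|} :=
      measurableSet_le measurable_const (measurable_abs.comp f1)
    have m4 : MeasurableSet {w : (Vec2 × Vec2) × ℝ | |w.2 * f w.1.1 - f w.1.2| ≤ e} :=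
      measurableSet_le (measurable_abs.comp ((measurable_snd.mul f1).sub f2)) measurable_const
    exact m1.inter (m2.inter (m3.inter m4))
  rw [Measure.volume_eq_prod, Measure.prod_apply hSm]
  have : ∀ y : Vec2 × Vec2, volume (Prod.mk y ⁻¹' S) ≤
      (closedBall (0:Vec2) R ×ˢ closedBall (0:Vec2) R).indicator (fun _ => ENNReal.ofReal (2 * (e / h))) y := by
    intro y
    by_cases hy : y ∈ closedBall (0:Vec2) R ×ˢ closedBall (0:Vec2) R
    · rw [indicator_of_mem hy]
      by_cases hfy : h ≤ |f y.1|
      · refine (measure_mono (?_ : _ ⊆ closedBall (f y.2 / f y.1) (e / h))).trans (by rw [Real.volume_closedBall])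
        rintro σ ⟨_, _, _, h4⟩
        change |σ * f y.1 - f y.2| ≤ e at h4
        have hne : f y.1 ≠ 0 := by
          intro h'; rw [h', abs_zero] at hfy; linarith
        rw [mem_closedBall, Real.dist_eq, le_div_iff₀ hh]
        have : σ * f y.1 - f y.2 = (σ - f y.2 / f y.1) * f y.1 := by field_simp
        rw [this, abs_mul] at h4
        nlinarith [abs_nonneg (σ - f y.2 / f y.1)]
      · have : Prod.mk y ⁻¹' S = (∅ : Set ℝ) := by
          ext ξ; simp only [mem_preimage, mem_empty_iff_false, iff_false]
          exact fun h => hfy h.2.2.1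
        rw [this]; simp
    · rw [indicator_of_notMem hy]
      have : Prod.mk y ⁻¹' S = (∅ : Set ℝ) := by
        ext ξ; simp only [mem_preimage, mem_empty_iff_false, iff_false]
        exact fun h => hy ⟨by simpa using h.1, by simpa using h.2.1⟩
      rw [this]; simp
  refine (lintegral_mono this).trans ?_
  rw [lintegral_indicator (measurableSet_closedBall.prod measurableSet_closedBall), setLIntegral_const,
    Measure.volume_eq_prod, Measure.prod_prod, vol_ball_vec2 _ _ hR, ← ENNReal.ofReal_mul (by positivity),
    ← ENNReal.ofReal_mul (by positivity)]
  apply ENNReal.ofReal_le_ofReal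
  apply le_of_eq; ring

end SM6

section SM6d
abbrev X3 : Type := Vec2 × ℝ
abbrev X9 : Type := X3 × (X3 × X3)
abbrev Y8 : Type := (Vec2 × Vec2) × (Vec2 × Vec2)

/-- product of `a`'s : numerator -/
def fN (ai aj ak : X3 → ℝ) (t : X9) : ℝ := aj t.1 * ak t.2.1 * ai t.2.2
/-- product of `a`'s : denominator -/
def fD (ai aj ak : X3 → ℝ) (t : X9) : ℝ := ai t.1 * aj t.2.1 * ak t.2.2
/-- the eight functions -/
def fG (Φi Φj Φk : X3 → Vec2) (t : X9) : Y8 :=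
  ((Φi t.1, Φi t.2.2), (Φj t.1 - Φj t.2.1, Φk t.2.1 - Φk t.2.2))

lemma tuple_lip {X Y : Type*} [NormedAddCommGroup X] [NormedSpace ℝ X] [NormedAddCommGroup Y] [NormedSpace ℝ Y]
    (N Dd : X → ℝ) (G : X → Y) (K : Set X) (Γ : ℝ) (hΓ : 1 ≤ Γ) (tN : TayOn N K Γ) (tD : TayOn Dd K Γ)
    (tG : TayOn G K Γ) (ts t t' : X) (hts : ts ∈ K) (ht : t ∈ K) (ht' : t' ∈ K) (ρ d0 q0 : ℝ)
    (hd0 : 0 < d0) (hd1 : d0 ≤ 1) (hq0 : 0 < q0) (h1 : ‖t - ts‖ ≤ ρ) (h2 : ‖t' - ts‖ ≤ ρ)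
    (hadj : ∀ v, q0 * ‖v‖ ≤ Γ * max |Dd ts * fderiv ℝ N ts v - N ts * fderiv ℝ Dd ts v| ‖fderiv ℝ G ts v‖)
    (hDt : d0 ≤ |Dd t|) (hDt' : d0 ≤ |Dd t'|) (hρ : 8 * Γ ^ 4 * ρ ≤ d0 * q0) (m : ℝ)
    (hm1 : ‖G t - G t'‖ ≤ m) (hm2 : |N t / Dd t - N t' / Dd t'| ≤ m) :
    ‖t - t'‖ ≤ 2 * Γ ^ 3 / q0 * m := by
  have hρ0 : 0 ≤ ρ := (norm_nonneg _).trans h1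
  have hm0 : 0 ≤ m := (norm_nonneg _).trans hm1
  set v := t - t' with hv
  set e := 4 * Γ ^ 3 * ρ / d0 with he
  have hDne : Dd t ≠ 0 := fun h => by rw [h, abs_zero] at hDt; linarith
  have hDne' : Dd t' ≠ 0 := fun h => by rw [h, abs_zero] at hDt'; linarith
  have hee : Γ ^ 3 * ρ ≤ e / 4 := by
    rw [he, div_div, le_div_iff₀ (by positivity)]
    nlinarith [mul_nonneg (pow_nonneg (by linarith : 0 ≤ Γ) 3) hρ0]
  have hG2 : Γ ≤ Γ ^ 3 := by nlinarith [mul_nonneg (by linarith : 0 ≤ Γ) (by nlinarith : 0 ≤ Γ^2 - 1)]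
  have hG23 : Γ ^ 2 ≤ Γ ^ 3 := by nlinarith [sq_nonneg Γ]
  have nv := norm_nonneg v
  have hGb : ‖fderiv ℝ G ts v‖ ≤ Γ ^ 2 * m + e * ‖v‖ := by
    have h3 := tG.tay t ht t' ht' ts hts ρ h1 h2
    have h4 : ‖fderiv ℝ G ts v‖ ≤ ‖G t - G t'‖ + Γ * ρ * ‖v‖ := by
      calc ‖fderiv ℝ G ts v‖ = ‖(G t - G t') - (G t - G t' - fderiv ℝ G ts v)‖ := by congr 1; abel
        _ ≤ _ := (norm_sub_le _ _).trans (by gcongr)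
    have h5 : Γ * ρ * ‖v‖ ≤ e * ‖v‖ := by
      gcongr
      have : Γ * ρ ≤ Γ ^ 3 * ρ := by gcongr
      have : 0 ≤ e := by positivity
      linarith
    have : m ≤ Γ ^ 2 * m := by nlinarith
    linarith
  have hNb : |Dd ts * fderiv ℝ N ts v - N ts * fderiv ℝ Dd ts v| ≤ Γ ^ 2 * m + e * ‖v‖ := by
    have hN := tN.tay t ht t' ht' ts hts ρ h1 h2
    have hD := tD.tay t ht t' ht' ts hts ρ h1 h2
    rw [Real.norm_eq_abs] at hN hD
    have bD := tD.bd ts hts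
    have bN := tN.bd ts hts
    have bDt := tD.bd t ht
    have lN := tN.lip t' ht' ts hts
    have lD := tD.lip t' ht' ts hts
    have lDD := tD.lip t ht t' ht'
    rw [Real.norm_eq_abs] at bD bN bDt lN lD lDD
    have id1 : Dd ts * fderiv ℝ N ts v - N ts * fderiv ℝ Dd ts v =
      Dd ts * Dd t * (N t / Dd t - N t' / Dd t') +
      (Dd ts * (N t' - N ts) - N ts * (Dd t' - Dd ts)) / Dd t' * (Dd t - Dd t')
      - Dd ts * (N t - N t' - fderiv ℝ N ts v) + N ts * (Dd t - Dd t' - fderiv ℝ Dd ts v) := by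
      field_simp; ring
    have b1 : |Dd ts * Dd t * (N t / Dd t - N t' / Dd t')| ≤ Γ ^ 2 * m := by
      rw [abs_mul, abs_mul, sq]; gcongr
    have b2 : |(Dd ts * (N t' - N ts) - N ts * (Dd t' - Dd ts)) / Dd t' * (Dd t - Dd t')| ≤ (2 * Γ ^ 3 * ρ / d0) * ‖v‖ := by
      have c1 : |Dd ts * (N t' - N ts) - N ts * (Dd t' - Dd ts)| ≤ 2 * Γ ^ 2 * ρ := by
        refine (abs_sub _ _).trans ?_
        rw [abs_mul, abs_mul]
        have i1 : |Dd ts| * |N t' - N ts| ≤ Γ * (Γ * ρ) := by gcongr; exact lN.trans (by gcongr)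
        have i2 : |N ts| * |Dd t' - Dd ts| ≤ Γ * (Γ * ρ) := by gcongr; exact lD.trans (by gcongr)
        nlinarith
      rw [abs_mul, abs_div]
      calc _ ≤ (2 * Γ ^ 2 * ρ) / d0 * (Γ * ‖v‖) := by gcongr
        _ = _ := by ring
    have b3 : |Dd ts * (N t - N t' - fderiv ℝ N ts v)| ≤ Γ * (Γ * ρ * ‖v‖) := by
      rw [abs_mul]; gcongr
    have b4 : |N ts * (Dd t - Dd t' - fderiv ℝ Dd ts v)| ≤ Γ * (Γ * ρ * ‖v‖) := by
      rw [abs_mul]; gcongr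
    rw [id1]
    have b5 : Γ * (Γ * ρ * ‖v‖) ≤ e / 4 * ‖v‖ := by
      have : Γ * (Γ * ρ * ‖v‖) = Γ ^ 2 * ρ * ‖v‖ := by ring
      rw [this]
      gcongr
      exact le_trans (by gcongr) hee
    have b6 : (2 * Γ ^ 3 * ρ / d0) = e / 2 := by rw [he]; ring
    rw [b6] at b2
    have gen : ∀ x1 x2 x3 x4 : ℝ, |x1 + x2 - x3 + x4| ≤ |x1| + |x2| + |x3| + |x4| := fun x1 x2 x3 x4 => by
      have i1 := abs_add_le (x1 + x2 - x3) x4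
      have i2 := abs_sub (x1 + x2) x3
      have i3 := abs_add_le x1 x2
      linarith
    refine (gen _ _ _ _).trans ?_
    linarith
  have h5 := (hadj v).trans (mul_le_mul_of_nonneg_left (max_le hNb hGb) (by linarith : 0 ≤ Γ))
  have h6 : Γ * e ≤ q0 / 2 := by
    rw [he, mul_div_assoc', div_le_div_iff₀ hd0 (by norm_num)]
    nlinarith
  have h7 : Γ * e * ‖v‖ ≤ q0 / 2 * ‖v‖ := by gcongr
  have h8 : q0 / 2 * ‖v‖ ≤ Γ ^ 3 * m := by nlinarith
  rw [div_mul_eq_mul_div, le_div_iff₀ hq0]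
  linarith

/-- quantitative data for the local estimate -/
structure LocDat (Φi Φj Φk : X3 → Vec2) (ai aj ak uj uk : X3 → ℝ) (Tj Tk : X3 → X3) (Dt : X9 → ℝ)
    (K : Set X3) (Γ : ℝ) : Prop where
  one_le : 1 ≤ Γ
  tj : TayOn Φj K Γ
  tk : TayOn Φk K Γ
  bi : ∀ p ∈ K, ‖Φi p‖ ≤ Γ
  bai : ∀ p ∈ K, |ai p| ≤ Γ
  baj : ∀ p ∈ K, |aj p| ≤ Γ
  bak : ∀ p ∈ K, |ak p| ≤ Γ
  buj : ∀ p ∈ K, |uj p| ≤ Γ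
  buk : ∀ p ∈ K, |uk p| ≤ Γ
  bTj : ∀ p ∈ K, ‖Tj p‖ ≤ Γ
  bTk : ∀ p ∈ K, ‖Tk p‖ ≤ Γ
  hTj : ∀ p ∈ K, ∀ v : X3, ‖uj p • v - v.1.1 • Tj p‖ ≤ Γ * ‖fderiv ℝ Φj p v‖
  hTk : ∀ p ∈ K, ∀ v : X3, ‖uk p • v - v.1.1 • Tk p‖ ≤ Γ * ‖fderiv ℝ Φk p v‖
  tN : TayOn (fN ai aj ak) (K ×ˢ (K ×ˢ K)) Γ
  tD : TayOn (fD ai aj ak) (K ×ˢ (K ×ˢ K)) Γ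
  tG : TayOn (fG Φi Φj Φk) (K ×ˢ (K ×ˢ K)) Γ
  tDt : TayOn Dt (K ×ˢ (K ×ˢ K)) Γ
  hadj : ∀ t ∈ K ×ˢ (K ×ˢ K), ∀ v, |Dt t| * ‖v‖ ≤ Γ * max
    |fD ai aj ak t * fderiv ℝ (fN ai aj ak) t v - fN ai aj ak t * fderiv ℝ (fD ai aj ak) t v|
    ‖fderiv ℝ (fG Φi Φj Φk) t v‖
  diag : ∀ p ∈ K, Dt (p, p, p) = 0

lemma bilip (Φ : X3 → Vec2) (u : X3 → ℝ) (T : X3 → X3) (K : Set X3) (Γ δ : ℝ) (hΓ : 1 ≤ Γ)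
    (hδ : 0 < δ) (hδΓ : Γ * δ ≤ 1) (hδ1 : 100 * δ ≤ 1)
    (tΦ : TayOn Φ K Γ) (bT : ∀ p ∈ K, ‖T p‖ ≤ Γ)
    (hT : ∀ p ∈ K, ∀ v : X3, ‖u p • v - v.1.1 • T p‖ ≤ Γ * ‖fderiv ℝ Φ p v‖)
    (p q : X3) (hp : p ∈ K) (hq : q ∈ K) (hpq : ‖p - q‖ ≤ 2 * δ ^ 25) (hu : δ ≤ |u q|) :
    ‖p - q‖ ≤ (δ⁻¹) ^ 3 * ‖chi Φ p - chi Φ q‖ := by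
  set v := p - q with hv
  set m := ‖chi Φ p - chi Φ q‖ with hm
  have m1 : |v.1.1| ≤ m := norm_fst_le (chi Φ p - chi Φ q)
  have m2 : ‖Φ p - Φ q‖ ≤ m := norm_snd_le (chi Φ p - chi Φ q)
  have hm0 : 0 ≤ m := norm_nonneg _
  have nv := norm_nonneg v
  have h1 := hT q hq v
  have h2 := tΦ.tay p hp q hq q hq (2 * δ ^ 25) hpq (by simp; positivity)
  have h4 : ‖fderiv ℝ Φ q v‖ ≤ m + Γ * (2 * δ ^ 25) * ‖v‖ := by
    calc ‖fderiv ℝ Φ q v‖ = ‖(Φ p - Φ q) - (Φ p - Φ q - fderiv ℝ Φ q v)‖ := by congr 1; abel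
        _ ≤ _ := (norm_sub_le _ _).trans (by gcongr)
  have h5 : ‖u q • v‖ ≤ ‖u q • v - v.1.1 • T q‖ + ‖v.1.1 • T q‖ := norm_le_norm_sub_add _ _
  have h6 : ‖v.1.1 • T q‖ ≤ m * Γ := by
    rw [norm_smul, Real.norm_eq_abs]; gcongr; exact bT q hq
  rw [norm_smul, Real.norm_eq_abs] at h5
  have h7 : δ * ‖v‖ ≤ |u q| * ‖v‖ := by gcongr
  have h8 : Γ * ‖fderiv ℝ Φ q v‖ ≤ Γ * (m + Γ * (2 * δ ^ 25) * ‖v‖) := by gcongr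
  have h9 : Γ * Γ * (2 * δ ^ 25) ≤ δ / 2 := by
    have : Γ * Γ * (2 * δ ^ 25) = 2 * ((Γ * δ) ^ 2 * (δ ^ 22 * δ)) := by ring
    rw [this]
    have e1 : (Γ * δ) ^ 2 ≤ 1 := pow_le_one₀ (by positivity) hδΓ
    have e2 : δ ^ 22 ≤ 1 / 4 := by
      calc δ ^ 22 ≤ δ ^ 1 := pow_le_pow_of_le_one hδ.le (by linarith) (by norm_num)
        _ ≤ 1 / 4 := by linarith
    calc 2 * ((Γ * δ) ^ 2 * (δ ^ 22 * δ)) ≤ 2 * (1 * (1 / 4 * δ)) := by gcongr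
      _ = δ / 2 := by ring
  have h10 : Γ * Γ * (2 * δ ^ 25) * ‖v‖ ≤ δ / 2 * ‖v‖ := by gcongr
  have h11 : δ * ‖v‖ ≤ 4 * Γ * m := by nlinarith
  have h12 : δ ^ 3 * ‖v‖ ≤ m := by
    calc δ ^ 3 * ‖v‖ = δ ^ 2 * (δ * ‖v‖) := by ring
      _ ≤ δ ^ 2 * (4 * Γ * m) := by gcongr
      _ = (4 * δ) * (Γ * δ) * m := by ring
      _ ≤ 1 * 1 * m := by gcongr; linarith
      _ = m := by ring
  rw [inv_pow, ← div_eq_inv_mul, le_div_iff₀ (by positivity)]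
  linarith

end SM6d

section SM6e
lemma loc_Dt (Φj Φk : X3 → Vec2) (uj uk : X3 → ℝ) (Tj Tk : X3 → X3) (Dt : X9 → ℝ)
    (K : Set X3) (Γ δ : ℝ) (hΓ : 1 ≤ Γ) (hδ : 0 < δ) (hδΓ : Γ * δ ≤ 1) (hδ1 : 100 * δ ≤ 1)
    (tj : TayOn Φj K Γ) (tk : TayOn Φk K Γ) (buj : ∀ p ∈ K, |uj p| ≤ Γ) (buk : ∀ p ∈ K, |uk p| ≤ Γ)
    (hTj : ∀ p ∈ K, ∀ v : X3, ‖uj p • v - v.1.1 • Tj p‖ ≤ Γ * ‖fderiv ℝ Φj p v‖)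
    (hTk : ∀ p ∈ K, ∀ v : X3, ‖uk p • v - v.1.1 • Tk p‖ ≤ Γ * ‖fderiv ℝ Φk p v‖)
    (tDt : TayOn Dt (K ×ˢ (K ×ˢ K)) Γ) (diag : ∀ p ∈ K, Dt (p, p, p) = 0)
    (p1 p p3 : X3) (h1 : p1 ∈ K) (h : p ∈ K) (h3 : p3 ∈ K) (e1 : ‖p1 - p‖ ≤ 2 * δ ^ 25)
    (e3 : ‖p3 - p‖ ≤ 2 * δ ^ 25) (hj : Φj p1 = Φj p) (hk : Φk p3 = Φk p)
    (hs : δ ^ 45 ≤ |uk p * fderiv ℝ Dt (p, p, p) (Tj p, 0, 0) * (p1.1.1 - p.1.1) +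
      uj p * fderiv ℝ Dt (p, p, p) (0, 0, Tk p) * (p3.1.1 - p.1.1)|) :
    δ ^ 48 ≤ |Dt (p1, p, p3)| := by
  set F := fderiv ℝ Dt (p, p, p) with hF
  set r := δ ^ 25 with hr
  have hr0 : 0 ≤ r := by positivity
  have hppp : ((p, p, p) : X9) ∈ K ×ˢ (K ×ˢ K) := ⟨h, h, h⟩
  have nd : ‖((p1, p, p3) : X9) - (p, p, p)‖ ≤ 2 * r := by
    simp only [Prod.mk_sub_mk, sub_self, Prod.norm_def, norm_zero]
    exact max_le e1 (max_le (by positivity) e3)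
  have a1 := tDt.tay (p1, p, p3) ⟨h1, h, h3⟩ (p, p, p) hppp (p, p, p) hppp (2 * r) nd (by simp; positivity)
  rw [diag p h, sub_zero, Real.norm_eq_abs] at a1
  have bF := tDt.bd' _ hppp
  have a2 : F (((p1, p, p3) : X9) - (p, p, p)) = F (p1 - p, 0, 0) + F (0, 0, p3 - p) := by
    rw [← map_add]; congr 1; simp
  have key : ∀ (Φ : X3 → Vec2) (u : X3 → ℝ) (T : X3 → X3), TayOn Φ K Γ → 
      (∀ p ∈ K, ∀ v : X3, ‖u p • v - v.1.1 • T p‖ ≤ Γ * ‖fderiv ℝ Φ p v‖) → ∀ q ∈ K, ‖q - p‖ ≤ 2 * r →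
      Φ q = Φ p → ‖u p • (q - p) - (q.1.1 - p.1.1) • T p‖ ≤ Γ * (Γ * (2 * r) * (2 * r)) := by
    intro Φ u T tΦ hT q hq hqp hΦ
    have b1 := tΦ.tay q hq p h p h (2 * r) hqp (by simp; positivity)
    rw [hΦ, sub_self, zero_sub, norm_neg] at b1
    refine (hT p h (q - p)).trans ?_
    gcongr
    exact b1.trans (by gcongr)
  have kj := key Φj uj Tj tj hTj p1 h1 e1 hj
  have kk := key Φk uk Tk tk hTk p3 h3 e3 hk
  set vj := uj p • (p1 - p) - (p1.1.1 - p.1.1) • Tj p with hvj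
  set vk := uk p • (p3 - p) - (p3.1.1 - p.1.1) • Tk p with hvk
  have c1 : uj p * F (p1 - p, 0, 0) = (p1.1.1 - p.1.1) * F (Tj p, 0, 0) + F (vj, 0, 0) := by
    rw [← smul_eq_mul, ← smul_eq_mul, ← map_smul, ← map_smul, ← map_add]; congr 1; simp [hvj]
  have c3 : uk p * F (0, 0, p3 - p) = (p3.1.1 - p.1.1) * F (0, 0, Tk p) + F (0, 0, vk) := by
    rw [← smul_eq_mul, ← smul_eq_mul, ← map_smul, ← map_smul, ← map_add]; congr 1; simp [hvk]
  have d1 : |F (vj, 0, 0)| ≤ Γ * (Γ * (Γ * (2 * r) * (2 * r))) := by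
    rw [← Real.norm_eq_abs]
    refine (F.le_opNorm _).trans ?_
    gcongr
    simpa [Prod.norm_def] using kj
  have d3 : |F (0, 0, vk)| ≤ Γ * (Γ * (Γ * (2 * r) * (2 * r))) := by
    rw [← Real.norm_eq_abs]
    refine (F.le_opNorm _).trans ?_
    gcongr
    simpa [Prod.norm_def] using kk
  rw [a2] at a1
  set L := uk p * F (Tj p, 0, 0) * (p1.1.1 - p.1.1) + uj p * F (0, 0, Tk p) * (p3.1.1 - p.1.1) with hL
  set E0 := Dt (p1, p, p3) - (F (p1 - p, 0, 0) + F (0, 0, p3 - p)) with hE0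
  have id : L = uj p * uk p * Dt (p1, p, p3) - uj p * uk p * E0 - uk p * F (vj, 0, 0) - uj p * F (0, 0, vk) := by
    rw [hL, hE0]
    linear_combination (-uk p) * c1 + (-uj p) * c3
  have uj1 := buj p h
  have uk1 := buk p h
  have f1 : |uj p * uk p * Dt (p1, p, p3)| ≤ Γ * Γ * |Dt (p1, p, p3)| := by
    rw [abs_mul, abs_mul]; gcongr
  have f2 : |uj p * uk p * E0| ≤ Γ * Γ * (Γ * (2 * r) * (2 * r)) := by
    rw [abs_mul, abs_mul]; gcongr; exact a1.trans (by gcongr)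
  have f3 : |uk p * F (vj, 0, 0)| ≤ Γ * (Γ * (Γ * (Γ * (2 * r) * (2 * r)))) := by
    rw [abs_mul]; gcongr
  have f4 : |uj p * F (0, 0, vk)| ≤ Γ * (Γ * (Γ * (Γ * (2 * r) * (2 * r)))) := by
    rw [abs_mul]; gcongr
  have g : |L| ≤ Γ ^ 2 * |Dt (p1, p, p3)| + 12 * Γ ^ 4 * r ^ 2 := by
    rw [id]
    have gen : ∀ x1 x2 x3 x4 : ℝ, |x1 - x2 - x3 - x4| ≤ |x1| + |x2| + |x3| + |x4| := fun x1 x2 x3 x4 => by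
      have i1 := abs_sub (x1 - x2 - x3) x4
      have i2 := abs_sub (x1 - x2) x3
      have i3 := abs_sub x1 x2
      linarith
    refine (gen _ _ _ _).trans ?_
    have : Γ ^ 3 * r ^ 2 ≤ Γ ^ 4 * r ^ 2 := by gcongr <;> norm_num
    nlinarith
  have hx1 : (Γ * δ) ^ 4 ≤ 1 := pow_le_one₀ (by positivity) hδΓ
  have hx2 : (Γ * δ) ^ 2 ≤ 1 := pow_le_one₀ (by positivity) hδΓ
  have g2 : 12 * Γ ^ 4 * r ^ 2 ≤ δ ^ 45 / 2 := by
    calc 12 * Γ ^ 4 * r ^ 2 = (Γ * δ) ^ 4 * (12 * δ * δ ^ 45) := by rw [hr]; ring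
      _ ≤ 1 * (1 / 2 * δ ^ 45) := by gcongr; linarith
      _ = _ := by ring
  have g3 : δ ^ 45 / 2 ≤ Γ ^ 2 * |Dt (p1, p, p3)| := by linarith
  calc δ ^ 48 = 2 * δ * δ ^ 2 * (δ ^ 45 / 2) := by ring
    _ ≤ 2 * δ * δ ^ 2 * (Γ ^ 2 * |Dt (p1, p, p3)|) := by gcongr
    _ = 2 * δ * ((Γ * δ) ^ 2) * |Dt (p1, p, p3)| := by ring
    _ ≤ 1 * 1 * |Dt (p1, p, p3)| := by gcongr; linarith
    _ = _ := by ring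

lemma loc_rel (Γ ε x1 x2 x3 x4 x5 x6 a1 a2 b1 b2 c1 c2 : ℝ) (hΓ : 1 ≤ Γ) (hε : 0 ≤ ε)
    (r1 : |x1 * a1 - x2 * a2| ≤ Γ * ε) (r2 : |x2 * b1 - x3 * b2| ≤ Γ * ε) (r3 : |x3 * c1 - x4 * c2| ≤ Γ * ε)
    (h1 : |a2| ≤ Γ) (h2 : |b1| ≤ Γ) (h3 : |b2| ≤ Γ) (h4 : |c1| ≤ Γ) :
    |x1 * (a1 * b1 * c1) - x4 * (a2 * b2 * c2)| ≤ 3 * Γ ^ 3 * ε := by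
  have id : x1 * (a1 * b1 * c1) - x4 * (a2 * b2 * c2) =
    (x1 * a1 - x2 * a2) * b1 * c1 + (x2 * b1 - x3 * b2) * a2 * c1 + (x3 * c1 - x4 * c2) * a2 * b2 := by ring
  have hΓ0 : 0 ≤ Γ := by linarith
  have k1 : |(x1 * a1 - x2 * a2) * b1 * c1| ≤ (Γ * ε) * Γ * Γ := by rw [abs_mul, abs_mul]; gcongr
  have k2 : |(x2 * b1 - x3 * b2) * a2 * c1| ≤ (Γ * ε) * Γ * Γ := by rw [abs_mul, abs_mul]; gcongr
  have k3 : |(x3 * c1 - x4 * c2) * a2 * b2| ≤ (Γ * ε) * Γ * Γ := by rw [abs_mul, abs_mul]; gcongr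
  rw [id]
  have i1 := abs_add_le ((x1 * a1 - x2 * a2) * b1 * c1 + (x2 * b1 - x3 * b2) * a2 * c1) ((x3 * c1 - x4 * c2) * a2 * b2)
  have i2 := abs_add_le ((x1 * a1 - x2 * a2) * b1 * c1) ((x2 * b1 - x3 * b2) * a2 * c1)
  nlinarith

end SM6e

section SM6f
/-- hypotheses on the set `A` and the functions in the local estimate -/
structure LocHyp (Φi Φj Φk : X3 → Vec2) (ai aj ak uj uk : X3 → ℝ) (Tj : X3 → X3) (Dt : X9 → ℝ)
    (K : Set X3) (Γ δ ε : ℝ) (A : Set X3) (fi fj fk : Vec2 → ℝ) : Prop where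
  sub : A ⊆ K
  lai : ∀ p ∈ A, δ ≤ |ai p|
  laj : ∀ p ∈ A, δ ≤ |aj p|
  lak : ∀ p ∈ A, δ ≤ |ak p|
  luj : ∀ p ∈ A, δ ≤ |uj p|
  luk : ∀ p ∈ A, δ ≤ |uk p|
  lK : ∀ p ∈ A, δ ≤ |fderiv ℝ Dt (p, p, p) (Tj p, 0, 0)|
  lf : ∀ p ∈ A, δ ≤ |fi (Φi p)|
  rij : ∀ p ∈ A, |fi (Φi p) * aj p - fj (Φj p) * ai p| ≤ Γ * ε
  rjk : ∀ p ∈ A, |fj (Φj p) * ak p - fk (Φk p) * aj p| ≤ Γ * ε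
  rki : ∀ p ∈ A, |fk (Φk p) * ai p - fi (Φi p) * ak p| ≤ Γ * ε

lemma loc_W : ∃ C5 : ℝ, 0 ≤ C5 ∧ ∀ (Φi Φj Φk : X3 → Vec2) (ai aj ak uj uk : X3 → ℝ) (Tj Tk : X3 → X3) (Dt : X9 → ℝ)
    (K : Set X3) (Γ C9 : ℝ), LocDat Φi Φj Φk ai aj ak uj uk Tj Tk Dt K Γ → 0 ≤ C9 →
    (∀ η : ℝ, 0 < η → η ≤ 1 → ∃ T : Finset X9, (T.card : ℝ) ≤ C9 * (η⁻¹) ^ 9 ∧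
      K ×ˢ (K ×ˢ K) ⊆ ⋃ z ∈ T, closedBall z η) →
    ∀ (δ ε : ℝ) (A : Set X3) (fi fj fk : Vec2 → ℝ) (z0 : X3), 0 < δ → Γ * δ ≤ 1 → 100 * δ ≤ 1 → 0 ≤ ε →
    Measurable fi → A ⊆ closedBall z0 (δ ^ 25) →
    LocHyp Φi Φj Φk ai aj ak uj uk Tj Dt K Γ δ ε A fi fj fk →
    volume {w : (Vec2 × ℝ) × (ℝ × ℝ) | w.1 ∈ A ∧
      (w.2.1, Φk w.1) ∈ chi Φk '' A ∧ (w.2.2, Φj w.1) ∈ chi Φj '' A ∧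
      δ ^ 45 ≤ |uk w.1 * fderiv ℝ Dt (w.1, w.1, w.1) (Tj w.1, 0, 0) * (w.2.2 - w.1.1.1) +
        uj w.1 * fderiv ℝ Dt (w.1, w.1, w.1) (0, 0, Tk w.1) * (w.2.1 - w.1.1.1)|} ≤
      ENNReal.ofReal (C9 * C5 * ε * (δ⁻¹) ^ 777) := by
  obtain ⟨C5, hC5, H5⟩ := expand_measure ((Vec2 × ℝ) × (ℝ × ℝ)) ((Vec2 × Vec2) × ℝ) volume volume (by simp)
  have hfr : Module.finrank ℝ ((Vec2 × ℝ) × (ℝ × ℝ)) = 5 := by simp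
  rw [hfr] at H5
  refine ⟨C5, hC5, ?_⟩
  intro Φi Φj Φk ai aj ak uj uk Tj Tk Dt K Γ C9 LD hC9 hcov δ ε A fi fj fk z0 hδ hδΓ hδ1 hε hfi hAz LH
  have hΓ := LD.one_le
  set W := {w : (Vec2 × ℝ) × (ℝ × ℝ) | w.1 ∈ A ∧
      (w.2.1, Φk w.1) ∈ chi Φk '' A ∧ (w.2.2, Φj w.1) ∈ chi Φj '' A ∧
      δ ^ 45 ≤ |uk w.1 * fderiv ℝ Dt (w.1, w.1, w.1) (Tj w.1, 0, 0) * (w.2.2 - w.1.1.1) +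
        uj w.1 * fderiv ℝ Dt (w.1, w.1, w.1) (0, 0, Tk w.1) * (w.2.1 - w.1.1.1)|} with hW
  have hch : ∀ w : (Vec2 × ℝ) × (ℝ × ℝ), ∃ q : X3 × X3, w ∈ W → (q.1 ∈ A ∧ q.2 ∈ A ∧ q.1.1.1 = w.2.2 ∧ Φj q.1 = Φj w.1 ∧
      q.2.1.1 = w.2.1 ∧ Φk q.2 = Φk w.1) := by
    intro w
    by_cases hw : w ∈ W
    · obtain ⟨h1, ⟨p3, hp3, e3⟩, ⟨p1, hp1, e1⟩, h4⟩ := hw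
      refine ⟨(p1, p3), fun _ => ⟨hp1, hp3, ?_⟩⟩
      simp only [chi, Prod.mk.injEq] at e1 e3
      exact ⟨e1.1, e1.2, e3.1, e3.2⟩
    · exact ⟨0, fun h => absurd h hw⟩
  choose q hq using hch
  set t : (Vec2 × ℝ) × (ℝ × ℝ) → X9 := fun w => ((q w).1, w.1, (q w).2) with ht
  set Θ : (Vec2 × ℝ) × (ℝ × ℝ) → (Vec2 × Vec2) × ℝ := fun w =>
    ((Φi (q w).1, Φi (q w).2), fN ai aj ak (t w) / fD ai aj ak (t w)) with hΘ
  set e := 3 * Γ ^ 3 * ε / δ ^ 3 with he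
  set S := {w : (Vec2 × Vec2) × ℝ | ‖w.1.1‖ ≤ Γ ∧ ‖w.1.2‖ ≤ Γ ∧ δ ≤ |fi w.1.1| ∧ |w.2 * fi w.1.1 - fi w.1.2| ≤ e} with hS
  have hSv := vol_S fi hfi Γ δ e (by linarith) hδ (by positivity)
  have htK : ∀ w ∈ W, t w ∈ K ×ˢ (K ×ˢ K) := fun w hw =>
    ⟨LH.sub (hq w hw).1, LH.sub hw.1, LH.sub (hq w hw).2.1⟩
  have hDlow : ∀ w ∈ W, δ ^ 3 ≤ |fD ai aj ak (t w)| := by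
    intro w hw
    have l1 := LH.lai _ (hq w hw).1
    have l2 := LH.laj _ hw.1
    have l3 := LH.lak _ (hq w hw).2.1
    simp only [fD, ht, abs_mul]
    calc δ ^ 3 = δ * δ * δ := by ring
      _ ≤ _ := by gcongr
  have hΘS : ∀ w ∈ W, Θ w ∈ S := by
    intro w hw
    obtain ⟨h1, h3, x1, y1, x3, y3⟩ := hq w hw
    refine ⟨LD.bi _ (LH.sub h1), LD.bi _ (LH.sub h3), LH.lf _ h1, ?_⟩
    have r1 := LH.rij _ h1
    have r2 := LH.rjk _ hw.1
    have r3 := LH.rki _ h3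
    rw [y1] at r1
    rw [y3] at r3
    have := loc_rel Γ ε _ _ _ _ 0 0 _ _ _ _ _ _ hΓ hε r1 r2 r3 (LD.bai _ (LH.sub h1)) (LD.bak _ (LH.sub hw.1))
      (LD.baj _ (LH.sub hw.1)) (LD.bai _ (LH.sub h3))
    have hD := hDlow w hw
    have hDne : fD ai aj ak (t w) ≠ 0 := fun h => by
      rw [h, abs_zero] at hD; have : 0 < δ ^ 3 := by positivity
      linarith
    have id : fN ai aj ak (t w) / fD ai aj ak (t w) * fi (Φi (q w).1) - fi (Φi (q w).2) =
      (fi (Φi (q w).1) * fN ai aj ak (t w) - fi (Φi (q w).2) * fD ai aj ak (t w)) / fD ai aj ak (t w) := by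
      field_simp
    simp only [hΘ]
    rw [id, abs_div, he]
    gcongr
    exact this
  obtain ⟨T, hTc, hTK⟩ := hcov (δ ^ 56) (by positivity) (pow_le_one₀ hδ.le (by linarith))
  have hQ : ∀ w ∈ W, δ ^ 48 ≤ |Dt (t w)| := by
    intro w hw
    obtain ⟨h1, h3, x1, y1, x3, y3⟩ := hq w hw
    have dd : ∀ p ∈ A, ∀ p' ∈ A, ‖p - p'‖ ≤ 2 * δ ^ 25 := fun p hp p' hp' => by
      have u1 := hAz hp; have u2 := hAz hp'
      rw [mem_closedBall] at u1 u2
      rw [← dist_eq_norm]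
      linarith [dist_triangle_right p p' z0]
    refine loc_Dt Φj Φk uj uk Tj Tk Dt K Γ δ hΓ hδ hδΓ hδ1 LD.tj LD.tk LD.buj LD.buk LD.hTj LD.hTk LD.tDt LD.diag
      _ _ _ (LH.sub h1) (LH.sub hw.1) (LH.sub h3) (dd _ h1 _ hw.1) (dd _ h3 _ hw.1) y1 y3 ?_
    rw [x1, x3]
    exact hw.2.2.2
  have hΓδ4 : (Γ * δ) ^ 4 ≤ 1 := pow_le_one₀ (by positivity) hδΓ
  have hΓδ3 : (Γ * δ) ^ 3 ≤ 1 := pow_le_one₀ (by positivity) hδΓ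
  have hΓδ7 : (Γ * δ) ^ 7 ≤ 1 := pow_le_one₀ (by positivity) hδΓ
  have hball : ∀ z ∈ T, volume (W ∩ {w | t w ∈ closedBall z (δ ^ 56)}) ≤
      ENNReal.ofReal (C5 * ((δ⁻¹) ^ 52) ^ 5) * ENNReal.ofReal (32 * Γ ^ 4 * (e / δ)) := by
    intro z hz
    refine (H5 _ Θ ((δ⁻¹) ^ 52) (by positivity) ?_).trans ?_
    · rintro w ⟨hw, hwz⟩ w' ⟨hw', hwz'⟩
      have hww : ‖w - w'‖ ≤ ‖t w - t w'‖ := by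
        have n1 : ‖(q w).1 - (q w').1‖ ≤ ‖t w - t w'‖ := norm_fst_le (t w - t w')
        have n2' : ‖(t w - t w').2‖ ≤ ‖t w - t w'‖ := norm_snd_le (t w - t w')
        have n2 : ‖w.1 - w'.1‖ ≤ ‖t w - t w'‖ := (norm_fst_le (t w - t w').2).trans n2'
        have n3 : ‖(q w).2 - (q w').2‖ ≤ ‖t w - t w'‖ := (norm_snd_le (t w - t w').2).trans n2'
        have m1 : ‖(q w).1.1.1 - (q w').1.1.1‖ ≤ ‖(q w).1 - (q w').1‖ :=
          (norm_fst_le ((q w).1 - (q w').1).1).trans (norm_fst_le _)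
        have m3 : ‖(q w).2.1.1 - (q w').2.1.1‖ ≤ ‖(q w).2 - (q w').2‖ :=
          (norm_fst_le ((q w).2 - (q w').2).1).trans (norm_fst_le _)
        rw [(hq w hw).2.2.1, (hq w' hw').2.2.1] at m1
        rw [(hq w hw).2.2.2.2.1, (hq w' hw').2.2.2.2.1] at m3
        refine max_le n2 (max_le (m3.trans n3) (m1.trans n1))
      refine hww.trans ?_
      have hm1 : ‖fG Φi Φj Φk (t w) - fG Φi Φj Φk (t w')‖ ≤ ‖Θ w - Θ w'‖ := by
        have g : ∀ w ∈ W, fG Φi Φj Φk (t w) = ((Θ w).1, 0, 0) := by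
          intro w hw
          obtain ⟨h1, h3, x1, y1, x3, y3⟩ := hq w hw
          simp only [fG, ht, hΘ, y1, y3, sub_self]
        rw [g w hw, g w' hw']
        refine max_le (norm_fst_le (Θ w - Θ w')) ?_
        simp
      have hm2 : |fN ai aj ak (t w) / fD ai aj ak (t w) - fN ai aj ak (t w') / fD ai aj ak (t w')| ≤ ‖Θ w - Θ w'‖ :=
        norm_snd_le (Θ w - Θ w')
      rw [mem_ofPred_eq, mem_closedBall] at hwz hwz'
      have hq0 : (0:ℝ) < δ ^ 48 := by positivity
      have := tuple_lip (fN ai aj ak) (fD ai aj ak) (fG Φi Φj Φk) _ Γ hΓ LD.tN LD.tD LD.tG (t w) (t w) (t w')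
        (htK w hw) (htK w hw) (htK w' hw') (2 * δ ^ 56) (δ ^ 3) (δ ^ 48) (by positivity)
        (pow_le_one₀ hδ.le (by linarith)) hq0 (by simp; positivity)
        (by rw [← dist_eq_norm]; linarith [dist_triangle_right (t w') (t w) z])
        (fun v => le_trans (by gcongr; exact hQ w hw) (LD.hadj _ (htK w hw) v))
        (hDlow w hw) (hDlow w' hw') (by
          calc 8 * Γ ^ 4 * (2 * δ ^ 56) = (Γ * δ) ^ 4 * (16 * δ * (δ ^ 3 * δ ^ 48)) := by ring
            _ ≤ 1 * (1 * (δ ^ 3 * δ ^ 48)) := by gcongr; linarith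
            _ = _ := by ring) _ hm1 hm2
      refine this.trans ?_
      gcongr
      rw [inv_pow, div_le_iff₀ hq0, ← div_eq_inv_mul, le_div_iff₀ (by positivity)]
      calc 2 * Γ ^ 3 * δ ^ 52 = (Γ * δ) ^ 3 * (2 * δ * δ ^ 48) := by ring
        _ ≤ 1 * (1 * δ ^ 48) := by gcongr; linarith
        _ = _ := by ring
    · gcongr
      refine le_trans (measure_mono ?_) hSv
      rintro _ ⟨w, hw, rfl⟩
      exact hΘS w hw.1
  have hcover : W ⊆ ⋃ z ∈ T, (W ∩ {w | t w ∈ closedBall z (δ ^ 56)}) := by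
    intro w hw
    have := hTK (htK w hw)
    simp only [mem_iUnion] at this ⊢
    obtain ⟨z, hz, h⟩ := this
    exact ⟨z, hz, hw, h⟩
  calc volume W ≤ ∑ z ∈ T, volume (W ∩ {w | t w ∈ closedBall z (δ ^ 56)}) :=
        (measure_mono hcover).trans (measure_biUnion_finset_le _ _)
    _ ≤ ∑ z ∈ T, ENNReal.ofReal (C5 * ((δ⁻¹) ^ 52) ^ 5) * ENNReal.ofReal (32 * Γ ^ 4 * (e / δ)) := Finset.sum_le_sum hball
    _ = ENNReal.ofReal (T.card * (C5 * ((δ⁻¹) ^ 52) ^ 5 * (32 * Γ ^ 4 * (e / δ)))) := by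
      rw [Finset.sum_const, nsmul_eq_mul, ← ENNReal.ofReal_mul (by positivity), ENNReal.ofReal_mul (p := (T.card : ℝ)) (by positivity),
        ENNReal.ofReal_natCast]
    _ ≤ _ := by
      apply ENNReal.ofReal_le_ofReal
      have k1 : 32 * Γ ^ 4 * (e / δ) ≤ ε * (δ⁻¹) ^ 13 := by
        rw [he, div_div, inv_pow, ← div_eq_mul_inv, mul_div_assoc', div_le_div_iff₀ (by positivity) (by positivity)]
        calc 32 * Γ ^ 4 * (3 * Γ ^ 3 * ε) * δ ^ 13 = (Γ * δ) ^ 7 * ((96 * δ) * δ * (ε * (δ ^ 3 * δ))) := by ring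
          _ ≤ 1 * (1 * 1 * (ε * (δ ^ 3 * δ))) := by gcongr <;> linarith
          _ = _ := by ring
      calc _ ≤ (C9 * ((δ ^ 56)⁻¹) ^ 9) * (C5 * ((δ⁻¹) ^ 52) ^ 5 * (ε * (δ⁻¹) ^ 13)) := by gcongr
        _ = C9 * C5 * ε * (δ⁻¹) ^ 777 := by rw [← inv_pow]; ring

/-- The local estimate. -/
lemma loc_est : ∃ C0 C5 : ℝ, 0 ≤ C0 ∧ 0 ≤ C5 ∧ ∀ (Φi Φj Φk : X3 → Vec2) (ai aj ak uj uk : X3 → ℝ) (Tj Tk : X3 → X3) (Dt : X9 → ℝ)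
    (K : Set X3) (Γ C9 : ℝ), LocDat Φi Φj Φk ai aj ak uj uk Tj Tk Dt K Γ → 0 ≤ C9 →
    (∀ η : ℝ, 0 < η → η ≤ 1 → ∃ T : Finset X9, (T.card : ℝ) ≤ C9 * (η⁻¹) ^ 9 ∧
      K ×ˢ (K ×ˢ K) ⊆ ⋃ z ∈ T, closedBall z η) →
    ∀ (δ ε : ℝ) (A : Set X3) (fi fj fk : Vec2 → ℝ) (z0 : X3), 0 < δ → Γ * δ ≤ 1 → 100 * δ ≤ 1 → C0 * δ ≤ 1 →
    2 * C9 * C5 * δ ≤ 1 → 0 ≤ ε → ε ≤ δ ^ 938 →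
    Measurable fi → MeasurableSet A → A ⊆ closedBall z0 (δ ^ 25) →
    LocHyp Φi Φj Φk ai aj ak uj uk Tj Dt K Γ δ ε A fi fj fk →
    volume A ≤ ENNReal.ofReal (3 * δ ^ 76) := by
  obtain ⟨C0, hC0, H0⟩ := bad_bound
  obtain ⟨C5, hC5, H5⟩ := loc_W
  refine ⟨C0, C5, hC0, hC5, ?_⟩
  intro Φi Φj Φk ai aj ak uj uk Tj Tk Dt K Γ C9 LD hC9 hcov δ ε A fi fj fk z0 hδ hδΓ hδ1 hδC0 hδC5 hε hεδ hfi hA hAz LH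
  have hΓ := LD.one_le
  have hW := H5 Φi Φj Φk ai aj ak uj uk Tj Tk Dt K Γ C9 LD hC9 hcov δ ε A fi fj fk z0 hδ hδΓ hδ1 hε hfi hAz LH
  have dd : ∀ p ∈ A, ∀ p' ∈ A, ‖p - p'‖ ≤ 2 * δ ^ 25 := fun p hp p' hp' => by
      have u1 := hAz hp; have u2 := hAz hp'
      rw [mem_closedBall] at u1 u2
      rw [← dist_eq_norm]
      linarith [dist_triangle_right p p' z0]
  have hΓΛ : Γ ≤ (δ⁻¹) ^ 3 := by
    rw [inv_pow, ← one_div, le_div_iff₀ (by positivity)]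
    calc Γ * δ ^ 3 = (Γ * δ) * δ ^ 2 := by ring
      _ ≤ 1 * 1 := by gcongr; exact pow_le_one₀ hδ.le (by linarith)
      _ = 1 := by ring
  have hbad : ∀ (Φ : X3 → Vec2) (u : X3 → ℝ) (T : X3 → X3), TayOn Φ K Γ → (∀ p ∈ K, ‖T p‖ ≤ Γ) →
      (∀ p ∈ K, ∀ v : X3, ‖u p • v - v.1.1 • T p‖ ≤ Γ * ‖fderiv ℝ Φ p v‖) → (∀ p ∈ A, δ ≤ |u p|) →
      volume {p | p ∈ A ∧ volume {ξ : ℝ | (ξ, Φ p) ∈ chi Φ '' A} < ENNReal.ofReal (δ ^ 42)} ≤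
      ENNReal.ofReal (δ ^ 76) := by
    intro Φ u T tΦ bT hT hu
    refine (H0 A Φ ((δ⁻¹) ^ 3) (δ ^ 25) (δ ^ 42) z0 hA (by positivity) (by positivity) (by positivity) hAz ?_ ?_).2.trans ?_
    · intro p hp q hq
      exact (tΦ.lip p (LH.sub hp) q (LH.sub hq)).trans (by gcongr)
    · intro p hp q hq
      exact bilip Φ u T K Γ δ hΓ hδ hδΓ hδ1 tΦ bT hT p q (LH.sub hp) (LH.sub hq) (dd p hp q hq) (hu q hq)
    · apply ENNReal.ofReal_le_ofReal
      have : C0 * ((δ⁻¹) ^ 3) ^ 5 * (δ ^ 25) ^ 2 * δ ^ 42 = (C0 * δ) * δ ^ 76 := by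
        field_simp
      rw [this]
      calc _ ≤ 1 * δ ^ 76 := by gcongr
        _ = _ := one_mul _
  have bj := hbad Φj uj Tj LD.tj LD.bTj LD.hTj LH.luj
  have bk := hbad Φk uk Tk LD.tk LD.bTk LD.hTk LH.luk
  set G := {p | p ∈ A ∧ ENNReal.ofReal (δ ^ 42) ≤ volume {ξ : ℝ | (ξ, Φj p) ∈ chi Φj '' A} ∧
    ENNReal.ofReal (δ ^ 42) ≤ volume {ξ : ℝ | (ξ, Φk p) ∈ chi Φk '' A}} with hG
  have hlow := lower_W G Φj Φk (chi Φj '' A) (chi Φk '' A)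
    (fun p => uk p * fderiv ℝ Dt (p, p, p) (Tj p, 0, 0)) (fun p => uj p * fderiv ℝ Dt (p, p, p) (0, 0, Tk p))
    (δ ^ 2) (δ ^ 45) (δ ^ 42) (by positivity) (by positivity) (by positivity) (by
      calc 4 * δ ^ 45 = (4 * δ) * (δ ^ 42 * δ ^ 2) := by ring
        _ ≤ 1 * (δ ^ 42 * δ ^ 2) := by gcongr; linarith
        _ = _ := one_mul _)
    (fun p hp => by
      rw [abs_mul, sq]
      have := LH.luk p hp.1
      have := LH.lK p hp.1
      gcongr) (fun p hp => hp.2.1) (fun p hp => hp.2.2)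
  have hGW : ENNReal.ofReal ((δ ^ 42) ^ 2 / 2) * volume G ≤ ENNReal.ofReal (C9 * C5 * ε * (δ⁻¹) ^ 777) := by
    refine hlow.trans ((measure_mono ?_).trans hW)
    rintro w ⟨h1, h2, h3, h4⟩
    exact ⟨h1.1, h2, h3, h4⟩
  have hGv : volume G ≤ ENNReal.ofReal (δ ^ 76) := by
    have hc : ENNReal.ofReal (C9 * C5 * ε * (δ⁻¹) ^ 777) ≤ ENNReal.ofReal ((δ ^ 42) ^ 2 / 2) * ENNReal.ofReal (δ ^ 76) := by
      rw [← ENNReal.ofReal_mul (by positivity)]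
      apply ENNReal.ofReal_le_ofReal
      calc C9 * C5 * ε * (δ⁻¹) ^ 777 ≤ C9 * C5 * δ ^ 938 * (δ⁻¹) ^ 777 := by gcongr
        _ = (2 * C9 * C5 * δ) * (δ ^ 160 / 2) := by field_simp
        _ ≤ 1 * (δ ^ 160 / 2) := by gcongr
        _ = _ := by ring
    have h0 : ENNReal.ofReal ((δ ^ 42) ^ 2 / 2) ≠ 0 := by
      rw [Ne, ENNReal.ofReal_eq_zero, not_le]; positivity
    exact (ENNReal.mul_le_mul_iff_right h0 ENNReal.ofReal_ne_top).1 (hGW.trans hc)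
  have hsub : A ⊆ G ∪ ({p | p ∈ A ∧ volume {ξ : ℝ | (ξ, Φj p) ∈ chi Φj '' A} < ENNReal.ofReal (δ ^ 42)} ∪
      {p | p ∈ A ∧ volume {ξ : ℝ | (ξ, Φk p) ∈ chi Φk '' A} < ENNReal.ofReal (δ ^ 42)}) := by
    intro p hp
    by_cases h1 : volume {ξ : ℝ | (ξ, Φj p) ∈ chi Φj '' A} < ENNReal.ofReal (δ ^ 42)
    · exact Or.inr (Or.inl ⟨hp, h1⟩)
    by_cases h2 : volume {ξ : ℝ | (ξ, Φk p) ∈ chi Φk '' A} < ENNReal.ofReal (δ ^ 42)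
    · exact Or.inr (Or.inr ⟨hp, h2⟩)
    exact Or.inl ⟨hp, not_lt.1 h1, not_lt.1 h2⟩
  refine (measure_mono hsub).trans ((measure_union_le _ _).trans ?_)
  have : (3 : ℝ) * δ ^ 76 = δ ^ 76 + (δ ^ 76 + δ ^ 76) := by ring
  rw [this, ENNReal.ofReal_add (by positivity) (by positivity), ENNReal.ofReal_add (by positivity) (by positivity)]
  exact add_le_add hGv ((measure_union_le _ _).trans (add_le_add bj bk))

end SM6f

section SM6g
lemma factor_low (Γ δ x y : ℝ) (n : ℕ) (hΓ : 1 ≤ Γ) (hy : |y| ≤ Γ ^ n) (h : 2 * Γ ^ 7 * δ ≤ |x * y|) (hn : n ≤ 6) (hδ : 0 ≤ δ) :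
    2 * Γ * δ ≤ |x| := by
  rw [abs_mul] at h
  have h1 : |x| * |y| ≤ |x| * Γ ^ 6 := by
    gcongr; exact hy.trans (pow_le_pow_right₀ hΓ hn)
  have h2 : 0 < Γ ^ 6 := by positivity
  have h3 : 2 * Γ * δ * Γ ^ 6 ≤ |x| * Γ ^ 6 := by nlinarith
  exact le_of_mul_le_mul_right h3 h2

set_option maxHeartbeats 1600000 in
lemma glob_est (Φi Φj Φk : X3 → Vec2) (ai aj ak uj uk : X3 → ℝ) (Tj Tk : X3 → X3) (Dt : X9 → ℝ)
    (K : Set X3) (Γ : ℝ) (LD : LocDat Φi Φj Φk ai aj ak uj uk Tj Tk Dt K Γ) (hK : IsCompact K)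
    (cov3 : CovOn K 3) (cov9 : CovOn (K ×ˢ (K ×ˢ K)) 9) (P : X3 → ℝ)
    (hP : ∀ p ∈ K, P p = fderiv ℝ Dt (p, p, p) (Tj p, 0, 0) * (ai p * aj p * ak p * uj p * uk p))
    (hPc : ContinuousOn P K) (hsub : SubBd volume P K) :
    ∃ κ : ℝ, 0 < κ ∧ ∃ C : ℝ, ∀ ε : ℝ, 0 < ε → ε ≤ 1 → ∀ (fi fj fk : Vec2 → ℝ) (E : Set X3), Measurable fi →
      MeasurableSet E → E ⊆ K →
      (∀ p ∈ E, |fi (Φi p) * aj p - fj (Φj p) * ai p| ≤ Γ * ε) →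
      (∀ p ∈ E, |fj (Φj p) * ak p - fk (Φk p) * aj p| ≤ Γ * ε) →
      (∀ p ∈ E, |fk (Φk p) * ai p - fi (Φi p) * ak p| ≤ Γ * ε) →
      (∀ p ∈ E, 1 ≤ |fi (Φi p)| ∨ 1 ≤ |fj (Φj p)| ∨ 1 ≤ |fk (Φk p)|) →
      volume E ≤ ENNReal.ofReal (C * ε ^ κ) := by
  obtain ⟨C0, C5, hC0, hC5, H⟩ := loc_est
  obtain ⟨C3, hC3, H3⟩ := cov3
  obtain ⟨C9, hC9, H9⟩ := cov9
  obtain ⟨κ, hκ, C', hC', HS⟩ := hsub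
  have hΓ := LD.one_le
  set Q := 100 + 2 * Γ ^ 7 + C0 + 2 * C9 * C5 with hQ
  have hQ1 : 100 ≤ Q := by
    have : 0 ≤ Γ ^ 7 := by positivity
    have : 0 ≤ C9 * C5 := by positivity
    linarith
  have hQ0 : 0 < Q := by linarith
  set κ1 := min 1 κ with hκ1
  have hκ1p : 0 < κ1 := lt_min one_pos hκ
  have hVfin : volume K ≠ ∞ := hK.measure_lt_top.ne
  set Vk := (volume K).toReal with hVk
  set Cb := 3 * C3 + C' * (2 * Γ ^ 7) ^ κ + Vk * Q ^ κ1 with hCb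
  refine ⟨κ1 / 938, by positivity, Cb, ?_⟩
  intro ε hε hε1 fi fj fk E hfi hE hEK r1 r2 r3 hl
  set δ := ε ^ ((938 : ℝ)⁻¹) with hδ
  have hδ0 : 0 < δ := rpow_pos_of_pos hε _
  have hδ1 : δ ≤ 1 := rpow_le_one hε.le hε1 (by positivity)
  have hδε : δ ^ 938 = ε := by
    rw [hδ, ← rpow_natCast, ← rpow_mul hε.le]; norm_num
  have hδκ : ε ^ (κ1 / 938) = δ ^ κ1 := by
    rw [hδ, ← rpow_mul hε.le]; congr 1; ring
  rw [hδκ]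
  have hC'' : 0 ≤ C' * (2 * Γ ^ 7) ^ κ := by positivity
  have hV0 : 0 ≤ Vk := ENNReal.toReal_nonneg
  by_cases hsm : Q * δ ≤ 1
  swap
  · push Not at hsm
    have : volume E ≤ ENNReal.ofReal Vk := by
      rw [hVk, ENNReal.ofReal_toReal hVfin]; exact measure_mono hEK
    refine this.trans (ENNReal.ofReal_le_ofReal ?_)
    have h1 : 1 ≤ Q ^ κ1 * δ ^ κ1 := by
      rw [← mul_rpow hQ0.le hδ0.le]; exact one_le_rpow hsm.le hκ1p.le
    have h2 : 0 < δ ^ κ1 := by positivity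
    calc Vk = Vk * 1 := (mul_one _).symm
      _ ≤ Vk * (Q ^ κ1 * δ ^ κ1) := by gcongr
      _ ≤ Cb * δ ^ κ1 := by
        rw [hCb, ← mul_assoc]; gcongr; linarith
  have hQle : ∀ x, x ≤ Q → x * δ ≤ 1 := fun x hx => le_trans (by gcongr) hsm
  have hΓ7 : Γ ≤ Γ ^ 7 := le_self_pow₀ hΓ (by norm_num)
  have hC95 : 0 ≤ C9 * C5 := by positivity
  have q1 : 100 * δ ≤ 1 := hQle _ hQ1
  have q2 : (2 * Γ ^ 7) * δ ≤ 1 := hQle _ (by linarith)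
  have q3 : Γ * δ ≤ 1 := hQle _ (by linarith)
  have q4 : C0 * δ ≤ 1 := hQle _ (by linarith)
  have q5 : (2 * C9 * C5) * δ ≤ 1 := hQle _ (by linarith)
  have hΓε : Γ * ε ≤ δ := by
    rw [← hδε]
    calc Γ * δ ^ 938 = (Γ * δ) * δ ^ 936 * δ := by ring
      _ ≤ 1 * 1 * δ := by gcongr; exact pow_le_one₀ hδ0.le hδ1
      _ = δ := by ring
  have hEP : MeasurableSet (E ∩ {p | p ∈ K ∧ 2 * Γ ^ 7 * δ ≤ |P p|}) := by
    refine hE.inter (IsClosed.measurableSet ?_)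
    have := hPc.abs.preimage_isClosed_of_isClosed hK.isClosed (isClosed_Ici (a := 2 * Γ ^ 7 * δ))
    exact this
  set E1 := E ∩ {p | p ∈ K ∧ 2 * Γ ^ 7 * δ ≤ |P p|} with hE1
  obtain ⟨T, hTc, hTK⟩ := H3 (δ ^ 25) (by positivity) (pow_le_one₀ hδ0.le hδ1)
  have hloc : ∀ z ∈ T, volume (E1 ∩ closedBall z (δ ^ 25)) ≤ ENNReal.ofReal (3 * δ ^ 76) := by
    intro z hz
    have hlow : ∀ p ∈ E1, 2 * Γ * δ ≤ |ai p| ∧ 2 * Γ * δ ≤ |aj p| ∧ 2 * Γ * δ ≤ |ak p| ∧ 2 * Γ * δ ≤ |uj p| ∧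
        2 * Γ * δ ≤ |uk p| ∧ 2 * Γ * δ ≤ |fderiv ℝ Dt (p, p, p) (Tj p, 0, 0)| := by
      rintro p ⟨hpE, hpK, hpP⟩
      rw [hP p hpK] at hpP
      have b1 := LD.bai p hpK
      have b2 := LD.baj p hpK
      have b3 := LD.bak p hpK
      have b4 := LD.buj p hpK
      have b5 := LD.buk p hpK
      have hΓ0 : 0 ≤ Γ := by linarith
      have b6 : |fderiv ℝ Dt (p, p, p) (Tj p, 0, 0)| ≤ Γ * Γ := by
        rw [← Real.norm_eq_abs]
        refine (ContinuousLinearMap.le_opNorm _ _).trans ?_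
        have := LD.tDt.bd' (p, p, p) ⟨hpK, hpK, hpK⟩
        gcongr
        simpa [Prod.norm_def] using LD.bTj p hpK
      set kh := fderiv ℝ Dt (p, p, p) (Tj p, 0, 0)
      refine ⟨?_, ?_, ?_, ?_, ?_, ?_⟩
      · refine factor_low Γ δ _ (kh * aj p * ak p * uj p * uk p) 6 hΓ ?_ (hpP.trans (le_of_eq (by congr 1; ring))) le_rfl hδ0.le
        simp only [abs_mul]
        calc _ ≤ (Γ * Γ) * Γ * Γ * Γ * Γ := by gcongr
          _ = _ := by ring
      · refine factor_low Γ δ _ (kh * ai p * ak p * uj p * uk p) 6 hΓ ?_ (hpP.trans (le_of_eq (by congr 1; ring))) le_rfl hδ0.le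
        simp only [abs_mul]
        calc _ ≤ (Γ * Γ) * Γ * Γ * Γ * Γ := by gcongr
          _ = _ := by ring
      · refine factor_low Γ δ _ (kh * ai p * aj p * uj p * uk p) 6 hΓ ?_ (hpP.trans (le_of_eq (by congr 1; ring))) le_rfl hδ0.le
        simp only [abs_mul]
        calc _ ≤ (Γ * Γ) * Γ * Γ * Γ * Γ := by gcongr
          _ = _ := by ring
      · refine factor_low Γ δ _ (kh * ai p * aj p * ak p * uk p) 6 hΓ ?_ (hpP.trans (le_of_eq (by congr 1; ring))) le_rfl hδ0.le
        simp only [abs_mul]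
        calc _ ≤ (Γ * Γ) * Γ * Γ * Γ * Γ := by gcongr
          _ = _ := by ring
      · refine factor_low Γ δ _ (kh * ai p * aj p * ak p * uj p) 6 hΓ ?_ (hpP.trans (le_of_eq (by congr 1; ring))) le_rfl hδ0.le
        simp only [abs_mul]
        calc _ ≤ (Γ * Γ) * Γ * Γ * Γ * Γ := by gcongr
          _ = _ := by ring
      · refine factor_low Γ δ _ (ai p * aj p * ak p * uj p * uk p) 5 hΓ ?_ hpP (by norm_num) hδ0.le
        simp only [abs_mul]
        calc _ ≤ Γ * Γ * Γ * Γ * Γ := by gcongr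
          _ = _ := by ring
    have h2δ : δ ≤ 2 * Γ * δ := by nlinarith
    refine H Φi Φj Φk ai aj ak uj uk Tj Tk Dt K Γ C9 LD hC9 H9 δ ε _ fi fj fk z hδ0 q3 q1 q4 q5 hε.le hδε.symm.le hfi
      (hEP.inter isClosed_closedBall.measurableSet) inter_subset_right ⟨fun p hp => hEK hp.1.1, ?_, ?_, ?_, ?_, ?_, ?_, ?_, ?_, ?_, ?_⟩
    · exact fun p hp => h2δ.trans (hlow p hp.1).1
    · exact fun p hp => h2δ.trans (hlow p hp.1).2.1
    · exact fun p hp => h2δ.trans (hlow p hp.1).2.2.1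
    · exact fun p hp => h2δ.trans (hlow p hp.1).2.2.2.1
    · exact fun p hp => h2δ.trans (hlow p hp.1).2.2.2.2.1
    · exact fun p hp => h2δ.trans (hlow p hp.1).2.2.2.2.2
    · intro p hp
      have hpE := hp.1.1
      have hpK := hEK hpE
      obtain ⟨l1, l2, l3, -, -, -⟩ := hlow p hp.1
      have key : ∀ x y a b : ℝ, |x * a - y * b| ≤ Γ * ε → |a| ≤ Γ → 2 * Γ * δ ≤ |b| → 1 ≤ |y| → δ ≤ |x| := by
        intro x y a b h1 h2 h3 h4
        have i1 := abs_sub_abs_le_abs_sub (y * b) (x * a)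
        rw [abs_sub_comm, abs_mul, abs_mul] at i1
        have i2 : |x| * |a| ≤ |x| * Γ := by gcongr
        have i3 : 1 * (2 * Γ * δ) ≤ |y| * |b| := by gcongr
        have i4 : Γ * δ ≤ Γ * |x| := by nlinarith
        exact le_of_mul_le_mul_left i4 (by linarith)
      rcases hl p hpE with h | h | h
      · linarith
      · exact key _ _ _ _ (r1 p hpE) (LD.baj p hpK) l1 h
      · exact key _ _ _ _ (by rw [abs_sub_comm]; exact r3 p hpE) (LD.bak p hpK) l1 h
    · exact fun p hp => r1 p hp.1.1
    · exact fun p hp => r2 p hp.1.1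
    · exact fun p hp => r3 p hp.1.1
  have hE1v : volume E1 ≤ ENNReal.ofReal (3 * C3 * δ) := by
    have hcover : E1 ⊆ ⋃ z ∈ T, (E1 ∩ closedBall z (δ ^ 25)) := by
      intro p hp
      have := hTK (hEK hp.1)
      simp only [mem_iUnion] at this ⊢
      obtain ⟨z, hz, h⟩ := this
      exact ⟨z, hz, hp, h⟩
    calc volume E1 ≤ ∑ z ∈ T, volume (E1 ∩ closedBall z (δ ^ 25)) :=
          (measure_mono hcover).trans (measure_biUnion_finset_le _ _)
      _ ≤ ∑ z ∈ T, ENNReal.ofReal (3 * δ ^ 76) := Finset.sum_le_sum hloc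
      _ = ENNReal.ofReal (T.card * (3 * δ ^ 76)) := by
        rw [Finset.sum_const, nsmul_eq_mul, ENNReal.ofReal_mul (p := (T.card : ℝ)) (by positivity), ENNReal.ofReal_natCast]
      _ ≤ _ := by
        apply ENNReal.ofReal_le_ofReal
        calc _ ≤ C3 * ((δ ^ 25)⁻¹) ^ 3 * (3 * δ ^ 76) := by gcongr
          _ = _ := by field_simp
  have hE2v := HS (2 * Γ ^ 7 * δ) (by positivity) q2
  have hs : E ⊆ E1 ∪ {p | p ∈ K ∧ |P p| ≤ 2 * Γ ^ 7 * δ} := by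
    intro p hp
    rcases le_total (2 * Γ ^ 7 * δ) |P p| with h | h
    · exact Or.inl ⟨hp, hEK hp, h⟩
    · exact Or.inr ⟨hEK hp, h⟩
  refine (measure_mono hs).trans ((measure_union_le _ _).trans ((add_le_add hE1v hE2v).trans ?_))
  rw [← ENNReal.ofReal_add (by positivity) (by positivity)]
  apply ENNReal.ofReal_le_ofReal
  have m1 : δ ≤ δ ^ κ1 := by
    conv_lhs => rw [← rpow_one δ]
    exact rpow_le_rpow_of_exponent_ge hδ0 hδ1 (min_le_left _ _)
  have m2 : δ ^ κ ≤ δ ^ κ1 := rpow_le_rpow_of_exponent_ge hδ0 hδ1 (min_le_right _ _)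
  rw [mul_rpow (by positivity) hδ0.le, ← mul_assoc]
  calc 3 * C3 * δ + C' * (2 * Γ ^ 7) ^ κ * δ ^ κ ≤ 3 * C3 * δ ^ κ1 + C' * (2 * Γ ^ 7) ^ κ * δ ^ κ1 := by gcongr
    _ = (3 * C3 + C' * (2 * Γ ^ 7) ^ κ) * δ ^ κ1 := by ring
    _ ≤ Cb * δ ^ κ1 := by
      gcongr
      have : 0 ≤ Vk * Q ^ κ1 := by positivity
      linarith

end SM6g

section SM7a
/-- the 9×9 matrix -/
def Mop (ai aj ak : X3 → ℝ) (Φi Φj Φk : X3 → Vec2) (t : X9) : X9 →L[ℝ] ℝ × Y8 :=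
  (fD ai aj ak t • fderiv ℝ (fN ai aj ak) t - fN ai aj ak t • fderiv ℝ (fD ai aj ak) t).prod
    (fderiv ℝ (fG Φi Φj Φk) t)

lemma fN_an {ai aj ak : X3 → ℝ} {R : Set X3} (hi : AnalyticOnNhd ℝ ai R) (hj : AnalyticOnNhd ℝ aj R)
    (hk : AnalyticOnNhd ℝ ak R) : AnalyticOnNhd ℝ (fN ai aj ak) (R ×ˢ (R ×ˢ R)) := by
  rintro ⟨p1, p2, p3⟩ ⟨h1, h2, h3⟩
  have e1 : AnalyticAt ℝ (fun t : X9 => aj t.1) (p1, p2, p3) := (hj p1 h1).comp analyticAt_fst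
  have e2 : AnalyticAt ℝ (fun t : X9 => ak t.2.1) (p1, p2, p3) :=
    AnalyticAt.fun_comp (f := fun t : X9 => t.2.1) (hk p2 h2) (AnalyticAt.fun_comp (f := fun t : X9 => t.2) analyticAt_fst analyticAt_snd)
  have e3 : AnalyticAt ℝ (fun t : X9 => ai t.2.2) (p1, p2, p3) :=
    AnalyticAt.fun_comp (f := fun t : X9 => t.2.2) (hi p3 h3) (AnalyticAt.fun_comp (f := fun t : X9 => t.2) analyticAt_snd analyticAt_snd)
  exact (e1.mul e2).mul e3

lemma fD_an {ai aj ak : X3 → ℝ} {R : Set X3} (hi : AnalyticOnNhd ℝ ai R) (hj : AnalyticOnNhd ℝ aj R)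
    (hk : AnalyticOnNhd ℝ ak R) : AnalyticOnNhd ℝ (fD ai aj ak) (R ×ˢ (R ×ˢ R)) :=
  fN_an hk hi hj

lemma fG_an {Φi Φj Φk : X3 → Vec2} {R : Set X3} (hi : AnalyticOnNhd ℝ Φi R) (hj : AnalyticOnNhd ℝ Φj R)
    (hk : AnalyticOnNhd ℝ Φk R) : AnalyticOnNhd ℝ (fG Φi Φj Φk) (R ×ˢ (R ×ˢ R)) := by
  rintro ⟨p1, p2, p3⟩ ⟨h1, h2, h3⟩
  have e1 : ∀ Φ : X3 → Vec2, AnalyticAt ℝ Φ p1 → AnalyticAt ℝ (fun t : X9 => Φ t.1) (p1, p2, p3) :=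
    fun Φ h => AnalyticAt.fun_comp (f := fun t : X9 => t.1) h analyticAt_fst
  have e2 : ∀ Φ : X3 → Vec2, AnalyticAt ℝ Φ p2 → AnalyticAt ℝ (fun t : X9 => Φ t.2.1) (p1, p2, p3) :=
    fun Φ h => AnalyticAt.fun_comp (f := fun t : X9 => t.2.1) h (AnalyticAt.fun_comp (f := fun t : X9 => t.2) analyticAt_fst analyticAt_snd)
  have e3 : ∀ Φ : X3 → Vec2, AnalyticAt ℝ Φ p3 → AnalyticAt ℝ (fun t : X9 => Φ t.2.2) (p1, p2, p3) :=
    fun Φ h => AnalyticAt.fun_comp (f := fun t : X9 => t.2.2) h (AnalyticAt.fun_comp (f := fun t : X9 => t.2) analyticAt_snd analyticAt_snd)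
  exact ((e1 _ (hi _ h1)).prod (e3 _ (hi _ h3))).prod
    (((e1 _ (hj _ h1)).sub (e2 _ (hj _ h2))).prod ((e2 _ (hk _ h2)).sub (e3 _ (hk _ h3))))

lemma clm_prod_an {E F G H : Type*} [NormedAddCommGroup E] [NormedSpace ℝ E] [NormedAddCommGroup F] [NormedSpace ℝ F]
    [NormedAddCommGroup G] [NormedSpace ℝ G] [NormedAddCommGroup H] [NormedSpace ℝ H]
    {f : E → F →L[ℝ] G} {g : E → F →L[ℝ] H} {x : E} (hf : AnalyticAt ℝ f x) (hg : AnalyticAt ℝ g x) :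
    AnalyticAt ℝ (fun y => (f y).prod (g y)) x := by
  have e : (fun y => (f y).prod (g y)) = fun y =>
      ContinuousLinearMap.compL ℝ F G (G × H) (ContinuousLinearMap.inl ℝ G H) (f y) +
      ContinuousLinearMap.compL ℝ F H (G × H) (ContinuousLinearMap.inr ℝ G H) (g y) := by
    funext y; ext v <;> simp
  rw [e]
  exact (((ContinuousLinearMap.compL ℝ F G (G × H) (ContinuousLinearMap.inl ℝ G H)).analyticAt _).comp' hf).add
    (((ContinuousLinearMap.compL ℝ F H (G × H) (ContinuousLinearMap.inr ℝ G H)).analyticAt _).comp' hg)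

lemma Mop_an {ai aj ak : X3 → ℝ} {Φi Φj Φk : X3 → Vec2} {R : Set X3} (hai : AnalyticOnNhd ℝ ai R)
    (haj : AnalyticOnNhd ℝ aj R) (hak : AnalyticOnNhd ℝ ak R)
    (hi : AnalyticOnNhd ℝ Φi R) (hj : AnalyticOnNhd ℝ Φj R)
    (hk : AnalyticOnNhd ℝ Φk R) : AnalyticOnNhd ℝ (Mop ai aj ak Φi Φj Φk) (R ×ˢ (R ×ˢ R)) := by
  intro t ht
  have hN := fN_an hai haj hak t ht
  have hD := fD_an hai haj hak t ht
  have hG := fG_an hi hj hk t ht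
  exact clm_prod_an ((hD.smul hN.fderiv).sub (hN.smul hD.fderiv)) hG.fderiv

lemma fN_fderiv {ai aj ak : X3 → ℝ} (t v : X9) (hi : DifferentiableAt ℝ ai t.2.2) (hj : DifferentiableAt ℝ aj t.1)
    (hk : DifferentiableAt ℝ ak t.2.1) : fderiv ℝ (fN ai aj ak) t v =
      fderiv ℝ aj t.1 v.1 * ak t.2.1 * ai t.2.2 + aj t.1 * fderiv ℝ ak t.2.1 v.2.1 * ai t.2.2 +
      aj t.1 * ak t.2.1 * fderiv ℝ ai t.2.2 v.2.2 := by
  have e1 : HasFDerivAt (fun t : X9 => aj t.1) ((fderiv ℝ aj t.1).comp (ContinuousLinearMap.fst ℝ X3 (X3 × X3))) t :=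
    HasFDerivAt.comp (f := fun t : X9 => t.1) t hj.hasFDerivAt hasFDerivAt_fst
  have e2 : HasFDerivAt (fun t : X9 => ak t.2.1) ((fderiv ℝ ak t.2.1).comp ((ContinuousLinearMap.fst ℝ X3 X3).comp (ContinuousLinearMap.snd ℝ X3 (X3 × X3)))) t :=
    HasFDerivAt.comp (f := fun t : X9 => t.2.1) t hk.hasFDerivAt (hasFDerivAt_fst.comp t hasFDerivAt_snd)
  have e3 : HasFDerivAt (fun t : X9 => ai t.2.2) ((fderiv ℝ ai t.2.2).comp ((ContinuousLinearMap.snd ℝ X3 X3).comp (ContinuousLinearMap.snd ℝ X3 (X3 × X3)))) t :=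
    HasFDerivAt.comp (f := fun t : X9 => t.2.2) t hi.hasFDerivAt (hasFDerivAt_snd.comp t hasFDerivAt_snd)
  have := ((e1.mul e2).mul e3).fderiv
  have h2 : (fun t : X9 => aj t.1 * ak t.2.1 * ai t.2.2) = fN ai aj ak := rfl
  rw [← h2]
  erw [this]
  simp
  ring

lemma fG_fderiv {Φi Φj Φk : X3 → Vec2} (t v : X9) (hi1 : DifferentiableAt ℝ Φi t.1) (hi3 : DifferentiableAt ℝ Φi t.2.2)
    (hj1 : DifferentiableAt ℝ Φj t.1) (hj2 : DifferentiableAt ℝ Φj t.2.1)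
    (hk2 : DifferentiableAt ℝ Φk t.2.1) (hk3 : DifferentiableAt ℝ Φk t.2.2) : fderiv ℝ (fG Φi Φj Φk) t v =
      ((fderiv ℝ Φi t.1 v.1, fderiv ℝ Φi t.2.2 v.2.2), (fderiv ℝ Φj t.1 v.1 - fderiv ℝ Φj t.2.1 v.2.1,
        fderiv ℝ Φk t.2.1 v.2.1 - fderiv ℝ Φk t.2.2 v.2.2)) := by
  have e1 : ∀ Φ : X3 → Vec2, DifferentiableAt ℝ Φ t.1 → HasFDerivAt (fun t : X9 => Φ t.1) ((fderiv ℝ Φ t.1).comp (ContinuousLinearMap.fst ℝ X3 (X3 × X3))) t :=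
    fun Φ h => HasFDerivAt.comp (f := fun t : X9 => t.1) t h.hasFDerivAt hasFDerivAt_fst
  have e2 : ∀ Φ : X3 → Vec2, DifferentiableAt ℝ Φ t.2.1 → HasFDerivAt (fun t : X9 => Φ t.2.1) ((fderiv ℝ Φ t.2.1).comp ((ContinuousLinearMap.fst ℝ X3 X3).comp (ContinuousLinearMap.snd ℝ X3 (X3 × X3)))) t :=
    fun Φ h => HasFDerivAt.comp (f := fun t : X9 => t.2.1) t h.hasFDerivAt (hasFDerivAt_fst.comp t hasFDerivAt_snd)
  have e3 : ∀ Φ : X3 → Vec2, DifferentiableAt ℝ Φ t.2.2 → HasFDerivAt (fun t : X9 => Φ t.2.2) ((fderiv ℝ Φ t.2.2).comp ((ContinuousLinearMap.snd ℝ X3 X3).comp (ContinuousLinearMap.snd ℝ X3 (X3 × X3)))) t :=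
    fun Φ h => HasFDerivAt.comp (f := fun t : X9 => t.2.2) t h.hasFDerivAt (hasFDerivAt_snd.comp t hasFDerivAt_snd)
  have := (((e1 _ hi1).prodMk (e3 _ hi3)).prodMk (((e1 _ hj1).sub (e2 _ hj2)).prodMk ((e2 _ hk2).sub (e3 _ hk3)))).fderiv
  have h2 : (fun t : X9 => ((Φi t.1, Φi t.2.2), (Φj t.1 - Φj t.2.1, Φk t.2.1 - Φk t.2.2))) = fG Φi Φj Φk := rfl
  rw [← h2]
  erw [this]
  simp

lemma Mop_fst {ai aj ak : X3 → ℝ} {Φi Φj Φk : X3 → Vec2} (t v : X9)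
    (hi1 : DifferentiableAt ℝ ai t.1) (hi3 : DifferentiableAt ℝ ai t.2.2)
    (hj1 : DifferentiableAt ℝ aj t.1) (hj2 : DifferentiableAt ℝ aj t.2.1)
    (hk2 : DifferentiableAt ℝ ak t.2.1) (hk3 : DifferentiableAt ℝ ak t.2.2)
    (ni1 : ai t.1 ≠ 0) (ni3 : ai t.2.2 ≠ 0) (nj1 : aj t.1 ≠ 0) (nj2 : aj t.2.1 ≠ 0) (nk2 : ak t.2.1 ≠ 0)
    (nk3 : ak t.2.2 ≠ 0) :
    (Mop ai aj ak Φi Φj Φk t v).1 = fN ai aj ak t * fD ai aj ak t *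
      (((aj t.1)⁻¹ * fderiv ℝ aj t.1 v.1 - (ai t.1)⁻¹ * fderiv ℝ ai t.1 v.1) +
       ((ak t.2.1)⁻¹ * fderiv ℝ ak t.2.1 v.2.1 - (aj t.2.1)⁻¹ * fderiv ℝ aj t.2.1 v.2.1) +
       ((ai t.2.2)⁻¹ * fderiv ℝ ai t.2.2 v.2.2 - (ak t.2.2)⁻¹ * fderiv ℝ ak t.2.2 v.2.2)) := by
  have e1 := fN_fderiv t v hi3 hj1 hk2
  have e2 : fderiv ℝ (fD ai aj ak) t v = _ := fN_fderiv (ai := ak) (aj := ai) (ak := aj) t v hk3 hi1 hj2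
  have : (Mop ai aj ak Φi Φj Φk t v).1 = fD ai aj ak t * fderiv ℝ (fN ai aj ak) t v - fN ai aj ak t * fderiv ℝ (fD ai aj ak) t v := rfl
  rw [this, e1, e2]
  simp only [fN, fD]
  field_simp
  ring

lemma Mop_snd {ai aj ak : X3 → ℝ} {Φi Φj Φk : X3 → Vec2} (t v : X9) :
    (Mop ai aj ak Φi Φj Φk t v).2 = fderiv ℝ (fG Φi Φj Φk) t v := rfl

end SM7a

section SM7b
/-- logarithmic differential -/
def thF (a : X3 → ℝ) (q : X3) : X3 →L[ℝ] ℝ := (a q)⁻¹ • fderiv ℝ a q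

lemma thF_an {a : X3 → ℝ} {q : X3} (ha : AnalyticAt ℝ a q) (h0 : a q ≠ 0) : AnalyticAt ℝ (thF a) q :=
  (ha.inv h0).smul ha.fderiv

lemma thF_symm {a : X3 → ℝ} {q : X3} (ha : AnalyticAt ℝ a q) (h0 : a q ≠ 0) (x y : X3) :
    fderiv ℝ (thF a) q x y = fderiv ℝ (thF a) q y x := by
  have hs : IsSymmSndFDerivAt ℝ a q := ha.contDiffAt.isSymmSndFDerivAt (n := ⊤) le_top
  have e1 : HasFDerivAt (fun y => (a y)⁻¹) _ q := (ha.inv h0).differentiableAt.hasFDerivAt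
  have e1' := ((hasDerivAt_inv h0).comp_hasFDerivAt q ha.differentiableAt.hasFDerivAt)
  have e2 := ha.fderiv.differentiableAt.hasFDerivAt
  have e3 := (e1'.smul e2).fderiv
  have : thF a = fun y => (Inv.inv ∘ a) y • fderiv ℝ a y := rfl
  rw [this]
  erw [e3]
  have := hs x y
  simp [this]
  ring

lemma diag_zero {ai aj ak : X3 → ℝ} {Φi Φj Φk : X3 → Vec2} {Ti : X3 → X3} (p : X3)
    (hai : DifferentiableAt ℝ ai p) (haj : DifferentiableAt ℝ aj p) (hak : DifferentiableAt ℝ ak p)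
    (ni : ai p ≠ 0) (nj : aj p ≠ 0) (nk : ak p ≠ 0)
    (hi : DifferentiableAt ℝ Φi p) (hj : DifferentiableAt ℝ Φj p) (hk : DifferentiableAt ℝ Φk p)
    (hTi : fderiv ℝ Φi p (Ti p) = 0) : Mop ai aj ak Φi Φj Φk (p, p, p) (Ti p, Ti p, Ti p) = 0 := by
  have h1 := Mop_fst (Φi := Φi) (Φj := Φj) (Φk := Φk) (p, p, p) (Ti p, Ti p, Ti p) hai hai haj haj hak hak ni ni nj nj nk nk
  have h2 := fG_fderiv (Φi := Φi) (Φj := Φj) (Φk := Φk) (p, p, p) (Ti p, Ti p, Ti p) hi hi hj hj hk hk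
  refine Prod.ext ?_ ?_
  · rw [h1]; simp only [Prod.fst_zero]; ring
  · rw [Mop_snd, h2]; simp [hTi]

set_option maxHeartbeats 1000000 in
lemma key_kappa {ai aj ak : X3 → ℝ} {Φi Φj Φk : X3 → Vec2} {Ti Tj Tk : X3 → X3} {R : Set X3} (hR : IsOpen R)
    (hai : AnalyticOnNhd ℝ ai R) (haj : AnalyticOnNhd ℝ aj R) (hak : AnalyticOnNhd ℝ ak R)
    (ni : ∀ q ∈ R, ai q ≠ 0) (nj : ∀ q ∈ R, aj q ≠ 0) (nk : ∀ q ∈ R, ak q ≠ 0)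
    (hi : AnalyticOnNhd ℝ Φi R) (hj : AnalyticOnNhd ℝ Φj R) (hk : AnalyticOnNhd ℝ Φk R)
    (tai : AnalyticOnNhd ℝ Ti R) (taj : AnalyticOnNhd ℝ Tj R)
    (hTi : ∀ q ∈ R, fderiv ℝ Φi q (Ti q) = 0) (hTj : ∀ q ∈ R, fderiv ℝ Φj q (Tj q) = 0)
    (hTk : ∀ q ∈ R, fderiv ℝ Φk q (Tk q) = 0) (p : X3) (hp : p ∈ R)
    (ki : ∀ v, fderiv ℝ Φi p v = 0 → ∃ c : ℝ, v = c • Ti p)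
    (kj : ∀ v, fderiv ℝ Φj p v = 0 → ∃ c : ℝ, v = c • Tj p)
    (kk : ∀ v, fderiv ℝ Φk p v = 0 → ∃ c : ℝ, v = c • Tk p)
    (hli : LinearIndependent ℝ ![Ti p, Tj p, Tk p])
    (ω : X3 → (X3 →L[ℝ] ℝ)) (hω : AnalyticAt ℝ ω p)
    (wi : ∀ q ∈ R, ω q (Ti q) = - thF ai q (Ti q)) (wj : ∀ q ∈ R, ω q (Tj q) = - thF aj q (Tj q))
    (wk : ∀ q ∈ R, ω q (Tk q) = - thF ak q (Tk q))
    (dt : (X9 →L[ℝ] ℝ × Y8) → ℝ) (adj : (X9 →L[ℝ] ℝ × Y8) → (ℝ × Y8 →L[ℝ] X9))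
    (dta : ∀ L, AnalyticAt ℝ dt L) (adja : ∀ L, AnalyticAt ℝ adj L) (h1 : ∀ L v, adj L (L v) = dt L • v)
    (h2 : ∀ (L : X9 →L[ℝ] ℝ × Y8) (w : X9), w ≠ 0 → (∀ v, (L v).2 = 0 → ∃ t : ℝ, v = t • w) →
        adj L (1, 0) ≠ 0)
    (hK : fderiv ℝ (fun t => dt (Mop ai aj ak Φi Φj Φk t)) (p, p, p) (Tj p, 0, 0) = 0) :
    fderiv ℝ ω p (Tj p) (Ti p) = fderiv ℝ ω p (Ti p) (Tj p) := by
  -- linear independence in coordinates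
  have hli' : ∀ x y z : ℝ, x • Ti p + y • Tj p + z • Tk p = 0 → x = 0 ∧ y = 0 ∧ z = 0 := by
    intro x y z h
    have := Fintype.linearIndependent_iff.1 hli ![x, y, z] (by simpa [Fin.sum_univ_three] using h)
    exact ⟨this 0, this 1, this 2⟩
  have hspan : ∀ v : X3, ∃ x y z : ℝ, v = x • Ti p + y • Tj p + z • Tk p := by
    intro v
    have hb := (basisOfLinearIndependentOfCardEqFinrank hli (by simp)).sum_repr v
    rw [Fin.sum_univ_three] at hb
    simp only [coe_basisOfLinearIndependentOfCardEqFinrank] at hb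
    exact ⟨_, _, _, hb.symm⟩
  have hTi0 : Ti p ≠ 0 := hli.ne_zero 0
  set M := Mop ai aj ak Φi Φj Φk with hM
  have dΦi := fun q hq => (hi q hq).differentiableAt
  have dΦj := fun q hq => (hj q hq).differentiableAt
  have dΦk := fun q hq => (hk q hq).differentiableAt
  have dai := fun q hq => (hai q hq).differentiableAt
  have daj := fun q hq => (haj q hq).differentiableAt
  have dak := fun q hq => (hak q hq).differentiableAt
  have hM0 : M (p, p, p) (Ti p, Ti p, Ti p) = 0 :=
    diag_zero p (dai p hp) (daj p hp) (dak p hp) (ni p hp) (nj p hp) (nk p hp) (dΦi p hp) (dΦj p hp) (dΦk p hp) (hTi p hp)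
  have hw0 : ((Ti p, Ti p, Ti p) : X9) ≠ 0 := fun h => hTi0 (congrArg Prod.fst h)
  have hadj0 : adj (M (p, p, p)) (1, 0) ≠ 0 := by
    refine h2 _ (Ti p, Ti p, Ti p) hw0 ?_
    rintro ⟨v1, v2, v3⟩ hv
    rw [hM, Mop_snd, fG_fderiv _ _ (dΦi p hp) (dΦi p hp) (dΦj p hp) (dΦj p hp) (dΦk p hp) (dΦk p hp)] at hv
    simp only [Prod.mk_eq_zero, ← map_sub] at hv
    obtain ⟨⟨e1, e2⟩, e3, e4⟩ := hv
    obtain ⟨c1, f1⟩ := ki _ e1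
    obtain ⟨c2, f2⟩ := ki _ e2
    obtain ⟨c3, f3⟩ := kj _ e3
    obtain ⟨c4, f4⟩ := kk _ e4
    have : (c1 - c2) • Ti p + (-c3) • Tj p + (-c4) • Tk p = 0 := by
      rw [sub_smul, ← f1, ← f2, neg_smul, neg_smul, ← f3, ← f4]; abel
    obtain ⟨g1, g2, g3⟩ := hli' _ _ _ this
    have c3' : c3 = 0 := by linarith
    have c12 : c1 = c2 := by linarith
    rw [c3', zero_smul, sub_eq_zero] at f3
    refine ⟨c1, ?_⟩
    simp only [Prod.smul_mk, Prod.mk.injEq]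
    exact ⟨f1, by rw [← f3]; exact f1, by rw [c12]; exact f2⟩
  have hdt0 : dt (M (p, p, p)) = 0 := by
    have := h1 (M (p, p, p)) (Ti p, Ti p, Ti p)
    rw [hM0, map_zero] at this
    exact (smul_eq_zero.1 this.symm).resolve_right hw0
  -- the bracket
  obtain ⟨Ai, Aj, Ak, hbr⟩ := hspan (fderiv ℝ Ti p (Tj p) - fderiv ℝ Tj p (Ti p))
  set e := Ai • Ti p + Ak • Tk p with he
  set γ : ℝ → X3 := fun u => p + u • Tj p with hγ
  have γ0 : γ 0 = p := by simp [hγ]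
  have hγd : HasDerivAt γ (Tj p) 0 := by
    have := ((hasDerivAt_id (0:ℝ)).smul_const (Tj p)).const_add p
    simpa [hγ] using this
  have hγR : ∀ᶠ u in 𝓝 (0:ℝ), γ u ∈ R := hγd.continuousAt.eventually (by rw [γ0]; exact hR.mem_nhds hp)
  have cmp : ∀ {Z : Type} [NormedAddCommGroup Z] [NormedSpace ℝ Z] (F : X3 → Z), DifferentiableAt ℝ F p →
      HasDerivAt (fun u => F (γ u)) (fderiv ℝ F p (Tj p)) 0 := by
    intro Z _ _ F hF
    exact HasFDerivAt.comp_hasDerivAt_of_eq 0 hF.hasFDerivAt hγd γ0.symm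
  set w : ℝ → X9 := fun u => (Ti (γ u), Ti p + u • e, Ti p + u • (Ai • Ti p)) with hw
  have lin : ∀ x y : X3, HasDerivAt (fun u : ℝ => x + u • y) y 0 := fun x y => by
    simpa using ((hasDerivAt_id (0:ℝ)).smul_const y).const_add x
  have hwd : HasDerivAt w (fderiv ℝ Ti p (Tj p), e, Ai • Ti p) 0 :=
    (cmp Ti (tai p hp).differentiableAt).prodMk ((lin _ _).prodMk (lin _ _))
  have w0 : w 0 = (Ti p, Ti p, Ti p) := by simp [hw, γ0]
  set q : ℝ → X9 := fun u => (γ u, p, p) with hq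
  have hqd : HasDerivAt q (Tj p, 0, 0) 0 := hγd.prodMk ((hasDerivAt_const _ _).prodMk (hasDerivAt_const _ _))
  have q0 : q 0 = (p, p, p) := by simp [hq, γ0]
  set ωj : X3 → (X3 →L[ℝ] ℝ) := fun x => ω x + thF aj x with hωj
  have hthj := thF_an (haj p hp) (nj p hp)
  have dωj : DifferentiableAt ℝ ωj p := hω.differentiableAt.add hthj.differentiableAt
  have dTi := (tai p hp).differentiableAt
  have dTj := (taj p hp).differentiableAt
  set κ := fderiv ℝ ωj p (Tj p) (Ti p) - fderiv ℝ ωj p (Ti p) (Tj p) with hκ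
  -- ωj(Tj) = 0
  have hz1 : fderiv ℝ ωj p (Ti p) (Tj p) + ωj p (fderiv ℝ Tj p (Ti p)) = 0 := by
    have e1 : HasFDerivAt (fun x => ωj x (Tj x)) _ p := dωj.hasFDerivAt.clm_apply dTj.hasFDerivAt
    have e2 : (fun x => ωj x (Tj x)) =ᶠ[𝓝 p] fun _ => 0 := by
      filter_upwards [hR.mem_nhds hp] with x hx
      simp [hωj, wj x hx]
    have e3 := e1.unique ((hasFDerivAt_const (0:ℝ) p).congr_of_eventuallyEq e2)
    have := congrArg (fun L => L (Ti p)) e3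
    simp at this
    linarith
  -- the sum S
  set S : ℝ → ℝ := fun u => ωj (γ u) (Ti (γ u)) + (thF ak p - thF aj p) (Ti p + u • e) +
    (thF ai p - thF ak p) (Ti p + u • (Ai • Ti p)) with hS
  have hSd : HasDerivAt S κ 0 := by
    have e1 := (cmp ωj dωj).clm_apply (cmp Ti dTi)
    rw [γ0] at e1
    have e2 := (thF ak p - thF aj p).hasFDerivAt.comp_hasDerivAt (0:ℝ) (lin (Ti p) e)
    have e3 := (thF ai p - thF ak p).hasFDerivAt.comp_hasDerivAt (0:ℝ) (lin (Ti p) (Ai • Ti p))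
    refine ((e1.add e2).add e3).congr_deriv ?_
    have i1 := wi p hp
    have i2 := wk p hp
    have i3 := wj p hp
    have i4 := congrArg (ωj p) hbr
    simp only [hωj, map_sub, map_add, map_smul, ContinuousLinearMap.add_apply, smul_eq_mul] at i4
    simp only [hωj, ContinuousLinearMap.add_apply] at hz1
    rw [hκ]
    simp only [he, hωj, map_add, map_smul, ContinuousLinearMap.add_apply, ContinuousLinearMap.sub_apply, smul_eq_mul]
    rw [i1, i2, i3] at i4
    linear_combination i4 + hz1
  have hS0 : S 0 = 0 := by
    have i1 := wi p hp
    simp only [hS, γ0, hωj, zero_smul, add_zero, ContinuousLinearMap.add_apply, ContinuousLinearMap.sub_apply, i1]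
    ring
  set ND : ℝ → ℝ := fun u => fN ai aj ak (q u) * fD ai aj ak (q u) with hND
  have hND0 : ND 0 ≠ 0 := by
    simp only [hND, q0, fN, fD]
    have := ni p hp; have := nj p hp; have := nk p hp
    positivity
  have hNDd : DifferentiableAt ℝ ND 0 := by
    have t0 : ((p, p, p) : X9) ∈ R ×ˢ (R ×ˢ R) := ⟨hp, hp, hp⟩
    have e1 := ((fN_an hai haj hak _ t0).differentiableAt.mul (fD_an hai haj hak _ t0).differentiableAt)
    exact (HasFDerivAt.comp_hasDerivAt_of_eq 0 e1.hasFDerivAt hqd q0.symm).differentiableAt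
  -- g
  set h : ℝ → Vec2 := fun u => fderiv ℝ Φj (γ u) (Ti (γ u)) - fderiv ℝ Φj p (Ti p + u • e) with hh
  have hhd : HasDerivAt h 0 0 := by
    have dd : DifferentiableAt ℝ (fderiv ℝ Φj) p := (hj p hp).fderiv.differentiableAt
    have e1 := (cmp (fderiv ℝ Φj) dd).clm_apply (cmp Ti dTi)
    rw [γ0] at e1
    have e2 := (fderiv ℝ Φj p).hasFDerivAt.comp_hasDerivAt (0:ℝ) (lin (Ti p) e)
    refine (e1.sub e2).congr_deriv ?_
    have f1 : HasFDerivAt (fun x => fderiv ℝ Φj x (Tj x)) _ p := dd.hasFDerivAt.clm_apply dTj.hasFDerivAt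
    have f2 : (fun x => fderiv ℝ Φj x (Tj x)) =ᶠ[𝓝 p] fun _ => 0 := by
      filter_upwards [hR.mem_nhds hp] with x hx using hTj x hx
    have f3 := f1.unique ((hasFDerivAt_const (0:Vec2) p).congr_of_eventuallyEq f2)
    have f4 := congrArg (fun L => L (Ti p)) f3
    have hs : IsSymmSndFDerivAt ℝ Φj p := (hj p hp).contDiffAt.isSymmSndFDerivAt (n := ⊤) le_top
    have f5 := hs (Ti p) (Tj p)
    have f6 := congrArg (fderiv ℝ Φj p) hbr
    simp only [map_sub, map_add, map_smul, hTj p hp, smul_zero, add_zero] at f6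
    simp at f4
    rw [f5] at f4
    simp only [he, map_add, map_smul]
    rw [← f6, eq_neg_of_add_eq_zero_right f4]
    abel
  have hg : (fun u => M (q u) (w u)) =ᶠ[𝓝 0] fun u => (ND u * S u, ((0, 0), (h u, 0))) := by
    filter_upwards [hγR] with u hu
    refine Prod.ext ?_ ?_
    · have := Mop_fst (Φi := Φi) (Φj := Φj) (Φk := Φk) (q u) (w u) (dai _ hu) (dai p hp) (daj _ hu) (daj p hp)
        (dak p hp) (dak p hp) (ni _ hu) (ni p hp) (nj _ hu) (nj p hp) (nk p hp) (nk p hp)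
      rw [hM, this]
      have i1 := wi _ hu
      simp only [hND, hS, hωj, hq, hw, thF, ContinuousLinearMap.add_apply, ContinuousLinearMap.sub_apply,
        ContinuousLinearMap.smul_apply, smul_eq_mul] at i1 ⊢
      rw [i1]
      ring
    · rw [hM, Mop_snd, fG_fderiv _ _ (dΦi _ hu) (dΦi p hp) (dΦj _ hu) (dΦj p hp) (dΦk p hp) (dΦk p hp)]
      simp only [hq, hw, hTi _ hu, map_add, map_smul, hTi p hp, smul_zero, add_zero, he, hTk p hp, sub_self, hh]
  have hgd : HasDerivAt (fun u => M (q u) (w u)) (ND 0 * κ, ((0, 0), (0, 0))) 0 := by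
    have e1 := hNDd.hasDerivAt.mul hSd
    rw [hS0, mul_zero, zero_add] at e1
    refine HasDerivAt.congr_of_eventuallyEq ?_ hg
    exact e1.prodMk (((hasDerivAt_const _ _).prodMk (hasDerivAt_const _ _)).prodMk (hhd.prodMk (hasDerivAt_const _ _)))
  have hMan : AnalyticAt ℝ M (p, p, p) := Mop_an hai haj hak hi hj hk _ ⟨hp, hp, hp⟩
  have hMq : DifferentiableAt ℝ (fun u => adj (M (q u))) 0 := by
    have e1 : DifferentiableAt ℝ (fun t => adj (M t)) (p, p, p) :=
      ((adja (M (p, p, p))).fun_comp hMan).differentiableAt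
    exact (HasFDerivAt.comp_hasDerivAt_of_eq 0 e1.hasFDerivAt hqd q0.symm).differentiableAt
  have hdq : HasDerivAt (fun u => dt (M (q u))) 0 0 := by
    have e1 : DifferentiableAt ℝ (fun t => dt (M t)) (p, p, p) :=
      ((dta (M (p, p, p))).fun_comp hMan).differentiableAt
    have e2 := HasFDerivAt.comp_hasDerivAt_of_eq 0 e1.hasFDerivAt hqd q0.symm
    rw [hK] at e2
    exact e2
  have L1 := hMq.hasDerivAt.clm_apply hgd
  have L2 := hdq.smul hwd
  have heq : (fun u => adj (M (q u)) (M (q u) (w u))) = fun u => dt (M (q u)) • w u := by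
    funext u; exact h1 _ _
  rw [heq] at L1
  have L3 := L1.unique L2
  simp only [q0, w0, hM0, map_zero, zero_add, hdt0, zero_smul, add_zero] at L3
  have L4 : adj (M (p, p, p)) (ND 0 * κ, ((0, 0), (0, 0))) = (ND 0 * κ) • adj (M (p, p, p)) (1, 0) := by
    rw [← map_smul]; congr 1; simp
  have hκ0 : κ = 0 := by
    have : (ND 0 * κ) • adj (M (p, p, p)) (1, 0) = 0 := by rw [← L4]; exact L3
    exact (mul_eq_zero.1 ((smul_eq_zero.1 this).resolve_right hadj0)).resolve_left hND0
  have hf : fderiv ℝ ωj p = fderiv ℝ ω p + fderiv ℝ (thF aj) p :=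
    fderiv_add hω.differentiableAt hthj.differentiableAt
  rw [hκ, hf] at hκ0
  simp only [ContinuousLinearMap.add_apply] at hκ0
  have := thF_symm (haj p hp) (nj p hp) (Tj p) (Ti p)
  linarith

end SM7b

section SM7c
/-- first partial derivative -/
def d1 (φ : Vec2 → ℝ) (x : Vec2) : ℝ := fderiv ℝ φ x ((1, 0) : Vec2)

/-- kernel field -/
def Tf (φ : Vec2 → ℝ) (p : X3) : X3 :=
  ((Dder φ p.1 * Dder φ p.1, -(Dder φ p.1 * d1 φ p.1)),
    -(p.2 * (Dder φ p.1 * d1 (Dder φ) p.1 - d1 φ p.1 * Dder (Dder φ) p.1)))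

/-- the weight -/
def uf (φ : Vec2 → ℝ) (p : X3) : ℝ := Dder φ p.1 * Dder φ p.1

/-- jacobian -/
def br (φ ψ : Vec2 → ℝ) (p : X3) : ℝ := d1 φ p.1 * Dder ψ p.1 - Dder φ p.1 * d1 ψ p.1

def Xf (φ : Vec2 → ℝ) (p : X3) : X3 := ((0, Dder φ p.1), -(p.2 * Dder (Dder φ) p.1))
def Yf (φ : Vec2 → ℝ) (p : X3) : X3 := ((0, 0), Dder φ p.1)

lemma fder_split (φ : Vec2 → ℝ) (x v : Vec2) : fderiv ℝ φ x v = d1 φ x * v.1 + Dder φ x * v.2 := by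
  have : v = v.1 • ((1, 0) : Vec2) + v.2 • ((0, 1) : Vec2) := by ext <;> simp
  conv_lhs => rw [this]
  rw [map_add, map_smul, map_smul, d1, Dder, smul_eq_mul, smul_eq_mul]; ring

section an
variable {φ : Vec2 → ℝ} {Bt : Set Vec2} (h : AnalyticOnNhd ℝ φ Bt)

lemma ev_an (w : Vec2) {x : Vec2} (hx : AnalyticAt ℝ φ x) : AnalyticAt ℝ (fun y => fderiv ℝ φ y w) x :=
  AnalyticAt.fun_comp (g := fun L : Vec2 →L[ℝ] ℝ => L w) (f := fderiv ℝ φ)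
    ((ContinuousLinearMap.apply ℝ ℝ w).analyticAt _) hx.fderiv

lemma d1_an {x : Vec2} (hx : AnalyticAt ℝ φ x) : AnalyticAt ℝ (d1 φ) x := ev_an _ hx
lemma d2_an {x : Vec2} (hx : AnalyticAt ℝ φ x) : AnalyticAt ℝ (Dder φ) x := ev_an _ hx

lemma fst_an {f : Vec2 → ℝ} {p : X3} (hx : AnalyticAt ℝ f p.1) : AnalyticAt ℝ (fun q : X3 => f q.1) p :=
  AnalyticAt.fun_comp (f := fun t : X3 => t.1) hx analyticAt_fst

lemma Φ_an {p : X3} (hx : AnalyticAt ℝ φ p.1) : AnalyticAt ℝ (Φmap φ) p :=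
  (fst_an hx).prod (analyticAt_snd.mul (fst_an (d2_an hx)))

lemma uf_an {p : X3} (hx : AnalyticAt ℝ φ p.1) : AnalyticAt ℝ (uf φ) p :=
  (fst_an (d2_an hx)).mul (fst_an (d2_an hx))

lemma br_an {ψ : Vec2 → ℝ} {p : X3} (hx : AnalyticAt ℝ φ p.1) (hy : AnalyticAt ℝ ψ p.1) : AnalyticAt ℝ (br φ ψ) p :=
  ((fst_an (d1_an hx)).mul (fst_an (d2_an hy))).sub ((fst_an (d2_an hx)).mul (fst_an (d1_an hy)))

lemma Tf_an {p : X3} (hx : AnalyticAt ℝ φ p.1) : AnalyticAt ℝ (Tf φ) p :=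
  ((uf_an hx).prod ((fst_an (d2_an hx)).mul (fst_an (d1_an hx))).neg).prod
    (analyticAt_snd.mul (((fst_an (d2_an hx)).mul (fst_an (d1_an (d2_an hx)))).sub
      ((fst_an (d1_an hx)).mul (fst_an (d2_an (d2_an hx)))))).neg

lemma Xf_an {p : X3} (hx : AnalyticAt ℝ φ p.1) : AnalyticAt ℝ (Xf φ) p :=
  (analyticAt_const.prod (fst_an (d2_an hx))).prod (analyticAt_snd.mul (fst_an (d2_an (d2_an hx)))).neg

lemma Yf_an {p : X3} (hx : AnalyticAt ℝ φ p.1) : AnalyticAt ℝ (Yf φ) p :=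
  (analyticAt_const (v := ((0, 0) : Vec2))).prod (fst_an (d2_an hx))

lemma Φ_fderiv {p : X3} (hx : AnalyticAt ℝ φ p.1) (v : X3) : fderiv ℝ (Φmap φ) p v =
    (d1 φ p.1 * v.1.1 + Dder φ p.1 * v.1.2,
      v.2 * Dder φ p.1 + p.2 * (d1 (Dder φ) p.1 * v.1.1 + Dder (Dder φ) p.1 * v.1.2)) := by
  have hf : HasFDerivAt (fun q : X3 => q.1) (ContinuousLinearMap.fst ℝ Vec2 ℝ) p := hasFDerivAt_fst
  have hs : HasFDerivAt (fun q : X3 => q.2) (ContinuousLinearMap.snd ℝ Vec2 ℝ) p := hasFDerivAt_snd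
  have e1 : HasFDerivAt (fun q : X3 => φ q.1) _ p := HasFDerivAt.comp p hx.differentiableAt.hasFDerivAt hf
  have e2 : HasFDerivAt (fun q : X3 => Dder φ q.1) _ p :=
    HasFDerivAt.comp p (d2_an hx).differentiableAt.hasFDerivAt hf
  have e3 := e1.prodMk (hs.mul e2)
  have e4 : fderiv ℝ (Φmap φ) p = _ := e3.fderiv
  rw [e4]
  refine Prod.ext ?_ ?_
  · simp [fder_split φ]
  · simp [fder_split (Dder φ)]; ring

lemma Tf_ker {p : X3} (hx : AnalyticAt ℝ φ p.1) : fderiv ℝ (Φmap φ) p (Tf φ p) = 0 := by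
  rw [Φ_fderiv hx]
  refine Prod.ext ?_ ?_ <;> simp [Tf] <;> ring

lemma Tf_id {p : X3} (hx : AnalyticAt ℝ φ p.1) (v : X3) : uf φ p • v - v.1.1 • Tf φ p =
    (fderiv ℝ (Φmap φ) p v).1 • Xf φ p + (fderiv ℝ (Φmap φ) p v).2 • Yf φ p := by
  rw [Φ_fderiv hx]
  refine Prod.ext (Prod.ext ?_ ?_) ?_ <;> simp [Tf, uf, Xf, Yf] <;> ring

lemma Tf_bd {p : X3} (hx : AnalyticAt ℝ φ p.1) (v : X3) : ‖uf φ p • v - v.1.1 • Tf φ p‖ ≤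
    (‖Xf φ p‖ + ‖Yf φ p‖) * ‖fderiv ℝ (Φmap φ) p v‖ := by
  rw [Tf_id hx]
  refine (norm_add_le _ _).trans ?_
  rw [norm_smul, norm_smul, add_mul]
  have h1 := norm_fst_le (fderiv ℝ (Φmap φ) p v)
  have h2 := norm_snd_le (fderiv ℝ (Φmap φ) p v)
  rw [mul_comm, mul_comm ‖Yf φ p‖]
  gcongr

lemma Tf_span {p : X3} (hx : AnalyticAt ℝ φ p.1) (h0 : Dder φ p.1 ≠ 0) (v : X3)
    (hv : fderiv ℝ (Φmap φ) p v = 0) : ∃ c : ℝ, v = c • Tf φ p := by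
  have := Tf_id hx v
  rw [hv] at this
  simp only [Prod.fst_zero, Prod.snd_zero, zero_smul, add_zero, sub_eq_zero] at this
  have hu : uf φ p ≠ 0 := mul_ne_zero h0 h0
  refine ⟨(uf φ p)⁻¹ * v.1.1, ?_⟩
  rw [mul_smul, ← this, smul_smul, inv_mul_cancel₀ hu, one_smul]

lemma Tf_ne {p : X3} (h0 : Dder φ p.1 ≠ 0) : Tf φ p ≠ 0 := fun h =>
  mul_ne_zero h0 h0 (congrArg (fun v : X3 => v.1.1) h)
end an

end SM7c

section SM7d
lemma tay_ev {X Y : Type*} [NormedAddCommGroup X] [NormedSpace ℝ X] [NormedAddCommGroup Y] [NormedSpace ℝ Y]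
    [CompleteSpace Y] (f : X → Y) (O K : Set X) (hf : AnalyticOnNhd ℝ f O) (hKO : K ⊆ O)
    (hK : IsCompact K) (hKc : Convex ℝ K) : ∀ᶠ Γ in (atTop : Filter ℝ), TayOn f K Γ := by
  obtain ⟨G, hG⟩ := tayOn_exists f O K hf hKO hK hKc
  filter_upwards [eventually_ge_atTop G] with Γ h
  exact hG.mono h

lemma bd_ev {X Y : Type*} [NormedAddCommGroup X] [NormedSpace ℝ X] [NormedAddCommGroup Y] [NormedSpace ℝ Y]
    (f : X → Y) (O K : Set X) (hf : AnalyticOnNhd ℝ f O) (hKO : K ⊆ O)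
    (hK : IsCompact K) : ∀ᶠ Γ in (atTop : Filter ℝ), ∀ x ∈ K, ‖f x‖ ≤ Γ := by
  obtain ⟨G, _, hG⟩ := an_bound f O K hf hKO hK
  filter_upwards [eventually_ge_atTop G] with Γ h
  exact fun x hx => (hG x hx).trans h

set_option maxHeartbeats 1000000 in
lemma est_one (c₀ : Vec2) (r₀ : ℝ) (hr₀ : 0 < r₀) (B Bt : Set Vec2) (hB : B = Metric.ball c₀ r₀)
    (hBt_open : IsOpen Bt) (hBt_conn : IsConnected Bt) (hBBt : closure B ⊆ Bt)
    (φi φj φk : Vec2 → ℝ) (ani : AnalyticOnNhd ℝ φi Bt) (anj : AnalyticOnNhd ℝ φj Bt) (ank : AnalyticOnNhd ℝ φk Bt)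
    (ni : ∀ p : X3, p.1 ∈ B → br φj φk p ≠ 0) (nj : ∀ p : X3, p.1 ∈ B → br φk φi p ≠ 0)
    (nk : ∀ p : X3, p.1 ∈ B → br φi φj p ≠ 0) (di : ∀ x ∈ B, Dder φi x ≠ 0)
    (dj : ∀ x ∈ B, Dder φj x ≠ 0) (dk : ∀ x ∈ B, Dder φk x ≠ 0)
    (dt : (X9 →L[ℝ] ℝ × Y8) → ℝ) (adj : (X9 →L[ℝ] ℝ × Y8) → (ℝ × Y8 →L[ℝ] X9))
    (dta : ∀ L, AnalyticAt ℝ dt L) (adja : ∀ L, AnalyticAt ℝ adj L) (h1 : ∀ L v, adj L (L v) = dt L • v)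
    (ps : X3) (hps : ps.1 ∈ B)
    (hK : fderiv ℝ (fun t => dt (Mop (br φj φk) (br φk φi) (br φi φj) (Φmap φi) (Φmap φj) (Φmap φk) t))
      (ps, ps, ps) (Tf φj ps, 0, 0) ≠ 0) (a b : ℝ) (hab : a ≤ b) :
    ∃ κ : ℝ, 0 < κ ∧ ∃ C : ℝ, ∀ ε : ℝ, 0 < ε → ε ≤ 1 → ∀ (fi fj fk : Vec2 → ℝ) (E : Set X3), Measurable fi →
      MeasurableSet E → E ⊆ B ×ˢ Icc a b →
      (∀ p ∈ E, ‖fi (Φmap φi p) • fderiv ℝ φi p.1 + fj (Φmap φj p) • fderiv ℝ φj p.1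
        + fk (Φmap φk p) • fderiv ℝ φk p.1‖ ≤ ε) →
      (∀ p ∈ E, 1 ≤ |fi (Φmap φi p)| ∨ 1 ≤ |fj (Φmap φj p)| ∨ 1 ≤ |fk (Φmap φk p)|) →
      volume E ≤ ENNReal.ofReal (C * ε ^ κ) := by
  set O : Set X3 := Bt ×ˢ (univ : Set ℝ) with hO
  set K : Set X3 := closure B ×ˢ Icc a b with hKdef
  set M := Mop (br φj φk) (br φk φi) (br φi φj) (Φmap φi) (Φmap φj) (Φmap φk) with hM
  set Dt : X9 → ℝ := fun t => dt (M t) with hDt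
  have hcl : closure B = closedBall c₀ r₀ := by rw [hB, closure_ball _ hr₀.ne']
  have hBsub : B ⊆ closure B := subset_closure
  have hKc : IsCompact K := by
    rw [hKdef, hcl]; exact (isCompact_closedBall _ _).prod isCompact_Icc
  have hKcv : Convex ℝ K := by
    rw [hKdef, hcl]; exact (convex_closedBall _ _).prod (convex_Icc _ _)
  have hKO : K ⊆ O := prod_mono hBBt (subset_univ _)
  have hK9c : IsCompact (K ×ˢ (K ×ˢ K)) := hKc.prod (hKc.prod hKc)
  have hK9v : Convex ℝ (K ×ˢ (K ×ˢ K)) := hKcv.prod (hKcv.prod hKcv)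
  have hK9O : (K ×ˢ (K ×ˢ K)) ⊆ (O ×ˢ (O ×ˢ O)) := prod_mono hKO (prod_mono hKO hKO)
  have hOp : IsPreconnected O := hBt_conn.isPreconnected.prod isPreconnected_univ
  have mB : ∀ p : X3, p.1 ∈ B → p.1 ∈ Bt := fun p hp => hBBt (hBsub hp)
  -- analyticity
  have aai : AnalyticOnNhd ℝ (br φj φk) O := fun p hp => br_an (anj _ hp.1) (ank _ hp.1)
  have aaj : AnalyticOnNhd ℝ (br φk φi) O := fun p hp => br_an (ank _ hp.1) (ani _ hp.1)
  have aak : AnalyticOnNhd ℝ (br φi φj) O := fun p hp => br_an (ani _ hp.1) (anj _ hp.1)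
  have aΦi : AnalyticOnNhd ℝ (Φmap φi) O := fun p hp => Φ_an (ani _ hp.1)
  have aΦj : AnalyticOnNhd ℝ (Φmap φj) O := fun p hp => Φ_an (anj _ hp.1)
  have aΦk : AnalyticOnNhd ℝ (Φmap φk) O := fun p hp => Φ_an (ank _ hp.1)
  have auj : AnalyticOnNhd ℝ (uf φj) O := fun p hp => uf_an (anj _ hp.1)
  have auk : AnalyticOnNhd ℝ (uf φk) O := fun p hp => uf_an (ank _ hp.1)
  have aTj : AnalyticOnNhd ℝ (Tf φj) O := fun p hp => Tf_an (anj _ hp.1)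
  have aTk : AnalyticOnNhd ℝ (Tf φk) O := fun p hp => Tf_an (ank _ hp.1)
  have aXj : AnalyticOnNhd ℝ (Xf φj) O := fun p hp => Xf_an (anj _ hp.1)
  have aXk : AnalyticOnNhd ℝ (Xf φk) O := fun p hp => Xf_an (ank _ hp.1)
  have aYj : AnalyticOnNhd ℝ (Yf φj) O := fun p hp => Yf_an (anj _ hp.1)
  have aYk : AnalyticOnNhd ℝ (Yf φk) O := fun p hp => Yf_an (ank _ hp.1)
  have aM : AnalyticOnNhd ℝ M (O ×ˢ (O ×ˢ O)) := Mop_an aai aaj aak aΦi aΦj aΦk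
  have aDt : AnalyticOnNhd ℝ Dt (O ×ˢ (O ×ˢ O)) := fun t ht => (dta _).fun_comp (aM t ht)
  have aAd : AnalyticOnNhd ℝ (fun t => adj (M t)) (O ×ˢ (O ×ˢ O)) := fun t ht => (adja _).fun_comp (aM t ht)
  have adg : ∀ p : X3, AnalyticAt ℝ (fun q : X3 => ((q, q, q) : X9)) p := fun p =>
    analyticAt_id.prod (analyticAt_id.prod analyticAt_id)
  set P : X3 → ℝ := fun p => fderiv ℝ Dt (p, p, p) (Tf φj p, 0, 0) *
    (br φj φk p * br φk φi p * br φi φj p * uf φj p * uf φk p) with hP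
  have aP : AnalyticOnNhd ℝ P O := by
    intro p hp
    have e1 : AnalyticAt ℝ (fun q : X3 => fderiv ℝ Dt (q, q, q)) p :=
      AnalyticAt.fun_comp (g := fderiv ℝ Dt) (f := fun q : X3 => ((q, q, q) : X9)) (aDt (p, p, p) ⟨hp, hp, hp⟩).fderiv (adg p)
    have e2 : AnalyticAt ℝ (fun q : X3 => ((Tf φj q, 0, 0) : X9)) p :=
      (aTj p hp).prod (analyticAt_const (v := ((0, 0) : X3 × X3)))
    exact (an_clm_apply e1 e2).mul (((((aai p hp).mul (aaj p hp)).mul (aak p hp)).mul (auj p hp)).mul (auk p hp))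
  have hPne : P ps ≠ 0 := by
    refine mul_ne_zero hK ?_
    exact mul_ne_zero (mul_ne_zero (mul_ne_zero (mul_ne_zero (ni _ hps) (nj _ hps)) (nk _ hps))
      (mul_ne_zero (dj _ hps) (dj _ hps))) (mul_ne_zero (dk _ hps) (dk _ hps))
  have hsub : SubBd volume P K := subBd_compact volume P O hOp aP ps ⟨mB _ hps, trivial⟩ hPne K hKc hKO
  -- diagonal
  have hdiag : EqOn (fun p : X3 => Dt (p, p, p)) (fun _ => 0) K := by
    refine Set.EqOn.of_subset_closure (s := B ×ˢ Icc a b) ?_ ?_ continuousOn_const (prod_mono hBsub le_rfl) ?_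
    · intro p hp
      have hpB := hp.1
      have hpO : p ∈ O := ⟨mB _ hpB, trivial⟩
      have hM0 : M (p, p, p) (Tf φi p, Tf φi p, Tf φi p) = 0 :=
        diag_zero p (aai p hpO).differentiableAt (aaj p hpO).differentiableAt (aak p hpO).differentiableAt
          (ni p hpB) (nj p hpB) (nk p hpB) (aΦi p hpO).differentiableAt (aΦj p hpO).differentiableAt
          (aΦk p hpO).differentiableAt (Tf_ker (ani _ hpO.1))
      have hne : ((Tf φi p, Tf φi p, Tf φi p) : X9) ≠ 0 := fun h => Tf_ne (di _ hpB) (congrArg Prod.fst h)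
      have := h1 (M (p, p, p)) (Tf φi p, Tf φi p, Tf φi p)
      rw [hM0, map_zero] at this
      exact (smul_eq_zero.1 this.symm).resolve_right hne
    · intro p hp
      exact (AnalyticAt.fun_comp (g := Dt) (f := fun q : X3 => ((q, q, q) : X9))
        (aDt (p, p, p) ⟨hKO hp, hKO hp, hKO hp⟩) (adg p)).continuousAt.continuousWithinAt
    · rw [closure_prod_eq, isClosed_Icc.closure_eq]
  -- coverings
  have cov3 : CovOn K 3 := by
    refine CovOn.mono (((covOn_Icc (c₀.1 - r₀) (c₀.1 + r₀)).prod (covOn_Icc (c₀.2 - r₀) (c₀.2 + r₀))).prod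
      (covOn_Icc a b)) ?_
    rw [hKdef, hcl, ← Real.closedBall_eq_Icc, ← Real.closedBall_eq_Icc, closedBall_prod_same]
  have cov9 : CovOn (K ×ˢ (K ×ˢ K)) 9 := cov3.prod (cov3.prod cov3)
  -- constants
  have F1 := tay_ev (Φmap φj) O K aΦj hKO hKc hKcv
  have F2 := tay_ev (Φmap φk) O K aΦk hKO hKc hKcv
  have F3 := bd_ev (Φmap φi) O K aΦi hKO hKc
  have F4 := bd_ev (br φj φk) O K aai hKO hKc
  have F5 := bd_ev (br φk φi) O K aaj hKO hKc
  have F6 := bd_ev (br φi φj) O K aak hKO hKc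
  have F7 := bd_ev (uf φj) O K auj hKO hKc
  have F8 := bd_ev (uf φk) O K auk hKO hKc
  have F9 := bd_ev (Tf φj) O K aTj hKO hKc
  have F10 := bd_ev (Tf φk) O K aTk hKO hKc
  obtain ⟨CXj, CXj0, hXj⟩ := an_bound (Xf φj) O K aXj hKO hKc
  obtain ⟨CXk, CXk0, hXk⟩ := an_bound (Xf φk) O K aXk hKO hKc
  obtain ⟨CYj, CYj0, hYj⟩ := an_bound (Yf φj) O K aYj hKO hKc
  obtain ⟨CYk, CYk0, hYk⟩ := an_bound (Yf φk) O K aYk hKO hKc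
  have F11 := tay_ev (fN (br φj φk) (br φk φi) (br φi φj)) _ _ (fN_an aai aaj aak) hK9O hK9c hK9v
  have F12 := tay_ev (fD (br φj φk) (br φk φi) (br φi φj)) _ _ (fD_an aai aaj aak) hK9O hK9c hK9v
  have F13 := tay_ev (fG (Φmap φi) (Φmap φj) (Φmap φk)) _ _ (fG_an aΦi aΦj aΦk) hK9O hK9c hK9v
  have F14 := tay_ev Dt _ _ aDt hK9O hK9c hK9v
  have F15 := bd_ev (fun t => adj (M t)) _ _ aAd hK9O hK9c
  have grd : ∀ φ : Vec2 → ℝ, AnalyticOnNhd ℝ φ Bt → ∃ C : ℝ, 0 ≤ C ∧ ∀ x ∈ closure B, |d1 φ x| + |Dder φ x| ≤ C := by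
    intro φ hφ
    have hc : IsCompact (closure B) := by rw [hcl]; exact isCompact_closedBall _ _
    obtain ⟨C1, C10, h1⟩ := an_bound (d1 φ) Bt (closure B) (fun x hx => d1_an (hφ x hx)) hBBt hc
    obtain ⟨C2, C20, h2⟩ := an_bound (Dder φ) Bt (closure B) (fun x hx => d2_an (hφ x hx)) hBBt hc
    exact ⟨C1 + C2, by positivity, fun x hx => add_le_add (h1 x hx) (h2 x hx)⟩
  obtain ⟨Gi, Gi0, hGi⟩ := grd φi ani
  obtain ⟨Gj, Gj0, hGj⟩ := grd φj anj
  obtain ⟨Gk, Gk0, hGk⟩ := grd φk ank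
  have hex : ∃ Γ : ℝ, LocDat (Φmap φi) (Φmap φj) (Φmap φk) (br φj φk) (br φk φi) (br φi φj) (uf φj) (uf φk)
      (Tf φj) (Tf φk) Dt K Γ ∧ Gi ≤ Γ ∧ Gj ≤ Γ ∧ Gk ≤ Γ := by
    have := (((F1.and F2).and (F3.and F4)).and ((F5.and F6).and (F7.and F8))).and
      (((F9.and F10).and (F11.and F12)).and ((F13.and F14).and F15))
    have := this.and ((eventually_ge_atTop (1 + (CXj + CYj) + (CXk + CYk) + Gi + Gj + Gk)))
    obtain ⟨Γ, ⟨⟨⟨⟨f1, f2⟩, f3, f4⟩, ⟨f5, f6⟩, f7, f8⟩, ⟨⟨f9, f10⟩, f11, f12⟩, ⟨f13, f14⟩, f15⟩, hΓ⟩ := this.exists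
    refine ⟨Γ, ?_, by linarith, by linarith, by linarith⟩
    refine ⟨by linarith, f1, f2, f3, f4, f5, f6, f7, f8, f9, f10, ?_, ?_, f11, f12, f13, f14, ?_, hdiag⟩
    · intro p hp v
      refine (Tf_bd (anj _ (hKO hp).1) v).trans ?_
      gcongr
      linarith [hXj p hp, hYj p hp]
    · intro p hp v
      refine (Tf_bd (ank _ (hKO hp).1) v).trans ?_
      gcongr
      linarith [hXk p hp, hYk p hp]
    · intro t ht v
      have e1 : |Dt t| * ‖v‖ = ‖adj (M t) (M t v)‖ := by rw [h1, norm_smul, Real.norm_eq_abs]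
      rw [e1]
      refine ((adj (M t)).le_opNorm _).trans ?_
      exact mul_le_mul (f15 t ht) le_rfl (norm_nonneg _) (by linarith)
  obtain ⟨Γ, LD, gi, gj, gk⟩ := hex
  obtain ⟨κ, hκ, C, H⟩ := glob_est _ _ _ _ _ _ _ _ _ _ _ K Γ LD hKc cov3 cov9 P (fun p _ => rfl)
    (aP.continuousOn.mono hKO) hsub
  refine ⟨κ, hκ, C, fun ε e0 e1 fi fj fk E hfi hE hEB hsum hdis => ?_⟩
  have hEK : E ⊆ K := hEB.trans (prod_mono hBsub le_rfl)
  -- components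
  have cmp : ∀ p ∈ E, |fi (Φmap φi p) * d1 φi p.1 + fj (Φmap φj p) * d1 φj p.1 + fk (Φmap φk p) * d1 φk p.1| ≤ ε ∧
      |fi (Φmap φi p) * Dder φi p.1 + fj (Φmap φj p) * Dder φj p.1 + fk (Φmap φk p) * Dder φk p.1| ≤ ε := by
    intro p hp
    have hs := hsum p hp
    constructor
    · have := (ContinuousLinearMap.le_opNorm _ ((1, 0) : Vec2)).trans (mul_le_mul_of_nonneg_right hs (norm_nonneg _))
      simpa [d1, Dder, Prod.norm_def] using this
    · have := (ContinuousLinearMap.le_opNorm _ ((0, 1) : Vec2)).trans (mul_le_mul_of_nonneg_right hs (norm_nonneg _))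
      simpa [d1, Dder, Prod.norm_def] using this
  have gen : ∀ x y A D G Z : ℝ, |x| ≤ ε → |y| ≤ ε → |A| + |D| ≤ G → G ≤ Γ → Z = y * A - x * D → |Z| ≤ Γ * ε := by
    intro x y A D G Z hx hy hG hGG hZ
    rw [hZ]
    refine (abs_sub _ _).trans ?_
    rw [abs_mul, abs_mul]
    have := mul_le_mul_of_nonneg_right hx (abs_nonneg D)
    have := mul_le_mul_of_nonneg_right hy (abs_nonneg A)
    nlinarith
  refine H ε e0 e1 fi fj fk E hfi hE hEK ?_ ?_ ?_ hdis
  · intro p hp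
    obtain ⟨c1, c2⟩ := cmp p hp
    exact gen _ _ _ _ _ _ c1 c2 (hGk _ (hEK hp).1) gk (by simp only [br]; ring)
  · intro p hp
    obtain ⟨c1, c2⟩ := cmp p hp
    exact gen _ _ _ _ _ _ c1 c2 (hGi _ (hEK hp).1) gi (by simp only [br]; ring)
  · intro p hp
    obtain ⟨c1, c2⟩ := cmp p hp
    exact gen _ _ _ _ _ _ c1 c2 (hGj _ (hEK hp).1) gj (by simp only [br]; ring)

end SM7d

section SM7e
lemma factor_exists {φ : Vec2 → ℝ} {R : Set X3} (hR : IsOpen R) (hφ : ∀ q ∈ R, AnalyticAt ℝ φ q.1)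
    (hD : ∀ q ∈ R, Dder φ q.1 ≠ 0) (h : X3 → ℝ) (hh : AnalyticOnNhd ℝ h R)
    (hT : ∀ q ∈ R, fderiv ℝ h q (Tf φ q) = 0) (p0 : X3) (hp0 : p0 ∈ R) :
    ∃ U : Set X3, IsOpen U ∧ p0 ∈ U ∧ ∃ g : Vec2 → ℝ, AnalyticOnNhd ℝ g (Φmap φ '' U) ∧
      ∀ p ∈ U, g (Φmap φ p) = h p := by
  set chi1 : X3 → ℝ × Vec2 := fun p => (p.1.1, Φmap φ p) with hchi
  have ac : ∀ q ∈ R, AnalyticAt ℝ chi1 q := fun q hq =>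
    (AnalyticAt.fun_comp (f := fun t : X3 => t.1) (g := fun x : Vec2 => x.1) analyticAt_fst analyticAt_fst).prod (Φ_an (hφ q hq))
  have dc : ∀ q ∈ R, ∀ v, fderiv ℝ chi1 q v = (v.1.1, fderiv ℝ (Φmap φ) q v) := by
    intro q hq v
    have e1 : HasFDerivAt (fun p : X3 => p.1.1) ((ContinuousLinearMap.fst ℝ ℝ ℝ).comp (ContinuousLinearMap.fst ℝ Vec2 ℝ)) q :=
      hasFDerivAt_fst.comp q hasFDerivAt_fst
    have e2 := e1.prodMk (Φ_an (hφ q hq)).differentiableAt.hasFDerivAt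
    have e3 : fderiv ℝ chi1 q = _ := e2.fderiv
    rw [e3]; rfl
  have hinj : Function.Injective (fderiv ℝ chi1 p0) := by
    rw [injective_iff_map_eq_zero]
    intro v hv
    rw [dc p0 hp0, Prod.mk_eq_zero] at hv
    obtain ⟨c, hc⟩ := Tf_span (hφ p0 hp0) (hD p0 hp0) v hv.2
    have h3 : c * (Dder φ p0.1 * Dder φ p0.1) = 0 := by
      have := hv.1; rw [hc] at this; exact this
    have := (mul_eq_zero.1 h3).resolve_right (mul_ne_zero (hD _ hp0) (hD _ hp0))
    rw [hc, this, zero_smul]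
  have hfr : Module.finrank ℝ X3 = Module.finrank ℝ (ℝ × Vec2) := by simp
  let i : X3 ≃L[ℝ] (ℝ × Vec2) :=
    (LinearEquiv.ofInjectiveOfFinrankEq (fderiv ℝ chi1 p0 : X3 →ₗ[ℝ] ℝ × Vec2) hinj hfr).toContinuousLinearEquiv
  have hi : fderiv ℝ chi1 p0 = (i : X3 →L[ℝ] ℝ × Vec2) := by
    exact ContinuousLinearMap.ext fun v => rfl
  have hs : HasStrictFDerivAt chi1 (i : X3 →L[ℝ] ℝ × Vec2) p0 := by
    rw [← hi]; exact (ac p0 hp0).hasStrictFDerivAt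
  let e := hs.toOpenPartialHomeomorph chi1
  have hps : p0 ∈ e.source := hs.mem_toOpenPartialHomeomorph_source
  have he : ∀ q, e q = chi1 q := fun q => rfl
  have aψ : AnalyticAt ℝ e.symm (e p0) := e.analyticAt_symm' (i := i) hps (ac p0 hp0) hi
  have hsy : e.symm (e p0) = p0 := e.left_inv hps
  have ev : ∀ᶠ y in 𝓝 (e p0), AnalyticAt ℝ e.symm y ∧ e.symm y ∈ R ∧ y ∈ e.target := by
    refine aψ.eventually_analyticAt.and ((aψ.continuousAt.eventually ?_).and (e.open_target.mem_nhds (e.map_source hps)))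
    rw [hsy]; exact hR.mem_nhds hp0
  obtain ⟨δ, hδ, hball⟩ := Metric.eventually_nhds_iff_ball.1 ev
  set y0 := e p0 with hy0
  refine ⟨e.source ∩ e ⁻¹' (ball y0 δ), e.isOpen_inter_preimage isOpen_ball, ⟨hps, mem_ball_self hδ⟩,
    fun y => h (e.symm (y0.1, y)), ?_, ?_⟩
  · rintro _ ⟨p, ⟨hp1, hp2⟩, rfl⟩
    have hm : ((y0.1, Φmap φ p) : ℝ × Vec2) ∈ ball y0 δ := by
      rw [← ball_prod_same] 
      have : e p ∈ ball y0 δ := hp2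
      rw [← ball_prod_same] at this
      exact ⟨mem_ball_self hδ, this.2⟩
    obtain ⟨h1, h2, h3⟩ := hball _ hm
    have e1 : AnalyticAt ℝ (fun y : Vec2 => ((y0.1, y) : ℝ × Vec2)) (Φmap φ p) := analyticAt_const.prod analyticAt_id
    have e2 : AnalyticAt ℝ (fun y : Vec2 => e.symm (y0.1, y)) (Φmap φ p) := AnalyticAt.fun_comp (f := fun y : Vec2 => ((y0.1, y) : ℝ × Vec2)) h1 e1
    exact AnalyticAt.fun_comp (f := fun y : Vec2 => e.symm (y0.1, y)) (hh _ h2) e2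
  · rintro p ⟨hp1, hp2⟩
    have hpb : e p ∈ ball y0 δ := hp2
    rw [← ball_prod_same] at hpb
    have hep : e p = (p.1.1, Φmap φ p) := rfl
    set F : ℝ → ℝ := fun t => h (e.symm (t, Φmap φ p)) with hF
    have hd : ∀ t ∈ ball y0.1 δ, HasDerivAt F 0 t := by
      intro t ht
      have hm : ((t, Φmap φ p) : ℝ × Vec2) ∈ ball y0 δ := by
        rw [← ball_prod_same]; exact ⟨ht, hpb.2⟩
      obtain ⟨h1, h2, h3⟩ := hball _ hm
      have l : HasDerivAt (fun t : ℝ => ((t, Φmap φ p) : ℝ × Vec2)) (1, 0) t :=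
        (hasDerivAt_id t).prodMk (hasDerivAt_const _ _)
      have l2 : HasDerivAt (fun t : ℝ => e.symm (t, Φmap φ p)) _ t :=
        HasFDerivAt.comp_hasDerivAt t h1.differentiableAt.hasFDerivAt l
      set v := fderiv ℝ e.symm (t, Φmap φ p) (1, 0) with hv
      have l3 : HasDerivAt (fun t : ℝ => chi1 (e.symm (t, Φmap φ p))) _ t :=
        HasFDerivAt.comp_hasDerivAt t (ac _ h2).differentiableAt.hasFDerivAt l2
      have l4 : (fun t : ℝ => chi1 (e.symm (t, Φmap φ p))) =ᶠ[𝓝 t] fun t => (t, Φmap φ p) := by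
        filter_upwards [isOpen_ball.mem_nhds ht] with t' ht'
        have hm' : ((t', Φmap φ p) : ℝ × Vec2) ∈ ball y0 δ := by
          rw [← ball_prod_same]; exact ⟨ht', hpb.2⟩
        exact e.right_inv (hball _ hm').2.2
      have l5 := (l3.congr_of_eventuallyEq l4.symm).unique l
      rw [dc _ h2] at l5
      obtain ⟨c, hc⟩ := Tf_span (hφ _ h2) (hD _ h2) v (congrArg Prod.snd l5)
      have l6 : HasDerivAt F _ t := HasFDerivAt.comp_hasDerivAt t (hh _ h2).differentiableAt.hasFDerivAt l2
      rw [hc, map_smul, hT _ h2, smul_zero] at l6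
      exact l6
    have := (convex_ball y0.1 δ).norm_image_sub_le_of_norm_hasDerivWithin_le (C := 0)
      (fun t ht => (hd t ht).hasDerivWithinAt) (by simp) hpb.1 (mem_ball_self hδ)
    rw [zero_mul, norm_le_zero_iff, sub_eq_zero] at this
    show F y0.1 = h p
    rw [this, hF]
    show h (e.symm (e p)) = h p
    rw [e.left_inv hp1]

/-- dual frame -/
lemma omega_exists {T0 T1 T2 : X3 → X3} {c0 c1 c2 : X3 → ℝ} {R : Set X3}
    (a0 : AnalyticOnNhd ℝ T0 R) (a1 : AnalyticOnNhd ℝ T1 R) (a2 : AnalyticOnNhd ℝ T2 R)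
    (b0 : AnalyticOnNhd ℝ c0 R) (b1 : AnalyticOnNhd ℝ c1 R) (b2 : AnalyticOnNhd ℝ c2 R)
    (hli : ∀ p ∈ R, LinearIndependent ℝ ![T0 p, T1 p, T2 p]) :
    ∃ ω : X3 → (X3 →L[ℝ] ℝ), AnalyticOnNhd ℝ ω R ∧ ∀ q ∈ R, ω q (T0 q) = c0 q ∧ ω q (T1 q) = c1 q ∧ ω q (T2 q) = c2 q := by
  set pr0 : X3 →L[ℝ] ℝ := (ContinuousLinearMap.fst ℝ ℝ ℝ).comp (ContinuousLinearMap.fst ℝ Vec2 ℝ) with hpr0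
  set pr1 : X3 →L[ℝ] ℝ := (ContinuousLinearMap.snd ℝ ℝ ℝ).comp (ContinuousLinearMap.fst ℝ Vec2 ℝ) with hpr1
  set pr2 : X3 →L[ℝ] ℝ := ContinuousLinearMap.snd ℝ Vec2 ℝ with hpr2
  set F : X3 → (X3 →L[ℝ] X3) := fun q => pr0.smulRight (T0 q) + pr1.smulRight (T1 q) + pr2.smulRight (T2 q) with hF
  set C : X3 → (X3 →L[ℝ] ℝ) := fun q => c0 q • pr0 + c1 q • pr1 + c2 q • pr2 with hC
  have aF : AnalyticOnNhd ℝ F R := by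
    intro q hq
    have g : ∀ (pr : X3 →L[ℝ] ℝ) (T : X3 → X3), AnalyticAt ℝ T q → AnalyticAt ℝ (fun q => pr.smulRight (T q)) q :=
      fun pr T hT => ((ContinuousLinearMap.smulRightL ℝ X3 X3 pr).analyticAt _).comp' hT
    exact ((g _ _ (a0 q hq)).add (g _ _ (a1 q hq))).add (g _ _ (a2 q hq))
  have aC : AnalyticOnNhd ℝ C R := fun q hq =>
    (((b0 q hq).smul analyticAt_const).add ((b1 q hq).smul analyticAt_const)).add ((b2 q hq).smul analyticAt_const)
  have hu : ∀ q ∈ R, IsUnit (F q) := by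
    intro q hq
    have inj : Function.Injective (F q : X3 →ₗ[ℝ] X3) := by
      rw [injective_iff_map_eq_zero]
      intro v hv
      have hv' : v.1.1 • T0 q + v.1.2 • T1 q + v.2 • T2 q = 0 := hv
      have := Fintype.linearIndependent_iff.1 (hli q hq) ![v.1.1, v.1.2, v.2] (by simpa [Fin.sum_univ_three] using hv')
      exact Prod.ext (Prod.ext (this 0) (this 1)) (this 2)
    let i := (LinearEquiv.ofInjectiveEndo (F q : X3 →ₗ[ℝ] X3) inj).toContinuousLinearEquiv
    exact ⟨ContinuousLinearEquiv.toUnit i, by exact ContinuousLinearMap.ext fun v => rfl⟩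
  refine ⟨fun q => (C q).comp (Ring.inverse (F q)), ?_, ?_⟩
  · intro q hq
    obtain ⟨z, hz⟩ := hu q hq
    have e1 : AnalyticAt ℝ (fun q => Ring.inverse (F q)) q := by
      have := analyticAt_inverse (𝕜 := ℝ) z
      rw [hz] at this
      exact this.fun_comp (aF q hq)
    have := ((ContinuousLinearMap.compL ℝ X3 X3 ℝ).analyticAt_bilinear (C q, Ring.inverse (F q))).comp₂ (aC q hq) e1
    exact this
  · intro q hq
    have key : ∀ v, Ring.inverse (F q) (F q v) = v := by
      intro v
      have := Ring.inverse_mul_cancel _ (hu q hq)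
      exact congrArg (fun L : X3 →L[ℝ] X3 => L v) this
    have k0 : F q ((1, 0), 0) = T0 q := by simp [hF, hpr0, hpr1, hpr2]
    have k1 : F q ((0, 1), 0) = T1 q := by simp [hF, hpr0, hpr1, hpr2]
    have k2 : F q ((0, 0), 1) = T2 q := by simp [hF, hpr0, hpr1, hpr2]
    refine ⟨?_, ?_, ?_⟩
    · rw [ContinuousLinearMap.comp_apply, ← k0, key]; simp [hC, hpr0, hpr1, hpr2]
    · rw [ContinuousLinearMap.comp_apply, ← k1, key]; simp [hC, hpr0, hpr1, hpr2]
    · rw [ContinuousLinearMap.comp_apply, ← k2, key]; simp [hC, hpr0, hpr1, hpr2]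

end SM7e

section SM7f
/-- the determinant derivative on the diagonal -/
def Kh (dt : (X9 →L[ℝ] ℝ × Y8) → ℝ) (φi φj φk : Vec2 → ℝ) (p : X3) : ℝ :=
  fderiv ℝ (fun t => dt (Mop (br φj φk) (br φk φi) (br φi φj) (Φmap φi) (Φmap φj) (Φmap φk) t))
      (p, p, p) (Tf φj p, 0, 0)

lemma li_rot {x y z : X3} (h : LinearIndependent ℝ ![x, y, z]) : LinearIndependent ℝ ![y, z, x] := by
  rw [Fintype.linearIndependent_iff] at h ⊢
  intro g hg
  have := h ![g 2, g 0, g 1] (by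
    rw [← hg]; simp [Fin.sum_univ_three]; abel)
  intro i; fin_cases i
  · exact this 1
  · exact this 2
  · exact this 0

lemma kappa_one (R : Set X3) (hR : IsOpen R) (φi φj φk : Vec2 → ℝ)
    (ani : ∀ q ∈ R, AnalyticAt ℝ φi q.1) (anj : ∀ q ∈ R, AnalyticAt ℝ φj q.1) (ank : ∀ q ∈ R, AnalyticAt ℝ φk q.1)
    (ni : ∀ p ∈ R, br φj φk p ≠ 0) (nj : ∀ p ∈ R, br φk φi p ≠ 0)
    (nk : ∀ p ∈ R, br φi φj p ≠ 0) (di : ∀ p ∈ R, Dder φi p.1 ≠ 0)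
    (dj : ∀ p ∈ R, Dder φj p.1 ≠ 0) (dk : ∀ p ∈ R, Dder φk p.1 ≠ 0)
    (hli : ∀ p ∈ R, LinearIndependent ℝ ![Tf φi p, Tf φj p, Tf φk p])
    (ω : X3 → (X3 →L[ℝ] ℝ)) (hω : AnalyticOnNhd ℝ ω R)
    (wi : ∀ q ∈ R, ω q (Tf φi q) = - thF (br φj φk) q (Tf φi q)) (wj : ∀ q ∈ R, ω q (Tf φj q) = - thF (br φk φi) q (Tf φj q))
    (wk : ∀ q ∈ R, ω q (Tf φk q) = - thF (br φi φj) q (Tf φk q))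
    (dt : (X9 →L[ℝ] ℝ × Y8) → ℝ) (adj : (X9 →L[ℝ] ℝ × Y8) → (ℝ × Y8 →L[ℝ] X9))
    (dta : ∀ L, AnalyticAt ℝ dt L) (adja : ∀ L, AnalyticAt ℝ adj L) (h1 : ∀ L v, adj L (L v) = dt L • v)
    (h2 : ∀ (L : X9 →L[ℝ] ℝ × Y8) (w : X9), w ≠ 0 → (∀ v, (L v).2 = 0 → ∃ t : ℝ, v = t • w) →
        adj L (1, 0) ≠ 0)
    (hK : ∀ p ∈ R, Kh dt φi φj φk p = 0) : ∀ p ∈ R,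
    fderiv ℝ ω p (Tf φj p) (Tf φi p) = fderiv ℝ ω p (Tf φi p) (Tf φj p) := by
  intro p hp
  exact key_kappa hR (fun q hq => br_an (anj q hq) (ank q hq)) (fun q hq => br_an (ank q hq) (ani q hq))
    (fun q hq => br_an (ani q hq) (anj q hq)) ni nj nk (fun q hq => Φ_an (ani q hq)) (fun q hq => Φ_an (anj q hq))
    (fun q hq => Φ_an (ank q hq)) (fun q hq => Tf_an (ani q hq)) (fun q hq => Tf_an (anj q hq))
    (fun q hq => Tf_ker (ani q hq)) (fun q hq => Tf_ker (anj q hq)) (fun q hq => Tf_ker (ank q hq)) p hp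
    (Tf_span (ani p hp) (di p hp)) (Tf_span (anj p hp) (dj p hp)) (Tf_span (ank p hp) (dk p hp)) (hli p hp)
    ω (hω p hp) wi wj wk dt adj dta adja h1 h2 (hK p hp)

lemma nonvanish (R : Set X3) (hR : IsOpen R) (hRc : Convex ℝ R) (φi φj φk : Vec2 → ℝ)
    (ani : ∀ q ∈ R, AnalyticAt ℝ φi q.1) (anj : ∀ q ∈ R, AnalyticAt ℝ φj q.1) (ank : ∀ q ∈ R, AnalyticAt ℝ φk q.1)
    (ni : ∀ p ∈ R, br φj φk p ≠ 0) (nj : ∀ p ∈ R, br φk φi p ≠ 0)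
    (nk : ∀ p ∈ R, br φi φj p ≠ 0) (di : ∀ p ∈ R, Dder φi p.1 ≠ 0)
    (dj : ∀ p ∈ R, Dder φj p.1 ≠ 0) (dk : ∀ p ∈ R, Dder φk p.1 ≠ 0)
    (hli : ∀ p ∈ R, LinearIndependent ℝ ![Tf φi p, Tf φj p, Tf φk p])
    (dt : (X9 →L[ℝ] ℝ × Y8) → ℝ) (adj : (X9 →L[ℝ] ℝ × Y8) → (ℝ × Y8 →L[ℝ] X9))
    (dta : ∀ L, AnalyticAt ℝ dt L) (adja : ∀ L, AnalyticAt ℝ adj L) (h1 : ∀ L v, adj L (L v) = dt L • v)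
    (h2 : ∀ (L : X9 →L[ℝ] ℝ × Y8) (w : X9), w ≠ 0 → (∀ v, (L v).2 = 0 → ∃ t : ℝ, v = t • w) →
        adj L (1, 0) ≠ 0)
    (hK0 : ∀ p ∈ R, Kh dt φi φj φk p = 0) (hK1 : ∀ p ∈ R, Kh dt φj φk φi p = 0)
    (hK2 : ∀ p ∈ R, Kh dt φk φi φj p = 0) (p0 : X3) (hp0 : p0 ∈ R) :
    ∃ U : Set X3, IsOpen U ∧ U ⊆ R ∧ p0 ∈ U ∧ ∃ gi gj gk : Vec2 → ℝ, AnalyticOnNhd ℝ gi (Φmap φi '' U) ∧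
      AnalyticOnNhd ℝ gj (Φmap φj '' U) ∧ AnalyticOnNhd ℝ gk (Φmap φk '' U) ∧
      (∀ p ∈ U, gi (Φmap φi p) • fderiv ℝ φi p.1 + gj (Φmap φj p) • fderiv ℝ φj p.1
        + gk (Φmap φk p) • fderiv ℝ φk p.1 = 0) ∧ gi (Φmap φi p0) ≠ 0 := by
  have aai : AnalyticOnNhd ℝ (br φj φk) R := fun p hp => br_an (anj _ hp) (ank _ hp)
  have aaj : AnalyticOnNhd ℝ (br φk φi) R := fun p hp => br_an (ank _ hp) (ani _ hp)
  have aak : AnalyticOnNhd ℝ (br φi φj) R := fun p hp => br_an (ani _ hp) (anj _ hp)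
  have ati : AnalyticOnNhd ℝ (Tf φi) R := fun p hp => Tf_an (ani _ hp)
  have atj : AnalyticOnNhd ℝ (Tf φj) R := fun p hp => Tf_an (anj _ hp)
  have atk : AnalyticOnNhd ℝ (Tf φk) R := fun p hp => Tf_an (ank _ hp)
  have ac : ∀ (a : X3 → ℝ) (T : X3 → X3), AnalyticOnNhd ℝ a R → AnalyticOnNhd ℝ T R → (∀ p ∈ R, a p ≠ 0) →
      AnalyticOnNhd ℝ (fun q => - thF a q (T q)) R := fun a T ha hT h0 p hp =>
    (an_clm_apply (thF_an (ha p hp) (h0 p hp)) (hT p hp)).neg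
  obtain ⟨ω, hω, hw⟩ := omega_exists ati atj atk (ac _ _ aai ati ni) (ac _ _ aaj atj nj) (ac _ _ aak atk nk) hli
  have wi := fun q hq => (hw q hq).1
  have wj := fun q hq => (hw q hq).2.1
  have wk := fun q hq => (hw q hq).2.2
  have s1 := kappa_one R hR φi φj φk ani anj ank ni nj nk di dj dk hli ω hω wi wj wk dt adj dta adja h1 h2 hK0
  have s2 := kappa_one R hR φj φk φi anj ank ani nj nk ni dj dk di (fun p hp => li_rot (hli p hp)) ω hω wj wk wi
    dt adj dta adja h1 h2 hK1
  have s3 := kappa_one R hR φk φi φj ank ani anj nk ni nj dk di dj (fun p hp => li_rot (li_rot (hli p hp))) ω hω wk wi wj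
    dt adj dta adja h1 h2 hK2
  have hsym : ∀ p ∈ R, ∀ x y, fderiv ℝ ω p x y = fderiv ℝ ω p y x := by
    intro p hp x y
    have hspan : ∀ v : X3, ∃ x y z : ℝ, v = x • Tf φi p + y • Tf φj p + z • Tf φk p := by
      intro v
      have hb := (basisOfLinearIndependentOfCardEqFinrank (hli p hp) (by simp)).sum_repr v
      rw [Fin.sum_univ_three] at hb
      simp only [coe_basisOfLinearIndependentOfCardEqFinrank] at hb
      exact ⟨_, _, _, hb.symm⟩
    obtain ⟨x0, x1, x2, rfl⟩ := hspan x
    obtain ⟨y0, y1, y2, rfl⟩ := hspan y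
    simp only [map_add, map_smul, ContinuousLinearMap.add_apply, ContinuousLinearMap.smul_apply, smul_eq_mul,
      s1 p hp, s2 p hp, s3 p hp]
    ring
  obtain ⟨L, hL, hLd⟩ := analytic_poincare ω R hR hRc hω hsym
  have fac : ∀ (φ : Vec2 → ℝ) (a : X3 → ℝ), (∀ q ∈ R, AnalyticAt ℝ φ q.1) → (∀ p ∈ R, Dder φ p.1 ≠ 0) →
      AnalyticOnNhd ℝ a R → (∀ p ∈ R, a p ≠ 0) → (∀ q ∈ R, ω q (Tf φ q) = - thF a q (Tf φ q)) →
      ∃ U : Set X3, IsOpen U ∧ p0 ∈ U ∧ ∃ g : Vec2 → ℝ, AnalyticOnNhd ℝ g (Φmap φ '' U) ∧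
      ∀ p ∈ U, g (Φmap φ p) = Real.exp (L p) * a p := by
    intro φ a hφ hD ha h0 hwq
    refine factor_exists hR hφ hD (fun p => Real.exp (L p) * a p) ?_ ?_ p0 hp0
    · intro p hp
      exact (hL p hp).rexp.mul (ha p hp)
    · intro q hq
      have e := ((hLd q hq).exp.mul (ha q hq).differentiableAt.hasFDerivAt).fderiv
      erw [e]
      have := hwq q hq
      simp only [thF, ContinuousLinearMap.smul_apply, smul_eq_mul] at this
      simp only [ContinuousLinearMap.add_apply, ContinuousLinearMap.smul_apply, smul_eq_mul, this]
      have := h0 q hq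
      field_simp
      ring
  obtain ⟨Ui, oi, mi, gi, hgi, ei⟩ := fac φi _ ani di aai ni wi
  obtain ⟨Uj, oj, mj, gj, hgj, ej⟩ := fac φj _ anj dj aaj nj wj
  obtain ⟨Uk, ok, mk, gk, hgk, ek⟩ := fac φk _ ank dk aak nk wk
  refine ⟨R ∩ (Ui ∩ (Uj ∩ Uk)), hR.inter (oi.inter (oj.inter ok)), inter_subset_left, ⟨hp0, mi, mj, mk⟩,
    gi, gj, gk, hgi.mono (image_mono fun p hp => hp.2.1), hgj.mono (image_mono fun p hp => hp.2.2.1),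
    hgk.mono (image_mono fun p hp => hp.2.2.2), ?_, ?_⟩
  · rintro p ⟨_, q1, q2, q3⟩
    rw [ei p q1, ej p q2, ek p q3]
    refine ContinuousLinearMap.ext fun v => ?_
    simp only [ContinuousLinearMap.add_apply, ContinuousLinearMap.smul_apply, smul_eq_mul, fder_split, br,
      ContinuousLinearMap.zero_apply]
    ring
  · rw [ei p0 mi]
    exact mul_ne_zero (Real.exp_ne_zero _) (ni p0 hp0)

end SM7f

section SM8
lemma br_ne {φ ψ : Vec2 → ℝ} (p : X3) (h : LinearIndependent ℝ ![fderiv ℝ φ p.1, fderiv ℝ ψ p.1]) : br φ ψ p ≠ 0 := by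
  intro h0
  simp only [br] at h0
  have hp := LinearIndependent.pair_iff.1 h
  have e1 := hp (Dder ψ p.1) (-Dder φ p.1) (by
    refine ContinuousLinearMap.ext fun v => ?_
    simp only [ContinuousLinearMap.add_apply, ContinuousLinearMap.smul_apply, smul_eq_mul, fder_split,
      ContinuousLinearMap.zero_apply]
    linear_combination v.1 * h0)
  have e2 := hp (d1 ψ p.1) (-d1 φ p.1) (by
    refine ContinuousLinearMap.ext fun v => ?_
    simp only [ContinuousLinearMap.add_apply, ContinuousLinearMap.smul_apply, smul_eq_mul, fder_split,
      ContinuousLinearMap.zero_apply]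
    linear_combination -v.2 * h0)
  have := h.ne_zero 0
  refine this ?_
  refine ContinuousLinearMap.ext fun v => ?_
  have e3 := neg_eq_zero.1 e1.2
  have e4 := neg_eq_zero.1 e2.2
  simp [fder_split, e3, e4]

lemma frame_li (B Bt : Set Vec2) (hBo : IsOpen B) (hBBt : B ⊆ Bt) (φ : Fin 4 → Vec2 → ℝ)
    (hφ_an : ∀ j, AnalyticOnNhd ℝ (φ j) Bt)
    (hD : ∀ j : Fin 3, ∀ x ∈ B, Dder (φ j.castSucc) x ≠ 0)
    (V : Fin 4 → Vec2 → Vec2) (hV_an : ∀ j, AnalyticOnNhd ℝ (V j) Bt)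
    (hV_ne : ∀ j, ∀ x ∈ Bt, V j x ≠ 0)
    (hV_ker : ∀ j, ∀ x ∈ Bt, fderiv ℝ (φ j) x (V j x) = 0)
    (W : Fin 4 → Fin 4 → (Vec2 × ℝ) → (Vec2 × ℝ))
    (hW_ker : ∀ j k, ∀ p ∈ Bt ×ˢ (univ : Set ℝ),
      fderiv ℝ (fun q : Vec2 × ℝ => ((φ j q.1, q.2 * fderiv ℝ (φ j) q.1 (V k q.1)) : Vec2))
        p (W j k p) = 0)
    (haux2 : ∀ k : Fin 4, ∀ p : Vec2 × ℝ, p.1 ∈ Bt → p.2 ≠ 0 →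
      LinearIndependent ℝ (fun j : {j : Fin 4 // j ≠ k} => W j.1 k p))
    (hd3 : ∀ x ∈ B, ∀ v, fderiv ℝ (φ 3) x v = v.1) (p : X3) (hpB : p.1 ∈ B) (hs : p.2 ≠ 0) :
    LinearIndependent ℝ (fun j : Fin 3 => Tf (φ j.castSucc) p) := by
  set be : Vec2 → ℝ := fun x => (V 3 x).2 with hbe
  have hVb : ∀ x ∈ B, V 3 x = (0, be x) := by
    intro x hx
    have := hV_ker 3 x (hBBt hx)
    rw [hd3 x hx] at this
    exact Prod.ext this rfl
  have hb0 : ∀ x ∈ B, be x ≠ 0 := by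
    intro x hx h
    apply hV_ne 3 x (hBBt hx)
    rw [hVb x hx, h]; rfl
  obtain ⟨x, s⟩ := p
  simp only at hpB hs
  have hbx := hb0 x hpB
  set q : X3 := (x, s / be x) with hq
  have hq2 : q.2 ≠ 0 := div_ne_zero hs hbx
  have hli := haux2 3 q (hBBt hpB) hq2
  set σ : X3 → X3 := fun r => (r.1, r.2 * be r.1) with hσ
  have hσq : σ q = (x, s) := by simp [hσ, hq, hbx]
  have dbe : DifferentiableAt ℝ be x := ((hV_an 3 x (hBBt hpB)).differentiableAt).snd
  have hf : HasFDerivAt (fun r : X3 => r.1) (ContinuousLinearMap.fst ℝ Vec2 ℝ) q := hasFDerivAt_fst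
  have hsn : HasFDerivAt (fun r : X3 => r.2) (ContinuousLinearMap.snd ℝ Vec2 ℝ) q := hasFDerivAt_snd
  have e2 : HasFDerivAt (fun r : X3 => be r.1) _ q :=
    HasFDerivAt.comp (g := be) q dbe.hasFDerivAt hf
  have hA : HasFDerivAt σ _ q := hf.prodMk (hsn.mul e2)
  set A := fderiv ℝ σ q with hAd
  have hAv : ∀ v : X3, A v = 0 → v = 0 := by
    intro v hv
    rw [hAd, hA.fderiv] at hv
    have h1 : v.1 = 0 := congrArg Prod.fst hv
    have h2 := congrArg Prod.snd hv
    simp [h1] at h2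
    exact Prod.ext h1 (h2.resolve_left hbx)
  have hA' : HasFDerivAt σ A q := hA.differentiableAt.hasFDerivAt
  have hc : ∀ j : Fin 3, ∃ c : ℝ, A (W j.castSucc 3 q) = c • Tf (φ j.castSucc) (x, s) := by
    intro j
    refine Tf_span (hφ_an _ x (hBBt hpB)) (hD j x hpB) _ ?_
    have h1 := hW_ker j.castSucc 3 q ⟨hBBt hpB, trivial⟩
    have h2 : (fun r : Vec2 × ℝ => ((φ j.castSucc r.1, r.2 * fderiv ℝ (φ j.castSucc) r.1 (V 3 r.1)) : Vec2)) =ᶠ[𝓝 q]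
        fun r => Φmap (φ j.castSucc) (σ r) := by
      have : ∀ᶠ r : X3 in 𝓝 q, r.1 ∈ B := continuous_fst.continuousAt.eventually (hBo.mem_nhds hpB)
      filter_upwards [this] with r hr
      rw [hVb r.1 hr, fder_split]
      simp [Φmap, hσ]; ring
    rw [h2.fderiv_eq] at h1
    have h3 : HasFDerivAt (Φmap (φ j.castSucc)) (fderiv ℝ (Φmap (φ j.castSucc)) (x, s)) (σ q) := by
      rw [hσq]; exact (Φ_an (p := (x, s)) (hφ_an _ x (hBBt hpB))).differentiableAt.hasFDerivAt
    have h4 : HasFDerivAt (fun r => Φmap (φ j.castSucc) (σ r)) _ q := h3.comp q hA'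
    rw [h4.fderiv] at h1
    exact h1
  choose c hc using hc
  have hli3 : LinearIndependent ℝ (fun j : Fin 3 => W j.castSucc 3 q) := by
    have := hli.comp (fun j : Fin 3 => (⟨j.castSucc, (Fin.castSucc_lt_last j).ne⟩ : {j : Fin 4 // j ≠ 3})) (by
      intro a b h
      have h' : a.castSucc = b.castSucc := congrArg Subtype.val h
      exact Fin.castSucc_injective _ h')
    exact this
  have hc0 : ∀ j, c j ≠ 0 := by
    intro j h
    have := hc j
    rw [h, zero_smul] at this
    exact hli3.ne_zero j (hAv _ this)
  rw [Fintype.linearIndependent_iff] at hli3 ⊢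
  intro g hg j
  have := hli3 (fun j => g j / c j) (by
    apply hAv
    rw [map_sum, ← hg]
    refine Finset.sum_congr rfl fun j _ => ?_
    rw [map_smul, hc, smul_smul, div_mul_cancel₀ _ (hc0 j)]) j
  exact (div_eq_zero_iff.1 this).resolve_right (hc0 j)

lemma meas_set (S : Set X3) (hS : MeasurableSet S) (φ : Fin 3 → Vec2 → ℝ)
    (hφ : ∀ j, ∀ p ∈ S, AnalyticAt ℝ (φ j) p.1) (f : Fin 3 → Vec2 → ℝ) (hf : ∀ j, Measurable (f j)) (ε : ℝ) :
    MeasurableSet (S ∩ {p : X3 | ‖∑ j : Fin 3, f j (Φmap (φ j) p) • fderiv ℝ (φ j) p.1‖ ≤ ε}) := by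
  classical
  have mΨ : ∀ j, Measurable (S.piecewise (Φmap (φ j)) (fun _ => 0)) := fun j =>
    ContinuousOn.measurable_piecewise (fun p hp => (Φ_an (hφ j p hp)).continuousAt.continuousWithinAt)
      continuousOn_const hS
  have mD : ∀ j, Measurable (S.piecewise (fun p : X3 => fderiv ℝ (φ j) p.1) (fun _ => 0)) := fun j =>
    ContinuousOn.measurable_piecewise (fun p hp => by
      have : ContinuousAt (fderiv ℝ (φ j)) p.1 := (hφ j p hp).fderiv.continuousAt
      exact (ContinuousAt.comp (f := fun p : X3 => p.1) this continuous_fst.continuousAt).continuousWithinAt)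
      continuousOn_const hS
  have : S ∩ {p : X3 | ‖∑ j : Fin 3, f j (Φmap (φ j) p) • fderiv ℝ (φ j) p.1‖ ≤ ε} =
      S ∩ {p : X3 | ‖∑ j : Fin 3, f j (S.piecewise (Φmap (φ j)) (fun _ => 0) p) •
        (S.piecewise (fun p : X3 => fderiv ℝ (φ j) p.1) (fun _ => 0)) p‖ ≤ ε} := by
    ext p
    constructor
    · rintro ⟨h1, h2⟩
      refine ⟨h1, ?_⟩
      simpa [h1] using h2
    · rintro ⟨h1, h2⟩
      refine ⟨h1, ?_⟩
      simpa [h1] using h2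
  rw [this]
  refine hS.inter (measurableSet_le ?_ measurable_const)
  refine Measurable.norm (Finset.measurable_sum _ fun j _ => ?_)
  exact ((hf j).comp (mΨ j)).smul (mD j)

end SM8

/-- approximate-solution (sublevel set) bound over `B × I`,
`I` a compact interval avoiding 0, when the functional equation has no
nontrivial analytic solution. -/
theorem stmt14
    -- `B` is a nonempty open ball of finite radius, `Bt` a connected open neighborhood of its closure
    (c₀ : Vec2) (r₀ : ℝ) (hr₀ : 0 < r₀)
    (B Bt : Set Vec2) (hB : B = Metric.ball c₀ r₀)
    (hBt_open : IsOpen Bt) (hBt_conn : IsConnected Bt) (hBBt : closure B ⊆ Bt)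
    -- the φⱼ are real analytic submersions on `Bt`
    (φ : Fin 4 → Vec2 → ℝ)
    (hφ_an : ∀ j, AnalyticOnNhd ℝ (φ j) Bt)
    (hφ_sub : ∀ j, ∀ x ∈ Bt, fderiv ℝ (φ j) x ≠ 0)
    -- transversality hypothesis
    (htrans : ∀ x ∈ B, ∀ j k : Fin 4, j ≠ k →
      LinearIndependent ℝ ![fderiv ℝ (φ j) x, fderiv ℝ (φ k) x])
    -- Vⱼ : nowhere vanishing real analytic vector fields with Vⱼ φⱼ ≡ 0
    (V : Fin 4 → Vec2 → Vec2)
    (hV_an : ∀ j, AnalyticOnNhd ℝ (V j) Bt)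
    (hV_ne : ∀ j, ∀ x ∈ Bt, V j x ≠ 0)
    (hV_ker : ∀ j, ∀ x ∈ Bt, fderiv ℝ (φ j) x (V j x) = 0)
    -- auxiliary hypothesis 2
    (W : Fin 4 → Fin 4 → (Vec2 × ℝ) → (Vec2 × ℝ))
    (hW_an : ∀ j k, AnalyticOnNhd ℝ (W j k) (Bt ×ˢ (univ : Set ℝ)))
    (hW_ne : ∀ j k, ∀ p ∈ Bt ×ˢ (univ : Set ℝ), W j k p ≠ 0)
    (hW_ker : ∀ j k, ∀ p ∈ Bt ×ˢ (univ : Set ℝ),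
      fderiv ℝ (fun q : Vec2 × ℝ => ((φ j q.1, q.2 * fderiv ℝ (φ j) q.1 (V k q.1)) : Vec2))
        p (W j k p) = 0)
    (haux2 : ∀ k : Fin 4, ∀ p : Vec2 × ℝ, p.1 ∈ Bt → p.2 ≠ 0 →
      LinearIndependent ℝ (fun j : {j : Fin 4 // j ≠ k} => W j.1 k p))
    -- coordinates are chosen so that φ₄(x₁,x₂) = x₁ on B
    (hφ4 : ∀ x ∈ B, φ 3 x = x.1)
    -- there is no nonzero real analytic solution of the functional equation on any
    -- nonempty open set
    (hnosol : ∀ U : Set (Vec2 × ℝ), IsOpen U → U.Nonempty → U ⊆ {p : Vec2 × ℝ | p.1 ∈ B} →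
      ∀ g : Fin 3 → Vec2 → ℝ,
      (∀ j : Fin 3, AnalyticOnNhd ℝ (g j) (Φmap (φ j.castSucc) '' U)) →
      (∀ p ∈ U, ∑ j : Fin 3, g j (Φmap (φ j.castSucc) p) • fderiv ℝ (φ j.castSucc) p.1 = 0) →
      ∀ j : Fin 3, ∀ p ∈ U, g j (Φmap (φ j.castSucc) p) = 0)
    : ∀ a b : ℝ, a ≤ b → (0 < a ∨ b < 0) →
    ∃ κ : ℝ, 0 < κ ∧ ∃ C : ℝ, ∀ ε : ℝ, 0 < ε → ε ≤ 1 →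
      ∀ f : Fin 3 → Vec2 → ℝ, (∀ j, Measurable (f j)) →
      (∃ i : Fin 3, ∀ p : Vec2 × ℝ, p.1 ∈ B → p.2 ∈ Set.Icc a b →
        1 ≤ |f i (Φmap (φ i.castSucc) p)|) →
      volume {p : Vec2 × ℝ | p.1 ∈ B ∧ p.2 ∈ Set.Icc a b ∧
          ‖∑ j : Fin 3, f j (Φmap (φ j.castSucc) p) • fderiv ℝ (φ j.castSucc) p.1‖ ≤ ε}
        ≤ ENNReal.ofReal (C * ε ^ κ) := by
  intro a b hab _
  have hBo : IsOpen B := by rw [hB]; exact isOpen_ball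
  have hBB : B ⊆ Bt := subset_closure.trans hBBt
  have hBne : c₀ ∈ B := by rw [hB]; exact mem_ball_self hr₀
  have hd3 : ∀ x ∈ B, ∀ v, fderiv ℝ (φ 3) x v = v.1 := by
    intro x hx v
    have : φ 3 =ᶠ[𝓝 x] fun y : Vec2 => y.1 := by
      filter_upwards [hBo.mem_nhds hx] with y hy using hφ4 y hy
    rw [this.fderiv_eq, fderiv_fst]
    rfl
  have hne3 : ∀ j : Fin 3, j.castSucc ≠ (3 : Fin 4) := fun j => (Fin.castSucc_lt_last j).ne
  have hD : ∀ j : Fin 3, ∀ x ∈ B, Dder (φ j.castSucc) x ≠ 0 := by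
    intro j x hx h0
    refine br_ne (φ := φ 3) (ψ := φ j.castSucc) (x, 0) (htrans x hx 3 j.castSucc (hne3 j).symm) ?_
    have e1 : Dder (φ 3) x = 0 := hd3 x hx _
    simp [br, h0, e1]
  have hbr : ∀ i j : Fin 3, i ≠ j → ∀ p : X3, p.1 ∈ B → br (φ i.castSucc) (φ j.castSucc) p ≠ 0 := by
    intro i j hij p hp
    exact br_ne p (htrans p.1 hp _ _ fun h => hij (Fin.castSucc_injective _ h))
  have hfr : ∀ p : X3, p.1 ∈ B → p.2 ≠ 0 → LinearIndependent ℝ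
      ![Tf (φ (0 : Fin 3).castSucc) p, Tf (φ (1 : Fin 3).castSucc) p, Tf (φ (2 : Fin 3).castSucc) p] := by
    intro p hp hs
    have := frame_li B Bt hBo hBB φ hφ_an hD V hV_an hV_ne hV_ker W hW_ker haux2 hd3 p hp hs
    convert this using 1
    funext j; fin_cases j <;> rfl
  obtain ⟨dt, adj, dta, adja, h1, h2⟩ := adj_exists X9 Y8 (by simp)
  have han : ∀ j : Fin 3, AnalyticOnNhd ℝ (φ j.castSucc) Bt := fun j => hφ_an _
  -- some determinant does not vanish identically
  have hex : ∃ ps : X3, ps.1 ∈ B ∧ (Kh dt (φ (0 : Fin 3).castSucc) (φ (1 : Fin 3).castSucc) (φ (2 : Fin 3).castSucc) ps ≠ 0 ∨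
      Kh dt (φ (1 : Fin 3).castSucc) (φ (2 : Fin 3).castSucc) (φ (0 : Fin 3).castSucc) ps ≠ 0 ∨
      Kh dt (φ (2 : Fin 3).castSucc) (φ (0 : Fin 3).castSucc) (φ (1 : Fin 3).castSucc) ps ≠ 0) := by
    by_contra hcon
    push Not at hcon
    set R : Set X3 := B ×ˢ Ioi (0 : ℝ) with hRdef
    have hRo : IsOpen R := hBo.prod isOpen_Ioi
    have hRc : Convex ℝ R := by
      rw [hRdef, hB]; exact (convex_ball _ _).prod (convex_Ioi _)
    have anR : ∀ j : Fin 3, ∀ q ∈ R, AnalyticAt ℝ (φ j.castSucc) q.1 := fun j q hq => han j _ (hBB hq.1)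
    obtain ⟨U, oU, UR, pU, gi, gj, gk, agi, agj, agk, hsum, hgne⟩ :=
      nonvanish R hRo hRc (φ (0 : Fin 3).castSucc) (φ (1 : Fin 3).castSucc) (φ (2 : Fin 3).castSucc)
        (anR 0) (anR 1) (anR 2) (fun p hp => hbr 1 2 (by decide) p hp.1) (fun p hp => hbr 2 0 (by decide) p hp.1)
        (fun p hp => hbr 0 1 (by decide) p hp.1) (fun p hp => hD 0 _ hp.1) (fun p hp => hD 1 _ hp.1)
        (fun p hp => hD 2 _ hp.1) (fun p hp => hfr p hp.1 (ne_of_gt hp.2)) dt adj dta adja h1 h2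
        (fun p hp => (hcon p hp.1).1) (fun p hp => (hcon p hp.1).2.1) (fun p hp => (hcon p hp.1).2.2)
        (c₀, 1) ⟨hBne, Set.mem_Ioi.2 (by norm_num)⟩
    refine hgne ?_
    have := hnosol U oU ⟨_, pU⟩ (fun p hp => (UR hp).1) ![gi, gj, gk] (by
      intro j; fin_cases j
      · exact agi
      · exact agj
      · exact agk) (by
      intro p hp
      rw [Fin.sum_univ_three]
      exact hsum p hp) 0 _ pU
    exact this
  obtain ⟨ps, hps, hcase⟩ := hex
  have hEeq : ∀ (f : Fin 3 → Vec2 → ℝ) (ε : ℝ), {p : Vec2 × ℝ | p.1 ∈ B ∧ p.2 ∈ Set.Icc a b ∧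
          ‖∑ j : Fin 3, f j (Φmap (φ j.castSucc) p) • fderiv ℝ (φ j.castSucc) p.1‖ ≤ ε} =
      (B ×ˢ Icc a b) ∩ {p : X3 | ‖∑ j : Fin 3, f j (Φmap (φ j.castSucc) p) • fderiv ℝ (φ j.castSucc) p.1‖ ≤ ε} := by
    intro f ε; ext p
    constructor
    · rintro ⟨q1, q2, q3⟩; exact ⟨⟨q1, q2⟩, q3⟩
    · rintro ⟨⟨q1, q2⟩, q3⟩; exact ⟨q1, q2, q3⟩
  have hmeas : ∀ (f : Fin 3 → Vec2 → ℝ) (ε : ℝ), (∀ j, Measurable (f j)) → MeasurableSet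
      ((B ×ˢ Icc a b) ∩ {p : X3 | ‖∑ j : Fin 3, f j (Φmap (φ j.castSucc) p) • fderiv ℝ (φ j.castSucc) p.1‖ ≤ ε}) :=
    fun f ε hf => meas_set _ (hBo.measurableSet.prod measurableSet_Icc) (fun j => φ j.castSucc)
      (fun j p hp => han j _ (hBB hp.1)) f hf ε
  have fin : ∀ i j k : Fin 3, i ≠ j → j ≠ k → k ≠ i →
      Kh dt (φ i.castSucc) (φ j.castSucc) (φ k.castSucc) ps ≠ 0 →
      (∀ F : Fin 3 → (Vec2 →L[ℝ] ℝ), F i + F j + F k = ∑ l, F l) → (∀ l : Fin 3, l = i ∨ l = j ∨ l = k) →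
      ∃ κ : ℝ, 0 < κ ∧ ∃ C : ℝ, ∀ ε : ℝ, 0 < ε → ε ≤ 1 →
      ∀ f : Fin 3 → Vec2 → ℝ, (∀ j, Measurable (f j)) →
      (∃ i : Fin 3, ∀ p : Vec2 × ℝ, p.1 ∈ B → p.2 ∈ Set.Icc a b →
        1 ≤ |f i (Φmap (φ i.castSucc) p)|) →
      volume {p : Vec2 × ℝ | p.1 ∈ B ∧ p.2 ∈ Set.Icc a b ∧
          ‖∑ j : Fin 3, f j (Φmap (φ j.castSucc) p) • fderiv ℝ (φ j.castSucc) p.1‖ ≤ ε}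
        ≤ ENNReal.ofReal (C * ε ^ κ) := by
    intro i j k hij hjk hki hKh hsum hl
    obtain ⟨κ, hκ, C, H⟩ := est_one c₀ r₀ hr₀ B Bt hB hBt_open hBt_conn hBBt
      (φ i.castSucc) (φ j.castSucc) (φ k.castSucc) (han i) (han j) (han k)
      (hbr j k hjk) (hbr k i hki) (hbr i j hij) (hD i) (hD j) (hD k) dt adj dta adja h1 ps hps hKh a b hab
    refine ⟨κ, hκ, C, fun ε e0 e1 f hf hex => ?_⟩
    rw [hEeq]
    refine H ε e0 e1 (f i) (f j) (f k) _ (hf i) (hmeas f ε hf) inter_subset_left ?_ ?_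
    · rintro p ⟨_, hp⟩
      have := hsum (fun l => f l (Φmap (φ l.castSucc) p) • fderiv ℝ (φ l.castSucc) p.1)
      rw [this]; exact hp
    · rintro p ⟨hp, _⟩
      obtain ⟨l, hl1⟩ := hex
      have := hl1 p hp.1 hp.2
      rcases hl l with rfl | rfl | rfl
      · exact Or.inl this
      · exact Or.inr (Or.inl this)
      · exact Or.inr (Or.inr this)
  rcases hcase with h | h | h
  · exact fin 0 1 2 (by decide) (by decide) (by decide) h (fun F => by rw [Fin.sum_univ_three]) (by decide)
  · exact fin 1 2 0 (by decide) (by decide) (by decide) h (fun F => by rw [Fin.sum_univ_three]; abel) (by decide)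
  · exact fin 2 0 1 (by decide) (by decide) (by decide) h (fun F => by rw [Fin.sum_univ_three]; abel) (by decide)
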